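/- Every Borel subset X of the Cantor space is σ-homogeneous; that is, X can be written as a countable union of subspaces X_i such that each X_i is closed in X and each X_i, with the subspace topology, is h-homogeneous. -/

import Mathlib

/-- A topological space is *h-homogeneous* if every nonempty clopen subset,
with the subspace topology, is homeomorphic to the whole space. -/
def HHomogeneous (Y : Type*) [TopologicalSpace Y] : Prop :=
  ∀ U : Set Y, IsClopen U → U.Nonempty → Nonempty (U ≃ₜ Y)


section
namespace SH

abbrev Cs := ℕ → Bool

/-- relative nowhere density -/
def NwdIn (D U : Set Cs) : Prop :=
  ∀ O, IsOpen O → (U ∩ O).Nonempty → ((U ∩ O) \ D).Nonempty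

/-- nonempty clopen part -/
def Part (U K : Set Cs) : Prop := U.Nonempty ∧ ∃ W, IsClopen W ∧ U = K ∩ W

def Perf (U : Set Cs) : Prop := ∀ x, NwdIn {x} U

theorem Part.trans {U V K : Set Cs} (h : Part U V) (h' : Part V K) : Part U K := by
  obtain ⟨n, W, hW, rfl⟩ := h
  obtain ⟨n', W', hW', rfl⟩ := h'
  exact ⟨n, W' ∩ W, hW'.inter hW, by rw [Set.inter_assoc]⟩

theorem Part.refl {U : Set Cs} (h : U.Nonempty) : Part U U :=
  ⟨h, Set.univ, isClopen_univ, by simp⟩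

theorem Part.subset {U K : Set Cs} (h : Part U K) : U ⊆ K := by
  obtain ⟨_, W, _, rfl⟩ := h; exact Set.inter_subset_left

theorem Part.closed {U K : Set Cs} (h : Part U K) (hK : IsClosed K) : IsClosed U := by
  obtain ⟨_, W, hW, rfl⟩ := h; exact hK.inter hW.1

theorem Part.mk' {K W : Set Cs} (hW : IsClopen W) (h : (K ∩ W).Nonempty) : Part (K ∩ W) K :=
  ⟨h, W, hW, rfl⟩

theorem clopen_nhd {O : Set Cs} (hO : IsOpen O) {x : Cs} (hx : x ∈ O) :
    ∃ W, IsClopen W ∧ x ∈ W ∧ W ⊆ O := by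
  obtain ⟨W, hW, hxW, hWO⟩ := compact_exists_isClopen_in_isOpen hO hx
  exact ⟨W, hW, hxW, hWO⟩

theorem NwdIn.mono {D D' U : Set Cs} (h : NwdIn D U) (hD : D' ⊆ D) : NwdIn D' U :=
  fun O hO hn => (h O hO hn).mono (Set.sdiff_subset_sdiff_right hD)

theorem NwdIn.union {D D' U : Set Cs} (hDc : IsClosed D) (h : NwdIn D U) (h' : NwdIn D' U) :
    NwdIn (D ∪ D') U := by
  intro O hO hn
  obtain ⟨y, ⟨hyU, hyO⟩, hyD⟩ := h O hO hn
  obtain ⟨w, ⟨hwU, hwO, hwD⟩, hw'⟩ := h' (O ∩ Dᶜ) (hO.inter hDc.isOpen_compl) ⟨y, hyU, hyO, hyD⟩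
  exact ⟨w, ⟨hwU, hwO⟩, fun h => h.elim hwD hw'⟩

theorem NwdIn.empty (U : Set Cs) : NwdIn ∅ U := fun O _ hn => by simpa using hn

theorem NwdIn.biUnion {U : Set Cs} (C : ℕ → Set Cs) (hC : ∀ i, IsClosed (C i))
    (h : ∀ i, NwdIn (C i) U) (n : ℕ) : IsClosed (⋃ i < n, C i) ∧ NwdIn (⋃ i < n, C i) U := by
  induction n with
  | zero => simp [NwdIn.empty]
  | succ n ih =>
    have : (⋃ i < n+1, C i) = (⋃ i < n, C i) ∪ C n := by
      ext x; simp only [Set.mem_iUnion, Set.mem_union, exists_prop]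
      constructor
      · rintro ⟨i, hi, hx⟩
        rcases Nat.lt_succ_iff_lt_or_eq.1 hi with h | rfl
        · exact Or.inl ⟨i, h, hx⟩
        · exact Or.inr hx
      · rintro (⟨i, hi, hx⟩ | hx)
        · exact ⟨i, by omega, hx⟩
        · exact ⟨n, by omega, hx⟩
    rw [this]
    exact ⟨ih.1.union (hC n), ih.2.union ih.1 (h n)⟩

theorem NwdIn.interOpen {D U W : Set Cs} (h : NwdIn D U) (hW : IsOpen W) : NwdIn D (U ∩ W) := by
  intro O hO hn
  rw [Set.inter_assoc] at hn ⊢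
  exact h _ (hW.inter hO) hn

theorem NwdIn.part {D U V : Set Cs} (h : NwdIn D U) (hV : Part V U) : NwdIn D V := by
  obtain ⟨_, W, hW, rfl⟩ := hV
  exact h.interOpen hW.2

theorem Perf.part {U V : Set Cs} (h : Perf U) (hV : Part V U) : Perf V := fun x => (h x).part hV

/-- avoid a closed nowhere dense set -/
theorem NwdIn.avoid {D U : Set Cs} (hD : IsClosed D) (h : NwdIn D U) {O : Set Cs} (hO : IsOpen O)
    (hn : (U ∩ O).Nonempty) : ∃ W, IsClopen W ∧ W ⊆ O ∧ (U ∩ W).Nonempty ∧ Disjoint W D := by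
  obtain ⟨y, ⟨hyU, hyO⟩, hyD⟩ := h O hO hn
  obtain ⟨W, hW, hyW, hWO⟩ := clopen_nhd (hO.inter hD.isOpen_compl) ⟨hyO, hyD⟩
  exact ⟨W, hW, fun x hx => (hWO hx).1, ⟨y, hyU, hyW⟩,
    Set.disjoint_left.2 fun x hx => (hWO hx).2⟩

theorem NwdIn.extend {D U W : Set Cs} (h : NwdIn D (U ∩ W)) (hW : IsOpen W) (hD : D ⊆ W)
    (hc : IsClosed W) : NwdIn D U := by
  intro O hO ⟨x, hxU, hxO⟩
  by_cases hx : x ∈ W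
  · obtain ⟨y, ⟨⟨h1, h2⟩, h3⟩, h4⟩ := h O hO ⟨x, ⟨hxU, hx⟩, hxO⟩
    exact ⟨y, ⟨h1, h3⟩, h4⟩
  · exact ⟨x, ⟨hxU, hxO⟩, fun hd => hx (hD hd)⟩

theorem NwdIn.ofPart {D U V : Set Cs} (h : NwdIn D V) (hV : Part V U) (hD : D ⊆ V) : NwdIn D U := by
  obtain ⟨_, W, hW, rfl⟩ := hV
  exact h.extend hW.2 (fun x hx => (hD hx).2) hW.1

/-- D nwd in a closed subset of U is nwd in U -/
theorem NwdIn.ofSubset {D E U : Set Cs} (h : NwdIn D E) (hE : IsClosed E) (hEU : E ⊆ U)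
    (hD : D ⊆ E) : NwdIn D U := by
  intro O hO ⟨x, hxU, hxO⟩
  by_cases hx : x ∈ E
  · obtain ⟨y, ⟨h1, h3⟩, h4⟩ := h O hO ⟨x, hx, hxO⟩
    exact ⟨y, ⟨hEU h1, h3⟩, h4⟩
  · exact ⟨x, ⟨hxU, hxO⟩, fun hd => hx (hD hd)⟩

/-! ### partial embeddings -/

structure PE (A B : Set Cs) (R : Set (Cs × Cs)) : Prop where
  cpt : IsCompact R
  inj1 : ∀ a b b', (a, b) ∈ R → (a, b') ∈ R → b = b'
  inj2 : ∀ a a' b, (a, b) ∈ R → (a', b) ∈ R → a = a'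
  resp : ∀ a b, (a, b) ∈ R → (a ∈ A ↔ b ∈ B)

def dom (R : Set (Cs × Cs)) : Set Cs := Prod.fst '' R
def ran (R : Set (Cs × Cs)) : Set Cs := Prod.snd '' R

theorem mem_dom {R : Set (Cs × Cs)} {x : Cs} : x ∈ dom R ↔ ∃ y, (x, y) ∈ R := by
  simp [dom]
theorem mem_ran {R : Set (Cs × Cs)} {x : Cs} : x ∈ ran R ↔ ∃ y, (y, x) ∈ R := by
  simp [ran]
theorem PE.domC {A B : Set Cs} {R : Set (Cs × Cs)} (h : PE A B R) : IsClosed (dom R) :=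
  (h.cpt.image continuous_fst).isClosed
theorem PE.ranC {A B : Set Cs} {R : Set (Cs × Cs)} (h : PE A B R) : IsClosed (ran R) :=
  (h.cpt.image continuous_snd).isClosed

def PEmb (A B C U : Set Cs) : Prop := ∃ R, PE A B R ∧ dom R = C ∧ ran R ⊆ U
def Emb (A B C U : Set Cs) : Prop := ∃ R, PE A B R ∧ dom R = C ∧ ran R ⊆ U ∧ NwdIn (ran R) U

theorem Emb.pemb {A B C U : Set Cs} (h : Emb A B C U) : PEmb A B C U := by
  obtain ⟨R, h1, h2, h3, _⟩ := h; exact ⟨R, h1, h2, h3⟩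

theorem PE.restr {A B : Set Cs} {R S : Set (Cs × Cs)} (h : PE A B R) (hS : IsClosed S) :
    PE A B (R ∩ S) where
  cpt := h.cpt.inter_right hS
  inj1 a b b' h1 h2 := h.inj1 a b b' h1.1 h2.1
  inj2 a b b' h1 h2 := h.inj2 a b b' h1.1 h2.1
  resp a b h1 := h.resp a b h1.1

theorem PE.swap {A B : Set Cs} {R : Set (Cs × Cs)} (h : PE A B R) : PE B A (Prod.swap '' R) where
  cpt := h.cpt.image continuous_swap
  inj1 a b b' h1 h2 := h.inj2 b b' a (by simpa using h1) (by simpa using h2)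
  inj2 a a' b h1 h2 := h.inj1 b a a' (by simpa using h1) (by simpa using h2)
  resp a b h1 := (h.resp b a (by simpa using h1)).symm

theorem dom_swap (R : Set (Cs × Cs)) : dom (Prod.swap '' R) = ran R := by
  ext x; simp [mem_dom, mem_ran]
theorem ran_swap (R : Set (Cs × Cs)) : ran (Prod.swap '' R) = dom R := by
  ext x; simp [mem_dom, mem_ran]

theorem PE.compl {A B : Set Cs} {R : Set (Cs × Cs)} (h : PE A B R) : PE Aᶜ Bᶜ R where
  cpt := h.cpt
  inj1 := h.inj1
  inj2 := h.inj2
  resp a b h1 := not_congr (h.resp a b h1)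

theorem PE.union {A B : Set Cs} {R S : Set (Cs × Cs)} (h : PE A B R) (hS : PE A B S)
    (hd : Disjoint (dom R) (dom S)) (hr : Disjoint (ran R) (ran S)) : PE A B (R ∪ S) := by
  have hd' : ∀ {a b b'}, (a, b) ∈ R → (a, b') ∈ S → False := fun h1 h2 =>
    Set.disjoint_left.1 hd (mem_dom.2 ⟨_, h1⟩) (mem_dom.2 ⟨_, h2⟩)
  have hr' : ∀ {a a' b}, (a, b) ∈ R → (a', b) ∈ S → False := fun h1 h2 =>
    Set.disjoint_left.1 hr (mem_ran.2 ⟨_, h1⟩) (mem_ran.2 ⟨_, h2⟩)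
  refine ⟨h.cpt.union hS.cpt, ?_, ?_, ?_⟩
  · rintro a b b' (h1 | h1) (h2 | h2)
    · exact h.inj1 _ _ _ h1 h2
    · exact (hd' h1 h2).elim
    · exact (hd' h2 h1).elim
    · exact hS.inj1 _ _ _ h1 h2
  · rintro a b b' (h1 | h1) (h2 | h2)
    · exact h.inj2 _ _ _ h1 h2
    · exact (hr' h1 h2).elim
    · exact (hr' h2 h1).elim
    · exact hS.inj2 _ _ _ h1 h2
  · rintro a b (h1 | h1)
    · exact h.resp _ _ h1
    · exact hS.resp _ _ h1

/-- composition of relations -/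
def rcomp (R S : Set (Cs × Cs)) : Set (Cs × Cs) := {p | ∃ b, (p.1, b) ∈ R ∧ (b, p.2) ∈ S}

theorem PE.comp {A B D : Set Cs} {R S : Set (Cs × Cs)} (h : PE A B R) (hS : PE B D S) :
    PE A D (rcomp R S) := by
  refine ⟨?_, ?_, ?_, ?_⟩
  · have : rcomp R S = (fun q : (Cs × Cs) × (Cs × Cs) => (q.1.1, q.2.2)) ''
        ((R ×ˢ S) ∩ {q | q.1.2 = q.2.1}) := by
      ext ⟨a, c⟩
      simp only [rcomp, Set.mem_ofPred_eq, Set.mem_image, Set.mem_inter_iff, Set.mem_prod,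
        Prod.exists, Prod.mk.injEq]
      constructor
      · rintro ⟨b, h1, h2⟩; exact ⟨a, b, b, c, ⟨⟨h1, h2⟩, rfl⟩, rfl, rfl⟩
      · rintro ⟨a, b, b', c, ⟨⟨h1, h2⟩, rfl⟩, rfl, rfl⟩; exact ⟨_, h1, h2⟩
    rw [this]
    refine ((h.cpt.prod hS.cpt).inter_right ?_).image (by fun_prop)
    exact isClosed_eq (by fun_prop) (by fun_prop)
  · rintro a b b' ⟨c, h1, h2⟩ ⟨c', h3, h4⟩
    obtain rfl := h.inj1 _ _ _ h1 h3
    exact hS.inj1 _ _ _ h2 h4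
  · rintro a b b' ⟨c, h1, h2⟩ ⟨c', h3, h4⟩
    obtain rfl := hS.inj2 _ _ _ h2 h4
    exact h.inj2 _ _ _ h1 h3
  · rintro a b ⟨c, h1, h2⟩
    exact (h.resp _ _ h1).trans (hS.resp _ _ h2)

theorem dom_rcomp {R S : Set (Cs × Cs)} (h : ran R ⊆ dom S) : dom (rcomp R S) = dom R := by
  ext x
  simp only [mem_dom, rcomp, Set.mem_ofPred_eq]
  constructor
  · rintro ⟨y, b, h1, _⟩; exact ⟨b, h1⟩
  · rintro ⟨b, h1⟩
    obtain ⟨y, hy⟩ := mem_dom.1 (h (mem_ran.2 ⟨x, h1⟩))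
    exact ⟨y, b, h1, hy⟩

theorem ran_rcomp (R S : Set (Cs × Cs)) : ran (rcomp R S) ⊆ ran S := by
  intro x hx
  obtain ⟨y, b, _, h⟩ := mem_ran.1 hx
  exact mem_ran.2 ⟨b, h⟩

theorem PEmb.trans_emb {A B D C E U : Set Cs} (h : PEmb A B C E) (h' : Emb B D E U) :
    Emb A D C U := by
  obtain ⟨R, hR, rfl, hr⟩ := h
  obtain ⟨S, hS, rfl, hs, hn⟩ := h'
  exact ⟨rcomp R S, hR.comp hS, dom_rcomp hr, (ran_rcomp R S).trans hs, hn.mono (ran_rcomp R S)⟩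

theorem PEmb.mono_left {A B C C' U : Set Cs} (h : PEmb A B C U) (hC : C' ⊆ C) (hc : IsClosed C') :
    PEmb A B C' U := by
  obtain ⟨R, hR, rfl, hr⟩ := h
  refine ⟨R ∩ (Prod.fst ⁻¹' C'), hR.restr (hc.preimage continuous_fst), ?_, ?_⟩
  · ext x; constructor
    · intro hx; obtain ⟨y, hy⟩ := mem_dom.1 hx; exact hy.2
    · intro hx; obtain ⟨y, hy⟩ := mem_dom.1 (hC hx); exact mem_dom.2 ⟨y, hy, hx⟩
  · rintro x hx; obtain ⟨y, hy⟩ := mem_ran.1 hx; exact hr (mem_ran.2 ⟨y, hy.1⟩)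

theorem Emb.mono_left {A B C C' U : Set Cs} (h : Emb A B C U) (hC : C' ⊆ C) (hc : IsClosed C') :
    Emb A B C' U := by
  obtain ⟨R, hR, rfl, hr, hn⟩ := h
  have hsub : ran (R ∩ (Prod.fst ⁻¹' C')) ⊆ ran R := by
    rintro x hx; obtain ⟨y, hy⟩ := mem_ran.1 hx; exact (mem_ran.2 ⟨y, hy.1⟩)
  refine ⟨R ∩ (Prod.fst ⁻¹' C'), hR.restr (hc.preimage continuous_fst), ?_, hsub.trans hr,
    hn.mono hsub⟩
  ext x; constructor
  · intro hx; obtain ⟨y, hy⟩ := mem_dom.1 hx; exact hy.2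
  · intro hx; obtain ⟨y, hy⟩ := mem_dom.1 (hC hx); exact mem_dom.2 ⟨y, hy, hx⟩

theorem PEmb.emb_of_nwd {A B C E U : Set Cs} (h : PEmb A B C E) (hE : E ⊆ U) (hn : NwdIn E U) :
    Emb A B C U := by
  obtain ⟨R, hR, rfl, hr⟩ := h
  exact ⟨R, hR, rfl, hr.trans hE, hn.mono hr⟩

theorem Emb.mono_right {A B C E U : Set Cs} (h : Emb A B C E) (hc : IsClosed E) (hE : E ⊆ U) :
    Emb A B C U := by
  obtain ⟨R, hR, rfl, hr, hn⟩ := h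
  exact ⟨R, hR, rfl, hr.trans hE, hn.ofSubset hc hE hr⟩

theorem PEmb.compl {A B C U : Set Cs} (h : PEmb A B C U) : PEmb Aᶜ Bᶜ C U := by
  obtain ⟨R, hR, h⟩ := h; exact ⟨R, hR.compl, h⟩
theorem Emb.compl {A B C U : Set Cs} (h : Emb A B C U) : Emb Aᶜ Bᶜ C U := by
  obtain ⟨R, hR, h⟩ := h; exact ⟨R, hR.compl, h⟩

theorem PE.id {A C : Set Cs} (hC : IsClosed C) : PE A A ((fun x => (x, x)) '' C) := by
  refine ⟨hC.isCompact.image (by fun_prop), ?_, ?_, ?_⟩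
  · rintro a b b' ⟨x, _, h⟩ ⟨x', _, h'⟩; simp only [Prod.mk.injEq] at h h'; aesop
  · rintro a b b' ⟨x, _, h⟩ ⟨x', _, h'⟩; simp only [Prod.mk.injEq] at h h'; aesop
  · rintro a b ⟨x, _, h⟩; simp only [Prod.mk.injEq] at h; aesop

theorem PEmb.id {A C U : Set Cs} (hC : IsClosed C) (hU : C ⊆ U) : PEmb A A C U := by
  refine ⟨_, PE.id hC, ?_, ?_⟩
  · ext x; simp [mem_dom]
  · intro x hx; obtain ⟨y, z, hz, h⟩ := mem_ran.1 hx
    simp only [Prod.mk.injEq] at h; rw [← h.2]; exact hU hz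

/-! ### exhaustion and Baire -/

def Sig (J : Set Cs → Prop) (K : Set Cs) : Prop :=
  ∃ S : Set (Set Cs), S.Countable ∧ (∀ E ∈ S, IsClosed E ∧ J E) ∧ K ⊆ ⋃₀ S

theorem Sig.mono {J : Set Cs → Prop} {K K' : Set Cs} (h : Sig J K) (hK : K' ⊆ K) : Sig J K' := by
  obtain ⟨S, h1, h2, h3⟩ := h; exact ⟨S, h1, h2, hK.trans h3⟩

theorem Sig.of {J : Set Cs → Prop} {K : Set Cs} (hc : IsClosed K) (h : J K) : Sig J K :=
  ⟨{K}, Set.countable_singleton _, by rintro E rfl; exact ⟨hc, h⟩, by simp⟩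

theorem Sig.imp {J J' : Set Cs → Prop} {K : Set Cs} (hJ : ∀ E, J E → J' E) (h : Sig J K) :
    Sig J' K := by
  obtain ⟨S, h1, h2, h3⟩ := h; exact ⟨S, h1, fun E hE => ⟨(h2 E hE).1, hJ _ (h2 E hE).2⟩, h3⟩

theorem Sig.iUnion {J : Set Cs → Prop} {ι : Sort*} [Countable ι] {K : ι → Set Cs}
    (h : ∀ i, Sig J (K i)) : Sig J (⋃ i, K i) := by
  choose S h1 h2 h3 using h
  refine ⟨⋃ i, S i, Set.countable_iUnion h1, ?_, ?_⟩
  · intro E hE; obtain ⟨i, hi⟩ := Set.mem_iUnion.1 hE; exact h2 i E hi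
  · intro x hx; obtain ⟨i, hi⟩ := Set.mem_iUnion.1 hx
    obtain ⟨E, hE, hx⟩ := h3 i hi
    exact ⟨E, Set.mem_iUnion.2 ⟨i, hE⟩, hx⟩

theorem Sig.union {J : Set Cs → Prop} {K K' : Set Cs} (h : Sig J K) (h' : Sig J K') :
    Sig J (K ∪ K') := by
  rw [Set.union_eq_iUnion]; exact Sig.iUnion (by rintro (_ | _) <;> assumption)

theorem Sig.seq {J : Set Cs → Prop} {K : Set Cs} (h : Sig J K) (h0 : J ∅) :
    ∃ E : ℕ → Set Cs, (∀ i, IsClosed (E i) ∧ J (E i)) ∧ K ⊆ ⋃ i, E i := by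
  obtain ⟨S, h1, h2, h3⟩ := h
  obtain ⟨E, hE⟩ := (h1.insert ∅).exists_eq_range ⟨∅, Set.mem_insert _ _⟩
  refine ⟨E, fun i => ?_, ?_⟩
  · have : E i ∈ insert ∅ S := hE ▸ Set.mem_range_self i
    rcases this with h | h
    · rw [h]; exact ⟨isClosed_empty, h0⟩
    · exact h2 _ h
  · intro x hx; obtain ⟨F, hF, hx⟩ := h3 hx
    have : F ∈ Set.range E := hE ▸ Set.mem_insert_of_mem _ hF
    obtain ⟨i, rfl⟩ := this
    exact Set.mem_iUnion.2 ⟨i, hx⟩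

theorem countable_clopens : {W : Set Cs | IsClopen W}.Countable := by
  have : Countable (TopologicalSpace.Clopens Cs) :=
    TopologicalSpace.Clopens.countable_iff_secondCountable.2 inferInstance
  have h := Set.countable_range (fun W : TopologicalSpace.Clopens Cs => (W : Set Cs))
  refine h.mono fun W hW => ?_
  exact Set.mem_range.2 ⟨⟨W, hW⟩, rfl⟩

theorem exhaustion (J : Set Cs → Prop) {K : Set Cs} (hK : IsClosed K) (h : ¬ Sig J K) :
    ∃ Z, IsClosed Z ∧ Z.Nonempty ∧ Z ⊆ K ∧
      ∀ W, IsClopen W → (Z ∩ W).Nonempty → ¬ Sig J (Z ∩ W) := by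
  let Q : Set (Set Cs) := {W | IsClopen W ∧ Sig J (K ∩ W)}
  have hQ : Q.Countable := countable_clopens.mono fun W h => h.1
  have := hQ.to_subtype
  have hU : Sig J (⋃ W : Q, K ∩ W.1) := Sig.iUnion fun W => W.2.2
  have hopen : IsOpen (⋃₀ Q) := isOpen_sUnion fun W hW => hW.1.2
  have hsub : K ∩ ⋃₀ Q ⊆ ⋃ W : Q, K ∩ W.1 := by
    rintro x ⟨hx, W, hW, hxW⟩; exact Set.mem_iUnion.2 ⟨⟨W, hW⟩, hx, hxW⟩
  refine ⟨K \ ⋃₀ Q, hK.sdiff hopen, ?_, Set.sdiff_subset, ?_⟩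
  · by_contra hne
    rw [Set.not_nonempty_iff_eq_empty, Set.sdiff_eq_empty] at hne
    exact h (hU.mono fun x hx => hsub ⟨hx, hne hx⟩)
  · rintro W hW ⟨x, ⟨hxK, hxQ⟩, hxW⟩ hs
    refine hxQ ⟨W, ⟨hW, (hs.union hU).mono ?_⟩, hxW⟩
    rintro y ⟨hyK, hyW⟩
    by_cases hy : y ∈ ⋃₀ Q
    · exact Or.inr (hsub ⟨hyK, hy⟩)
    · exact Or.inl ⟨⟨hyK, hy⟩, hyW⟩

theorem baire {C : Set Cs} (hC : IsClosed C) (hn : C.Nonempty) {J : Set Cs → Prop} (h : Sig J C) :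
    ∃ E, IsClosed E ∧ J E ∧ ∃ W, IsClopen W ∧ (C ∩ W).Nonempty ∧ C ∩ W ⊆ E := by
  obtain ⟨S, h1, h2, h3⟩ := h
  have : CompactSpace C := isCompact_iff_compactSpace.1 hC.isCompact
  have := hn.to_subtype
  have := h1.to_subtype
  obtain ⟨E, hE⟩ := nonempty_interior_of_iUnion_of_closed
    (f := fun E : S => (Subtype.val ⁻¹' E.1 : Set C))
    (fun E => (h2 _ E.2).1.preimage continuous_subtype_val) (by
      ext x; simp only [Set.mem_iUnion, Set.mem_preimage, Set.mem_univ, iff_true]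
      obtain ⟨E, hE, hx⟩ := h3 x.2
      exact ⟨⟨E, hE⟩, hx⟩)
  obtain ⟨x, hx⟩ := hE
  obtain ⟨O, hO, hOi⟩ := isOpen_induced_iff.1 (isOpen_interior (s := (Subtype.val ⁻¹' E.1 : Set C)))
  have hxO : x.1 ∈ O := by
    have : x ∈ (Subtype.val ⁻¹' O : Set C) := hOi ▸ hx
    exact this
  obtain ⟨W, hW, hxW, hWO⟩ := clopen_nhd hO hxO
  refine ⟨E, (h2 _ E.2).1, (h2 _ E.2).2, W, hW, ⟨x, x.2, hxW⟩, ?_⟩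
  rintro y ⟨hyC, hyW⟩
  have : (⟨y, hyC⟩ : C) ∈ (Subtype.val ⁻¹' O : Set C) := hWO hyW
  rw [hOi] at this
  have h5 := interior_subset this
  exact h5

end SH

end

section
namespace SH

structure St where
  W : Set Cs
  W' : Set Cs
  R : Set (Cs × Cs)

def St.swap (s : St) : St := ⟨s.W', s.W, Prod.swap '' s.R⟩

structure Inv (A K K' : Set Cs) (s : St) : Prop where
  pW : Part s.W K
  pW' : Part s.W' K'
  pe : PE A A s.R
  sub : s.R ⊆ s.W ×ˢ s.W'
  n1 : NwdIn (dom s.R) s.W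
  n2 : NwdIn (ran s.R) s.W'

theorem St.swap_swap (s : St) : s.swap.swap = s := by
  cases s; simp [St.swap, Set.image_image]

theorem Inv.swap {A K K' : Set Cs} {s : St} (h : Inv A K K' s) : Inv A K' K s.swap where
  pW := h.pW'
  pW' := h.pW
  pe := h.pe.swap
  sub := by
    rintro _ ⟨p, hp, rfl⟩
    exact ⟨(h.sub hp).2, (h.sub hp).1⟩
  n1 := by simp only [St.swap, dom_swap]; exact h.n2
  n2 := by simp only [St.swap, ran_swap]; exact h.n1

def Agree (n : ℕ) (W : Set Cs) : Prop := ∀ x ∈ W, ∀ y ∈ W, ∀ j < n, x j = y j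

structure SplitP (s : St) (t : Bool → St) : Prop where
  c1 : ∀ x ∈ s.W, ∃ b, x ∈ (t b).W
  c1' : ∀ x ∈ s.W', ∃ b, x ∈ (t b).W'
  s1 : ∀ b, (t b).W ⊆ s.W
  s1' : ∀ b, (t b).W' ⊆ s.W'
  d1 : ∀ b b' x, x ∈ (t b).W → x ∈ (t b').W → b = b'
  d1' : ∀ b b' x, x ∈ (t b).W' → x ∈ (t b').W' → b = b'
  r : ∀ p ∈ s.R, ∃ b, p ∈ (t b).R
  rs : ∀ b, (t b).R ⊆ (t b).W ×ˢ (t b).W'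

theorem SplitP.swap {s : St} {t : Bool → St} (h : SplitP s t) :
    SplitP s.swap (fun b => (t b).swap) where
  c1 := h.c1'
  c1' := h.c1
  s1 := h.s1'
  s1' := h.s1
  d1 := h.d1'
  d1' := h.d1
  r := by
    rintro _ ⟨p, hp, rfl⟩
    obtain ⟨b, hb⟩ := h.r p hp
    exact ⟨b, p, hb, rfl⟩
  rs := by
    rintro b _ ⟨p, hp, rfl⟩
    exact ⟨(h.rs b hp).2, (h.rs b hp).1⟩

structure StepP (C G F' : Set Cs) (s : St) (t : Bool → St) : Prop extends SplitP s t where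
  fr : ∀ b, ran (t b).R ∩ F' ⊆ ran s.R
  alt : ((∀ x ∈ C ∩ s.W, ∃ b, x ∈ dom (t b).R) ∧ (∀ b, dom (t b).R ⊆ dom s.R ∪ (C ∩ s.W)) ∧
      Disjoint (C ∩ s.W) G) ∨
    (¬ Disjoint (C ∩ s.W) (dom s.R ∪ G) ∧ ∀ b, dom (t b).R ⊆ dom s.R)
  ag : ∀ n, Agree n s.W → ∀ b, Agree (n+1) (t b).W

theorem ran_mono {R S : Set (Cs × Cs)} (h : R ⊆ S) : ran R ⊆ ran S := Set.image_mono h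
theorem dom_mono {R S : Set (Cs × Cs)} (h : R ⊆ S) : dom R ⊆ dom S := Set.image_mono h
theorem ran_union (R S : Set (Cs × Cs)) : ran (R ∪ S) = ran R ∪ ran S := Set.image_union ..
theorem dom_union (R S : Set (Cs × Cs)) : dom (R ∪ S) = dom R ∪ dom S := Set.image_union ..

theorem add_step {A K K' : Set Cs} (hK : IsClosed K) (hK' : IsClosed K') {s : St}
    (h : Inv A K K' s) {C F' : Set Cs} (G : Set Cs) (hC : IsClosed C) (hCn : NwdIn C K)
    (hE : ∀ O', Part O' K' → Emb A A C O') (hF : IsClosed F') (hFn : NwdIn F' K') :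
    ∃ R, Inv A K K' ⟨s.W, s.W', R⟩ ∧ s.R ⊆ R ∧ ran R ∩ F' ⊆ ran s.R ∧
      ((C ∩ s.W ⊆ dom R ∧ dom R ⊆ dom s.R ∪ (C ∩ s.W) ∧ Disjoint (C ∩ s.W) G) ∨
      (¬ Disjoint (C ∩ s.W) (dom s.R ∪ G) ∧ dom R ⊆ dom s.R)) := by
  by_cases hd : Disjoint (C ∩ s.W) (dom s.R ∪ G)
  swap
  · exact ⟨s.R, h, le_rfl, Set.inter_subset_left, Or.inr ⟨hd, le_rfl⟩⟩
  have hn : NwdIn (ran s.R ∪ F') s.W' := h.n2.union h.pe.ranC (hFn.part h.pW')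
  obtain ⟨O, hO, -, hne, hOd⟩ := hn.avoid (h.pe.ranC.union hF) isOpen_univ
    (by simpa using h.pW'.1)
  have hp : Part (s.W' ∩ O) s.W' := Part.mk' hO hne
  obtain ⟨S, hS, hSd, hSr, hSn⟩ := (hE _ (hp.trans h.pW')).mono_left
    (C' := C ∩ s.W) Set.inter_subset_left (hC.inter (h.pW.closed hK))
  rw [Set.disjoint_union_right] at hd
  rw [Set.disjoint_union_right] at hOd
  refine ⟨s.R ∪ S, ⟨h.pW, h.pW', h.pe.union hS ?_ ?_, ?_, ?_, ?_⟩, Set.subset_union_left, ?_, ?_⟩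
  · rw [hSd]; exact hd.1.symm
  · exact hOd.1.symm.mono_right fun x hx => (hSr hx).2
  · rintro ⟨a, b⟩ (hp | hp)
    · exact h.sub hp
    · refine ⟨?_, (hSr (mem_ran.2 ⟨_, hp⟩)).1⟩
      have : a ∈ dom S := mem_dom.2 ⟨_, hp⟩
      rw [hSd] at this; exact this.2
  · simp only [dom_union, hSd]
    exact h.n1.union h.pe.domC ((hCn.part h.pW).mono Set.inter_subset_left)
  · simp only [ran_union]
    exact h.n2.union h.pe.ranC (hSn.ofPart hp hSr)
  · rw [ran_union]
    rintro x ⟨hx | hx, hxF⟩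
    · exact hx
    · exact (Set.disjoint_left.1 hOd.2 (hSr hx).2 hxF).elim
  · left
    rw [dom_union, hSd]
    exact ⟨Set.subset_union_right, le_rfl, hd.2⟩

theorem clopen_sep {D E : Set Cs} (hD : IsClosed D) (hE : IsClosed E) (h : Disjoint D E) :
    ∃ O, IsClopen O ∧ D ⊆ O ∧ Disjoint O E := by
  obtain ⟨O, h1, h2, h3⟩ := exists_clopen_of_closed_subset_open hD hE.isOpen_compl
    (Set.subset_compl_iff_disjoint_right.2 h)
  exact ⟨O, h1, h2, Set.subset_compl_iff_disjoint_right.1 h3⟩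

theorem isClopen_coord (n : ℕ) (b : Bool) : IsClopen {x : Cs | x n = b} :=
  (isClopen_discrete ({b} : Set Bool)).preimage (continuous_apply n)

theorem split_step {A K K' : Set Cs} (hK : IsClosed K) (hK' : IsClosed K') (hp : Perf K)
    (hp' : Perf K') {s : St} (h : Inv A K K' s) :
    ∃ t : Bool → St, (∀ b, Inv A K K' (t b)) ∧ SplitP s t ∧ (∀ b, (t b).R ⊆ s.R) ∧
      ∀ n, Agree n s.W → ∀ b, Agree (n+1) (t b).W := by
  classical
  have hex : ∃ n, ∃ x ∈ s.W, ∃ y ∈ s.W, x n ≠ y n := by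
    obtain ⟨x, hx⟩ := h.pW.1
    obtain ⟨y, ⟨hy, _⟩, hxy⟩ := (hp.part h.pW) x Set.univ isOpen_univ ⟨x, hx, trivial⟩
    by_contra hcon
    push Not at hcon
    exact hxy (funext fun n => (hcon n y hy x hx))
  let n := Nat.find hex
  obtain ⟨x, hx, y, hy, hxy⟩ := Nat.find_spec hex
  have hmin : ∀ j < n, ∀ x ∈ s.W, ∀ y ∈ s.W, x j = y j := by
    intro j hj x hx y hy
    by_contra hc
    exact Nat.find_min hex hj ⟨x, hx, y, hy, hc⟩
  have hcl := isClopen_coord n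
  have hWne : ∀ b, (s.W ∩ {x : Cs | x n = b}).Nonempty := by
    intro b
    by_cases hb : x n = b
    · exact ⟨x, hx, hb⟩
    · refine ⟨y, hy, ?_⟩
      have h3 : x n ≠ y n := hxy
      show y n = b
      revert hb h3
      cases x n <;> cases y n <;> cases b <;> simp
  -- split on the other side
  obtain ⟨O, hO, -, hne, hOd⟩ := h.n2.avoid h.pe.ranC isOpen_univ (by simpa using h.pW'.1)
  obtain ⟨p, hpW, hpO⟩ := hne
  obtain ⟨q, ⟨hqW, hqO⟩, hpq⟩ := (hp'.part h.pW') p O hO.2 ⟨p, hpW, hpO⟩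
  let Rb : Bool → Set (Cs × Cs) := fun b => s.R ∩ (Prod.fst ⁻¹' {x : Cs | x n = b})
  have hRb : ∀ b, PE A A (Rb b) := fun b => h.pe.restr ((hcl b).1.preimage continuous_fst)
  have hRbs : ∀ b, Rb b ⊆ s.R := fun b => Set.inter_subset_left
  obtain ⟨V, hV, hV1, hV2⟩ := clopen_sep (D := ran (Rb true) ∪ {p}) (E := ran (Rb false) ∪ {q})
    ((hRb _).ranC.union isClosed_singleton) ((hRb _).ranC.union isClosed_singleton) (by
      rw [Set.disjoint_left]
      rintro z (hz | hz) (hz' | hz')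
      · obtain ⟨a, ha⟩ := mem_ran.1 hz
        obtain ⟨a', ha'⟩ := mem_ran.1 hz'
        obtain rfl := h.pe.inj2 _ _ _ ha.1 ha'.1
        have h1 : a n = true := ha.2
        have h2 : a n = false := ha'.2
        simp [h1] at h2
      · rcases hz' with rfl
        exact Set.disjoint_left.1 hOd hqO (ran_mono (hRbs _) hz)
      · rcases hz with rfl
        exact Set.disjoint_left.1 hOd hpO (ran_mono (hRbs _) hz')
      · rcases hz with rfl; rcases hz' with rfl; exact hpq rfl)
  let Vb : Bool → Set Cs := fun b => if b then V else Vᶜ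
  have hVb : ∀ b, IsClopen (Vb b) := by
    intro b; cases b
    · exact hV.compl
    · exact hV
  have hVne : ∀ b, (s.W' ∩ Vb b).Nonempty := by
    intro b; cases b
    · exact ⟨q, hqW, fun h => Set.disjoint_left.1 hV2 h (Or.inr rfl)⟩
    · exact ⟨p, hpW, hV1 (Or.inr rfl)⟩
  have hRV : ∀ b, ran (Rb b) ⊆ Vb b := by
    intro b z hz; cases b
    · exact fun h => Set.disjoint_left.1 hV2 h (Or.inl hz)
    · exact hV1 (Or.inl hz)
  refine ⟨fun b => ⟨s.W ∩ {x : Cs | x n = b}, s.W' ∩ Vb b, Rb b⟩, ?_, ?_, hRbs, ?_⟩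
  · intro b
    refine ⟨(Part.mk' (hcl b) (hWne b)).trans h.pW, (Part.mk' (hVb b) (hVne b)).trans h.pW',
      hRb b, ?_, ?_, ?_⟩
    · rintro ⟨a, c⟩ hac
      exact ⟨⟨(h.sub hac.1).1, hac.2⟩, (h.sub hac.1).2, hRV b (mem_ran.2 ⟨_, hac⟩)⟩
    · exact (h.n1.mono (dom_mono (hRbs b))).interOpen (hcl b).2
    · exact (h.n2.mono (ran_mono (hRbs b))).interOpen (hVb b).2
  · refine ⟨?_, ?_, fun b => Set.inter_subset_left, fun b => Set.inter_subset_left, ?_, ?_, ?_, ?_⟩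
    · intro x hx; exact ⟨x n, hx, rfl⟩
    · intro x hx
      by_cases hxV : x ∈ V
      · exact ⟨true, hx, hxV⟩
      · exact ⟨false, hx, hxV⟩
    · intro b b' x hx hx'
      have h1 : x n = b := hx.2
      have h2 : x n = b' := hx'.2
      exact h1.symm.trans h2
    · intro b b' x hx hx'
      have h1 := hx.2
      have h2 := hx'.2
      cases b <;> cases b' <;> simp_all [Vb]
    · intro p hp; exact ⟨p.1 n, hp, rfl⟩
    · rintro b ⟨a, c⟩ hac
      exact ⟨⟨(h.sub hac.1).1, hac.2⟩, (h.sub hac.1).2, hRV b (mem_ran.2 ⟨_, hac⟩)⟩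
  · intro m hm b u hu v hv j hj
    by_cases hjn : j < n
    · exact hmin j hjn u hu.1 v hv.1
    · rcases Nat.lt_succ_iff_lt_or_eq.1 hj with h1 | h1
      · exact hm u hu.1 v hv.1 j h1
      · rcases Nat.lt_or_eq_of_le (not_lt.1 hjn) with h2 | h2
        · exact absurd (hm x hx y hy n (by omega)) hxy
        · rw [← h2]
          exact (show u n = b from hu.2).trans (show v n = b from hv.2).symm

theorem full_step {A K K' : Set Cs} (hK : IsClosed K) (hK' : IsClosed K') (hp : Perf K)
    (hp' : Perf K') {s : St}
    (h : Inv A K K' s) {C F' : Set Cs} (G : Set Cs) (hC : IsClosed C) (hCn : NwdIn C K)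
    (hE : ∀ O', Part O' K' → Emb A A C O') (hF : IsClosed F') (hFn : NwdIn F' K') :
    ∃ t : Bool → St, (∀ b, Inv A K K' (t b)) ∧ StepP C G F' s t := by
  obtain ⟨R, hR, h1, h2, h3⟩ := add_step hK hK' h G hC hCn hE hF hFn
  obtain ⟨t, ht, h4, h5, h6⟩ := split_step hK hK' hp hp' hR
  refine ⟨t, ht, ⟨⟨h4.c1, h4.c1', h4.s1, h4.s1', h4.d1, h4.d1', fun p hp => h4.r p (h1 hp),
      h4.rs⟩,
    ?_, ?_, h6⟩⟩
  · rintro b x ⟨hx, hxF⟩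
    exact h2 ⟨ran_mono (h5 b) hx, hxF⟩
  · rcases h3 with ⟨h7, h8, h9⟩ | ⟨h7, h8⟩
    · refine Or.inl ⟨fun x hx => ?_, fun b => (dom_mono (h5 b)).trans h8, h9⟩
      obtain ⟨y, hy⟩ := mem_dom.1 (h7 hx)
      obtain ⟨b, hb⟩ := h4.r _ hy
      exact ⟨b, mem_dom.2 ⟨y, hb⟩⟩
    · exact Or.inr ⟨h7, fun b => (dom_mono (h5 b)).trans h8⟩

end SH

end

section
namespace SH

/-- union of an initial segment -/
def Ini (C : ℕ → Set Cs) (n : ℕ) : Set Cs := ⋃ i < n, C i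

theorem mem_Ini {C : ℕ → Set Cs} {n : ℕ} {x : Cs} : x ∈ Ini C n ↔ ∃ i < n, x ∈ C i := by
  simp [Ini]

structure Br (C C' : ℕ → Set Cs) (fw : ℕ → Bool) (ix : ℕ → ℕ) (m : ℕ) (s : St) (t : Bool → St) :
    Prop where
  f : fw m = true → StepP (C (ix m)) (Ini C (ix m)) (Ini C' m) s t
  g : fw m = false → StepP (C' (ix m)) (Ini C' (ix m)) (Ini C m) s.swap (fun b => (t b).swap)

theorem Br.split {C C' : ℕ → Set Cs} {fw : ℕ → Bool} {ix : ℕ → ℕ} {m : ℕ} {s : St} {t : Bool → St}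
    (h : Br C C' fw ix m s t) : SplitP s t := by
  cases hb : fw m
  · have := (h.g hb).toSplitP.swap
    simpa only [St.swap_swap] using this
  · exact (h.f hb).toSplitP

theorem Br.swap {C C' : ℕ → Set Cs} {fw : ℕ → Bool} {ix : ℕ → ℕ} {m : ℕ} {s : St} {t : Bool → St}
    (h : Br C C' fw ix m s t) :
    Br C' C (fun m => !fw m) ix m s.swap (fun b => (t b).swap) := by
  refine ⟨fun hb => h.g (by simpa using hb), fun hb => ?_⟩
  simp only [St.swap_swap]
  exact h.f (by simpa using hb)

theorem avoid_closed {s : ℕ → St} {x : Cs} (hx : ∀ m, x ∈ (s m).W)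
    (hdec : ∀ m, (s (m+1)).W ⊆ (s m).W)
    (hag : ∀ n, ∃ m, Agree n (s m).W) {D : Set Cs} (hD : IsClosed D) (hxD : x ∉ D) (m0 : ℕ) :
    ∃ m ≥ m0, ∀ m' ≥ m, Disjoint (s m').W D := by
  have hanti : Antitone fun m => (s m).W := antitone_nat_of_succ_le hdec
  obtain ⟨n, hn⟩ : ∃ n, ∀ y : Cs, (∀ j < n, y j = x j) → y ∉ D := by
    by_contra hcon
    push Not at hcon
    choose y hy hyD using hcon
    apply hxD
    refine hD.mem_of_tendsto (f := y) (b := Filter.atTop) (tendsto_pi_nhds.2 fun j => ?_)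
      (Filter.Eventually.of_forall hyD)
    refine tendsto_const_nhds.congr' ?_
    filter_upwards [Filter.eventually_gt_atTop j] with n hn
    exact (hy n j hn).symm
  obtain ⟨m, hm⟩ := hag n
  refine ⟨max m m0, le_max_right _ _, fun m' hm' => Set.disjoint_left.2 fun y hy => ?_⟩
  refine hn y fun j hj => ?_
  exact hm y (hanti ((le_max_left _ _).trans hm') hy) x (hx m) j hj

theorem isClosed_Ini {C : ℕ → Set Cs} (hC : ∀ i, IsClosed (C i)) (n : ℕ) : IsClosed (Ini C n) := by
  unfold Ini
  exact (Set.finite_lt_nat n).isClosed_biUnion fun i _ => hC i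

theorem coverage {C C' : ℕ → Set Cs} {fw : ℕ → Bool} {ix : ℕ → ℕ}
    (hC : ∀ i, IsClosed (C i))
    (hix : ∀ i n, ∃ m ≥ n, fw m = true ∧ ix m = i)
    {s : ℕ → St} {x : Cs} (hx : ∀ m, x ∈ (s m).W)
    (hs : ∀ m, ∃ t b, s (m+1) = t b ∧ Br C C' fw ix m (s m) t)
    (hag : ∀ n, ∃ m, Agree n (s m).W)
    (hcl : ∀ m, IsClosed (dom (s m).R)) (hsub : ∀ m, (s m).R ⊆ (s m).W ×ˢ (s m).W')
    (hxC : ∃ i, x ∈ C i) : ∃ m, x ∈ dom (s m).R := by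
  classical
  by_contra hcon
  push Not at hcon
  let i := Nat.find hxC
  have hi : x ∈ C i := Nat.find_spec hxC
  have hmin : x ∉ Ini C i := by
    intro h
    obtain ⟨j, hj, hxj⟩ := mem_Ini.1 h
    exact Nat.find_min hxC hj hxj
  have hdec : ∀ m, (s (m+1)).W ⊆ (s m).W := by
    intro m
    obtain ⟨t, b, h1, h2⟩ := hs m
    rw [h1]; exact h2.split.s1 b
  obtain ⟨m0, hm0, hd0⟩ := avoid_closed hx hdec hag (isClosed_Ini hC i) hmin (i+1)
  -- x cannot enter
  have hno : ∀ m ≥ m0, fw m = true → ix m = i → ¬ Disjoint (C i ∩ (s m).W) (dom (s m).R ∪ Ini C i) ∧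
      dom (s (m+1)).R ⊆ dom (s m).R := by
    intro m hm hf hixm
    obtain ⟨t, b, h1, h2⟩ := hs m
    have h3 := h2.f hf
    rw [hixm] at h3
    rcases h3.alt with ⟨h4, h5, h6⟩ | h4
    · exfalso
      obtain ⟨b', hb'⟩ := h4 x ⟨hi, hx m⟩
      -- b' = b
      obtain ⟨y, hy⟩ := mem_dom.1 hb'
      obtain rfl : b' = b := h3.d1 b' b x (h3.rs b' hy).1 (by rw [← h1]; exact hx _)
      exact hcon (m+1) (by rw [h1]; exact hb')
    · rw [h1]; exact ⟨h4.1, h4.2 b⟩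
  have hmono : ∀ m ≥ m0, C i ∩ dom (s (m+1)).R ⊆ dom (s m).R := by
    rintro m hm y ⟨hyC, hy⟩
    obtain ⟨t, b, h1, h2⟩ := hs m
    cases hf : fw m
    · have h3 := (h2.g hf).fr b
      simp only [St.swap, ran_swap] at h3
      rw [h1] at hy
      exact h3 ⟨hy, mem_Ini.2 ⟨i, by omega, hyC⟩⟩
    · by_cases hii : ix m = i
      · exact (hno m hm hf hii).2 hy
      · rw [h1] at hy
        rcases (h2.f hf).alt with ⟨h4, h5, h6⟩ | h4
        · rcases h5 b hy with h7 | h7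
          · exact h7
          · exfalso
            rcases lt_or_gt_of_ne hii with h8 | h8
            · exact Set.disjoint_left.1 (hd0 m hm) h7.2 (mem_Ini.2 ⟨_, h8, h7.1⟩)
            · exact Set.disjoint_left.1 h6 h7 (mem_Ini.2 ⟨_, h8, hyC⟩)
        · exact h4.2 b hy
  have hmono' : ∀ k, C i ∩ dom (s (m0 + k)).R ⊆ dom (s m0).R := by
    intro k
    induction k with
    | zero => exact Set.inter_subset_right
    | succ k ih => exact fun y hy => ih ⟨hy.1, hmono (m0 + k) (by omega) hy⟩
  obtain ⟨m1, hm1, hd1⟩ := avoid_closed hx hdec hag (hcl m0) (hcon m0) m0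
  obtain ⟨m, hm, hf, hii⟩ := hix i m1
  refine (hno m (by omega) hf hii).1 ?_
  rw [Set.disjoint_left]
  rintro y ⟨hyC, hyW⟩ (hy | hy)
  · obtain ⟨k, rfl⟩ := Nat.exists_eq_add_of_le (show m0 ≤ m by omega)
    exact Set.disjoint_left.1 (hd1 _ hm) hyW (hmono' k ⟨hyC, hy⟩)
  · exact Set.disjoint_left.1 (hd0 m (by omega)) hyW hy

theorem branch_resp {C C' : ℕ → Set Cs} {fw : ℕ → Bool} {ix : ℕ → ℕ}
    (hC : ∀ i, IsClosed (C i))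
    (hix : ∀ i n, ∃ m ≥ n, fw m = true ∧ ix m = i)
    {s : ℕ → St} {x x' : Cs} (hx : ∀ m, x ∈ (s m).W) (hx' : ∀ m, x' ∈ (s m).W')
    (hs : ∀ m, ∃ t b, s (m+1) = t b ∧ Br C C' fw ix m (s m) t)
    (hag : ∀ n, ∃ m, Agree n (s m).W) (hag' : ∀ n, ∃ m, Agree n (s m).W')
    (hcl : ∀ m, IsClosed (dom (s m).R)) (hsub : ∀ m, (s m).R ⊆ (s m).W ×ˢ (s m).W')
    (hxC : ∃ i, x ∈ C i) : ∃ m, (x, x') ∈ (s m).R := by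
  obtain ⟨m, hm⟩ := coverage hC hix hx hs hag hcl hsub hxC
  obtain ⟨y, hy⟩ := mem_dom.1 hm
  have hpers : ∀ k, (x, y) ∈ (s (m+k)).R := by
    intro k
    induction k with
    | zero => exact hy
    | succ k ih =>
      obtain ⟨t, b, h1, h2⟩ := hs (m+k)
      obtain ⟨b', hb'⟩ := h2.split.r _ ih
      obtain rfl : b' = b := h2.split.d1 b' b x (h2.split.rs b' hb').1 (by rw [← h1]; exact hx _)
      rw [← add_assoc, h1]; exact hb'
  have hdec : ∀ m, (s (m+1)).W' ⊆ (s m).W' := by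
    intro m
    obtain ⟨t, b, h1, h2⟩ := hs m
    rw [h1]; exact h2.split.s1' b
  have hanti : Antitone fun m => (s m).W' := antitone_nat_of_succ_le hdec
  obtain rfl : y = x' := by
    funext j
    obtain ⟨n, hn⟩ := hag' (j+1)
    exact hn y (hanti (show n ≤ m + n by omega) ((hsub (m+n)) (hpers n)).2) x' (hx' n) j (by omega)
  exact ⟨m, hy⟩

theorem isClosed_locConst {X Y S : Type*} [TopologicalSpace X] [TopologicalSpace Y] {f : X → S}
    (hf : IsLocallyConstant f) {F : S → Set Y} (hF : ∀ s, IsClosed (F s)) :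
    IsClosed {p : X × Y | p.2 ∈ F (f p.1)} := by
  rw [← isOpen_compl_iff, isOpen_iff_mem_nhds]
  rintro ⟨x, y⟩ h
  have h1 : f ⁻¹' {f x} ∈ nhds x := (hf.isOpen_fiber _).mem_nhds rfl
  have h2 : (F (f x))ᶜ ∈ nhds y := (hF _).isOpen_compl.mem_nhds h
  filter_upwards [prod_mem_nhds h1 h2] with q hq
  have h3 : f q.1 = f x := hq.1
  have h4 : q.2 ∉ F (f x) := hq.2
  show q.2 ∉ F (f q.1)
  rw [h3]; exact h4

theorem lemmaH {A K K' N : Set Cs} (hK : IsClosed K) (hK' : IsClosed K') (hne : K.Nonempty)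
    (hne' : K'.Nonempty) (hp : Perf K) (hp' : Perf K') (hN : N = A ∨ N = Aᶜ)
    {C C' : ℕ → Set Cs} (hC : ∀ i, IsClosed (C i)) (hC' : ∀ i, IsClosed (C' i))
    (hn : ∀ i, NwdIn (C i) K) (hn' : ∀ i, NwdIn (C' i) K')
    (hE : ∀ i O, Part O K' → Emb A A (C i) O) (hE' : ∀ i O, Part O K → Emb A A (C' i) O)
    (hcov : N ∩ K ⊆ ⋃ i, C i) (hcov' : N ∩ K' ⊆ ⋃ i, C' i) :
    ∃ R, PE A A R ∧ dom R = K ∧ ran R = K' := by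
  classical
  let fw : ℕ → Bool := fun m => decide (m % 2 = 0)
  let ix : ℕ → ℕ := fun m => (Nat.unpair (m / 2)).1
  have hix : ∀ i n, ∃ m ≥ n, fw m = true ∧ ix m = i := fun i n =>
    ⟨2 * Nat.pair i n, by have := Nat.right_le_pair i n; omega, by simp [fw], by simp [ix]⟩
  have hix' : ∀ i n, ∃ m ≥ n, (!fw m) = true ∧ ix m = i := fun i n =>
    ⟨2 * Nat.pair i n + 1, by have := Nat.right_le_pair i n; omega, by simp [fw], by
      have : (2 * Nat.pair i n + 1) / 2 = Nat.pair i n := by omega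
      simp [ix, this]⟩
  have hstep : ∀ (m : ℕ) (s : {s : St // Inv A K K' s}), ∃ t : Bool → {s : St // Inv A K K' s},
      Br C C' fw ix m s.1 (fun b => (t b).1) := by
    rintro m ⟨s, hs⟩
    cases hf : fw m
    · obtain ⟨t, h1, h2⟩ := full_step hK' hK hp' hp hs.swap (Ini C' (ix m)) (hC' (ix m))
        (hn' (ix m)) (hE' (ix m)) (NwdIn.biUnion C hC hn m).1 (NwdIn.biUnion C hC hn m).2
      refine ⟨fun b => ⟨(t b).swap, (h1 b).swap⟩, ⟨fun h => by simp [hf] at h, fun _ => ?_⟩⟩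
      simp only [St.swap_swap]; exact h2
    · obtain ⟨t, h1, h2⟩ := full_step hK hK' hp hp' hs (Ini C (ix m)) (hC (ix m))
        (hn (ix m)) (hE (ix m)) (NwdIn.biUnion C' hC' hn' m).1 (NwdIn.biUnion C' hC' hn' m).2
      exact ⟨fun b => ⟨t b, h1 b⟩, ⟨fun _ => h2, fun h => by simp [hf] at h⟩⟩
  choose next hnext using hstep
  have hPE0 : PE A A ∅ := ⟨isCompact_empty, by simp, by simp, by simp⟩
  let s0 : {s : St // Inv A K K' s} := ⟨⟨K, K', ∅⟩, Part.refl hne, Part.refl hne', hPE0,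
    by simp, by simpa [dom] using NwdIn.empty _, by simpa [ran] using NwdIn.empty _⟩
  let st : (ℕ → Bool) → ℕ → {s : St // Inv A K K' s} := fun z m =>
    Nat.rec s0 (fun m s => next m s (z m)) m
  have st0 : ∀ z, st z 0 = s0 := fun z => rfl
  have sts : ∀ z m, st z (m+1) = next m (st z m) (z m) := fun z m => rfl
  have hbr : ∀ z m, Br C C' fw ix m (st z m).1 (fun b => (next m (st z m) b).1) :=
    fun z m => hnext m _
  have hs : ∀ z m, ∃ t b, (st z (m+1)).1 = t b ∧ Br C C' fw ix m (st z m).1 t :=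
    fun z m => ⟨_, z m, rfl, hbr z m⟩
  have hagm : ∀ z k, Agree k (st z (2*k)).1.W ∧ Agree k (st z (2*k)).1.W' := by
    intro z k
    induction k with
    | zero => exact ⟨fun _ _ _ _ j hj => by omega, fun _ _ _ _ j hj => by omega⟩
    | succ k ih =>
      have h1 : Agree (k+1) (st z (2*k+1)).1.W :=
        ((hbr z (2*k)).f (by simp [fw])).ag k ih.1 (z (2*k))
      have h1' : Agree k (st z (2*k+1)).1.W' := fun x hx y hy =>
        ih.2 x ((hbr z (2*k)).split.s1' _ hx) y ((hbr z (2*k)).split.s1' _ hy)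
      have h2 : Agree (k+1) (st z (2*k+2)).1.W' :=
        ((hbr z (2*k+1)).g (by simp [fw])).ag k h1' (z (2*k+1))
      have h2' : Agree (k+1) (st z (2*k+2)).1.W := fun x hx y hy =>
        h1 x ((hbr z (2*k+1)).split.s1 _ hx) y ((hbr z (2*k+1)).split.s1 _ hy)
      exact ⟨h2', h2⟩
  have hloc : ∀ m, IsLocallyConstant (fun z => st z m) := by
    intro m
    induction m with
    | zero => exact IsLocallyConstant.const _
    | succ m ih =>
      have h1 : IsLocallyConstant (fun z : ℕ → Bool => z m) :=
        (IsLocallyConstant.iff_continuous _).2 (continuous_apply m)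
      have := (ih.prodMk h1).comp (fun p : _ × Bool => next m p.1 p.2)
      exact this
  have hclW : ∀ s : {s : St // Inv A K K' s}, IsClosed s.1.W := fun s => s.2.pW.closed hK
  have hclW' : ∀ s : {s : St // Inv A K K' s}, IsClosed s.1.W' := fun s => s.2.pW'.closed hK'
  let G : Set ((ℕ → Bool) × (Cs × Cs)) :=
    {q | ∀ m, q.2 ∈ (st q.1 m).1.W ×ˢ (st q.1 m).1.W'}
  have hG : IsCompact G := by
    have : G = ⋂ m, {q | q.2 ∈ (st q.1 m).1.W ×ˢ (st q.1 m).1.W'} := by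
      ext q; simp only [G, Set.mem_ofPred_eq, Set.mem_iInter]
    rw [this]
    refine IsClosed.isCompact (isClosed_iInter fun m => ?_)
    exact isClosed_locConst (hloc m) (F := fun s => s.1.W ×ˢ s.1.W')
      fun s => (hclW s).prod (hclW' s)
  have uniq1 : ∀ z z' x, (∀ m, x ∈ (st z m).1.W) → (∀ m, x ∈ (st z' m).1.W) → z = z' := by
    intro z z' x h1 h2
    have : ∀ m, st z m = st z' m := by
      intro m
      induction m with
      | zero => rfl
      | succ m ih =>
        have h3 : z m = z' m := (hbr z m).split.d1 _ _ x (h1 (m+1)) (by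
          have := h2 (m+1); rw [sts, ← ih] at this; exact this)
        rw [sts, sts, ih, h3]
    funext m
    exact (hbr z m).split.d1 _ _ x (h1 (m+1)) (by
          have h4 := h2 (m+1); rw [sts, ← this m] at h4; exact h4)
  have uniq2 : ∀ z z' x, (∀ m, x ∈ (st z m).1.W') → (∀ m, x ∈ (st z' m).1.W') → z = z' := by
    intro z z' x h1 h2
    have : ∀ m, st z m = st z' m := by
      intro m
      induction m with
      | zero => rfl
      | succ m ih =>
        have h3 : z m = z' m := (hbr z m).split.d1' _ _ x (h1 (m+1)) (by
          have := h2 (m+1); rw [sts, ← ih] at this; exact this)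
        rw [sts, sts, ih, h3]
    funext m
    exact (hbr z m).split.d1' _ _ x (h1 (m+1)) (by
          have h4 := h2 (m+1); rw [sts, ← this m] at h4; exact h4)
  have exz : ∀ (P : {s : St // Inv A K K' s} → Prop), P s0 →
      (∀ m s, P s → ∃ b, P (next m s b)) → ∃ z, ∀ m, P (st z m) := by
    intro P h0 hP
    choose! bb hbb using hP
    let sq : ℕ → {s : St // Inv A K K' s} := fun m => Nat.rec s0 (fun m s => next m s (bb m s)) m
    have h1 : ∀ m, P (sq m) := by
      intro m
      induction m with
      | zero => exact h0
      | succ m ih => exact hbb m _ ih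
    refine ⟨fun m => bb m (sq m), fun m => ?_⟩
    have h2 : st (fun m => bb m (sq m)) m = sq m := by
      induction m with
      | zero => rfl
      | succ m ih => rw [sts, ih]
    rw [h2]; exact h1 m
  have hdec : ∀ z m, (st z (m+1)).1.W ⊆ (st z m).1.W := fun z m => (hbr z m).split.s1 _
  have hdec' : ∀ z m, (st z (m+1)).1.W' ⊆ (st z m).1.W' := fun z m => (hbr z m).split.s1' _
  have agl : ∀ z, ∀ n, ∃ m, Agree n (st z m).1.W := fun z n => ⟨_, (hagm z n).1⟩
  have agr : ∀ z, ∀ n, ∃ m, Agree n (st z m).1.W' := fun z n => ⟨_, (hagm z n).2⟩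
  refine ⟨Prod.snd '' G, ⟨hG.image continuous_snd, ?_, ?_, ?_⟩, ?_, ?_⟩
  · rintro a b b' ⟨⟨z, p⟩, h1, rfl⟩ ⟨⟨z', p'⟩, h2, h3⟩
    simp only at h3
    subst h3
    obtain rfl := uniq1 z z' a (fun m => (h1 m).1) (fun m => (h2 m).1)
    funext j
    exact (hagm z (j+1)).2 b (h1 (2*(j+1))).2 b' (h2 (2*(j+1))).2 j (by omega)
  · rintro a a' b ⟨⟨z, p⟩, h1, rfl⟩ ⟨⟨z', p'⟩, h2, h3⟩
    simp only at h3
    subst h3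
    obtain rfl := uniq2 z z' b (fun m => (h1 m).2) (fun m => (h2 m).2)
    funext j
    exact (hagm z (j+1)).1 a (h1 (2*(j+1))).1 a' (h2 (2*(j+1))).1 j (by omega)
  · rintro a b ⟨⟨z, p⟩, h1, rfl⟩
    have hab : a ∈ N → (a ∈ A ↔ b ∈ A) := by
      intro ha
      have haK : a ∈ K := (h1 0).1
      obtain ⟨m, hm⟩ := branch_resp (C := C) (C' := C') hC hix
        (s := fun m => (st z m).1) (fun m => (h1 m).1) (fun m => (h1 m).2) (hs z) (agl z) (agr z)
        (fun m => (st z m).2.pe.domC) (fun m => (st z m).2.sub)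
        (Set.mem_iUnion.1 (hcov ⟨ha, haK⟩))
      exact (st z m).2.pe.resp _ _ hm
    have hba : b ∈ N → (b ∈ A ↔ a ∈ A) := by
      intro hb
      have hbK : b ∈ K' := (h1 0).2
      obtain ⟨m, hm⟩ := branch_resp (C := C') (C' := C) (fw := fun m => !fw m) (ix := ix)
        hC' hix'
        (s := fun m => (st z m).1.swap) (fun m => (h1 m).2) (fun m => (h1 m).1)
        (fun m => ⟨_, z m, rfl, (hbr z m).swap⟩) (agr z) (agl z)
        (fun m => (st z m).2.swap.pe.domC) (fun m => (st z m).2.swap.sub)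
        (Set.mem_iUnion.1 (hcov' ⟨hb, hbK⟩))
      exact (st z m).2.swap.pe.resp _ _ hm
    rcases hN with rfl | rfl
    · tauto
    · simp only [Set.mem_compl_iff] at hab hba; tauto
  · ext x
    constructor
    · intro hx
      obtain ⟨y, ⟨z, p⟩, h1, rfl⟩ := mem_dom.1 hx
      exact (h1 0).1
    · intro hx
      obtain ⟨z, hz⟩ := exz (fun s => x ∈ s.1.W) hx fun m s h => (hnext m s).split.c1 x h
      obtain ⟨y, hy⟩ := IsCompact.nonempty_iInter_of_sequence_nonempty_isCompact_isClosed
        (fun m => (st z m).1.W') (hdec' z) (fun m => (st z m).2.pW'.1) (hclW' _).isCompact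
        (fun m => hclW' _)
      exact mem_dom.2 ⟨y, (z, (x, y)), fun m => ⟨hz m, Set.mem_iInter.1 hy m⟩, rfl⟩
  · ext x
    constructor
    · intro hx
      obtain ⟨y, ⟨z, p⟩, h1, rfl⟩ := mem_ran.1 hx
      exact (h1 0).2
    · intro hx
      obtain ⟨z, hz⟩ := exz (fun s => x ∈ s.1.W') hx fun m s h => (hnext m s).split.c1' x h
      obtain ⟨y, hy⟩ := IsCompact.nonempty_iInter_of_sequence_nonempty_isCompact_isClosed
        (fun m => (st z m).1.W) (hdec z) (fun m => (st z m).2.pW.1) (hclW _).isCompact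
        (fun m => hclW _)
      exact mem_ran.2 ⟨y, (z, (y, x)), fun m => ⟨Set.mem_iInter.1 hy m, hz m⟩, rfl⟩

end SH

end

section
namespace SH
open Topology

theorem PE.homeo {A : Set Cs} {R : Set (Cs × Cs)} (h : PE A A R) :
    Nonempty (↥(A ∩ dom R) ≃ₜ ↥(A ∩ ran R)) := by
  have hcs : CompactSpace R := isCompact_iff_compactSpace.1 h.cpt
  let S : Set R := {p | p.1.1 ∈ A}
  have e1 : IsEmbedding (fun p : R => p.1.1) :=
    (Continuous.isClosedEmbedding (by fun_prop) (by
      rintro ⟨⟨a, b⟩, hp⟩ ⟨⟨a', b'⟩, hp'⟩ h1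
      simp only at h1
      subst h1
      obtain rfl := h.inj1 _ _ _ hp hp'
      rfl)).isEmbedding
  have e2 : IsEmbedding (fun p : R => p.1.2) :=
    (Continuous.isClosedEmbedding (by fun_prop) (by
      rintro ⟨⟨a, b⟩, hp⟩ ⟨⟨a', b'⟩, hp'⟩ h1
      simp only at h1
      subst h1
      obtain rfl := h.inj2 _ _ _ hp hp'
      rfl)).isEmbedding
  have f1 := e1.comp (IsEmbedding.subtypeVal (p := (· ∈ S)))
  have f2 := e2.comp (IsEmbedding.subtypeVal (p := (· ∈ S)))
  have r1 : Set.range ((fun p : R => p.1.1) ∘ (Subtype.val : S → R)) = A ∩ dom R := by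
    ext x
    simp only [Set.mem_range, Function.comp, Set.mem_inter_iff, mem_dom]
    constructor
    · rintro ⟨⟨⟨⟨a, b⟩, hp⟩, hS⟩, rfl⟩
      exact ⟨hS, b, hp⟩
    · rintro ⟨hx, y, hy⟩
      exact ⟨⟨⟨(x, y), hy⟩, hx⟩, rfl⟩
  have r2 : Set.range ((fun p : R => p.1.2) ∘ (Subtype.val : S → R)) = A ∩ ran R := by
    ext x
    simp only [Set.mem_range, Function.comp, Set.mem_inter_iff, mem_ran]
    constructor
    · rintro ⟨⟨⟨⟨a, b⟩, hp⟩, hS⟩, rfl⟩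
      exact ⟨(h.resp _ _ hp).1 hS, a, hp⟩
    · rintro ⟨hx, y, hy⟩
      exact ⟨⟨⟨(y, x), hy⟩, (h.resp _ _ hy).2 hx⟩, rfl⟩
  exact ⟨(Homeomorph.setCongr r1.symm).trans (f1.toHomeomorph.symm.trans
    (f2.toHomeomorph.trans (Homeomorph.setCongr r2)))⟩

theorem hhom_of {A U N : Set Cs} (hU : IsClosed U) (hp : Perf U) (hN : N = A ∨ N = Aᶜ)
    (hdense : ∀ O, IsOpen O → (U ∩ O).Nonempty → (A ∩ U ∩ O).Nonempty)
    {C : ℕ → Set Cs} (hC : ∀ i, IsClosed (C i)) (hn : ∀ i, NwdIn (C i) U)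
    (hE : ∀ i O, Part O U → Emb A A (C i) O) (hcov : N ∩ U ⊆ ⋃ i, C i) :
    HHomogeneous ↥(A ∩ U) := by
  intro S hS hSne
  obtain ⟨O, hO, hOS⟩ := isOpen_induced_iff.1 hS.2
  let K' : Set Cs := closure (A ∩ U ∩ O)
  have hUK : U ∩ O ⊆ K' := by
    rintro x ⟨hxU, hxO⟩
    refine mem_closure_iff.2 fun V hV hxV => ?_
    obtain ⟨y, ⟨hyA, hyU⟩, hyV, hyO⟩ := hdense (V ∩ O) (hV.inter hO) ⟨x, hxU, hxV, hxO⟩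
    exact ⟨y, hyV, ⟨hyA, hyU⟩, hyO⟩
  have hK'U : K' ⊆ U := closure_minimal (fun x hx => hx.1.2) hU
  have hmeet : ∀ V, IsOpen V → (K' ∩ V).Nonempty → (U ∩ (V ∩ O)).Nonempty := by
    rintro V hV ⟨x, hx, hxV⟩
    obtain ⟨y, hyV, ⟨hyA, hyU⟩, hyO⟩ := mem_closure_iff.1 hx V hV hxV
    exact ⟨y, hyU, hyV, hyO⟩
  have hnw : ∀ D, NwdIn D U → NwdIn D K' := by
    intro D hD V hV hne
    obtain ⟨y, ⟨hyU, hyV, hyO⟩, hyD⟩ := hD (V ∩ O) (hV.inter hO) (hmeet V hV hne)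
    exact ⟨y, ⟨hUK ⟨hyU, hyO⟩, hyV⟩, hyD⟩
  have hSeq : A ∩ K' = Subtype.val '' S := by
    ext x
    constructor
    · rintro ⟨hxA, hxK⟩
      have hxU := hK'U hxK
      refine ⟨⟨x, hxA, hxU⟩, ?_, rfl⟩
      rw [← hS.1.closure_eq, closure_subtype]
      refine closure_mono ?_ hxK
      rintro y ⟨hy, hyO⟩
      exact ⟨⟨y, hy⟩, hOS ▸ hyO, rfl⟩
    · rintro ⟨⟨y, hy⟩, hyS, rfl⟩
      refine ⟨hy.1, subset_closure ⟨hy, ?_⟩⟩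
      rw [← hOS] at hyS; exact hyS
  obtain ⟨⟨y0, hy0⟩, hy0S⟩ := hSne
  have hK'ne : K'.Nonempty := by
    have : y0 ∈ A ∩ K' := by rw [hSeq]; exact ⟨⟨y0, hy0⟩, hy0S, rfl⟩
    exact ⟨y0, this.2⟩
  have hpart : ∀ P, Part P K' → ∃ Q, Part Q U ∧ Q ⊆ P := by
    rintro P ⟨hne, W, hW, rfl⟩
    obtain ⟨y, hyU, hyW, hyO⟩ := hmeet W hW.2 hne
    obtain ⟨W2, hW2, hyW2, hW2s⟩ := clopen_nhd (hW.2.inter hO) ⟨hyW, hyO⟩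
    exact ⟨U ∩ W2, Part.mk' hW2 ⟨y, hyU, hyW2⟩, fun z hz =>
      ⟨hUK ⟨hz.1, (hW2s hz.2).2⟩, (hW2s hz.2).1⟩⟩
  obtain ⟨R, hR, hRd, hRr⟩ := lemmaH (A := A) (K := K') (K' := U) (N := N) isClosed_closure hU hK'ne
    ⟨y0, hy0.2⟩ (fun x => hnw _ (hp x)) hp hN (C := fun i => C i ∩ K') (C' := C)
    (fun i => (hC i).inter isClosed_closure) hC
    (fun i => hnw _ ((hn i).mono Set.inter_subset_left)) hn
    (fun i O hO => (hE i O hO).mono_left Set.inter_subset_left ((hC i).inter isClosed_closure))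
    (fun i P hP => by
      obtain ⟨Q, hQ, hQP⟩ := hpart P hP
      exact (hE i Q hQ).mono_right (hQ.closed hU) hQP)
    (fun x hx => by
      obtain ⟨i, hi⟩ := Set.mem_iUnion.1 (hcov ⟨hx.1, hK'U hx.2⟩)
      exact Set.mem_iUnion.2 ⟨i, hi, hx.2⟩) hcov
  obtain ⟨e⟩ := hR.homeo
  rw [hRd, hRr, hSeq] at e
  have f := (IsEmbedding.subtypeVal (p := (· ∈ A ∩ U)))
  have e3 : S ≃ₜ ↥(Subtype.val '' S : Set Cs) := f.homeomorphImage S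
  exact ⟨e3.trans e⟩

theorem hhom_subsing {Y : Type*} [TopologicalSpace Y] [Subsingleton Y] : HHomogeneous Y := by
  rintro U hU ⟨x, hx⟩
  have : U = Set.univ := Set.eq_univ_of_forall fun y => Subsingleton.elim x y ▸ hx
  rw [this]
  exact ⟨Homeomorph.Set.univ Y⟩

theorem baire_prop {A Z : Set Cs} (hA : @MeasurableSet Cs (borel Cs) A) (hZ : IsClosed Z)
    (hne : Z.Nonempty) : ∃ K N : Set Cs, Part K Z ∧ (N = A ∨ N = Aᶜ) ∧ ∃ C : ℕ → Set Cs,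
      (∀ i, IsClosed (C i)) ∧ (∀ i, NwdIn (C i) K) ∧ N ∩ K ⊆ ⋃ i, C i := by
  let _ : MeasurableSpace Cs := borel Cs
  have _ : BorelSpace Cs := ⟨rfl⟩
  let _ : MeasurableSpace Z := borel Z
  have _ : BorelSpace Z := ⟨rfl⟩
  have hs : MeasurableSet (Subtype.val ⁻¹' A : Set Z) := by
    have : Measurable (Subtype.val : Z → Cs) := continuous_subtype_val.borel_measurable
    exact this hA
  obtain ⟨u, hu, hsu⟩ := hs.baireMeasurableSet.residualEq_isOpen
  have hres : {x : Z | (x ∈ (Subtype.val ⁻¹' A : Set Z)) = (x ∈ u)} ∈ residual Z := hsu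
  obtain ⟨S, hS1, hS2, hS3, hS4⟩ := mem_residual_iff.1 hres
  have hSig : Sig (fun D => NwdIn D Z) {x | ∃ h : x ∈ Z, ¬ (x ∈ A ↔ (⟨x, h⟩ : Z) ∈ u)} := by
    refine ⟨(fun t => Subtype.val '' (tᶜ : Set Z)) '' S, hS3.image _, ?_, ?_⟩
    · rintro _ ⟨t, ht, rfl⟩
      refine ⟨hZ.isClosedEmbedding_subtypeVal.isClosedMap _ (hS1 t ht).isClosed_compl, ?_⟩
      rintro O hO ⟨x, hxZ, hxO⟩
      obtain ⟨y, hy1, hy2⟩ := (hS2 t ht).inter_open_nonempty (Subtype.val ⁻¹' O)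
        (hO.preimage continuous_subtype_val) ⟨⟨x, hxZ⟩, hxO⟩
      refine ⟨y, ⟨y.2, hy1⟩, ?_⟩
      rintro ⟨y', hy', h⟩
      rw [Subtype.ext h] at hy'
      exact hy' hy2
    · rintro x ⟨hxZ, hx⟩
      have : (⟨x, hxZ⟩ : Z) ∉ ⋂₀ S := fun h => hx (by
        have := hS4 h
        exact Iff.of_eq this)
      simp only [Set.mem_sInter, not_forall] at this
      obtain ⟨t, ht, hxt⟩ := this
      exact ⟨_, ⟨t, ht, rfl⟩, ⟨x, hxZ⟩, hxt, rfl⟩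
  obtain ⟨C, hC, hCc⟩ := hSig.seq (NwdIn.empty _)
  by_cases hue : u.Nonempty
  · obtain ⟨x, hx⟩ := hue
    obtain ⟨O, hO, rfl⟩ := isOpen_induced_iff.1 hu
    obtain ⟨W, hW, hxW, hWO⟩ := clopen_nhd hO hx
    have hP : Part (Z ∩ W) Z := Part.mk' hW ⟨x, x.2, hxW⟩
    refine ⟨Z ∩ W, Aᶜ, hP, Or.inr rfl, C, fun i => (hC i).1, fun i => (hC i).2.part hP, ?_⟩
    rintro y ⟨hyA, hyZ, hyW⟩
    refine hCc ⟨hyZ, fun h => hyA (h.2 (hWO hyW))⟩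
  · refine ⟨Z, A, Part.refl hne, Or.inl rfl, C, fun i => (hC i).1, fun i => (hC i).2, ?_⟩
    rintro y ⟨hyA, hyZ⟩
    exact hCc ⟨hyZ, fun h => hue ⟨_, h.1 hyA⟩⟩

/-- the situation reached from a counterexample -/
structure Bad (A K N : Set Cs) (C : ℕ → Set Cs) : Prop where
  cl : IsClosed K
  ne : K.Nonempty
  perf : Perf K
  hN : N = A ∨ N = Aᶜ
  nh : ∀ U, Part U K → ¬ HHomogeneous ↥(A ∩ U)
  Ccl : ∀ i, IsClosed (C i)
  Cn : ∀ i, NwdIn (C i) K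
  cov : N ∩ K ⊆ ⋃ i, C i

theorem start {A : Set Cs} (hA : @MeasurableSet Cs (borel Cs) A)
    (hno : ¬ ∃ f : ℕ → Set (ℕ → Bool),
      (∀ i, f i ⊆ A) ∧
      (∀ i, IsClosed (Subtype.val ⁻¹' f i : Set ↥A)) ∧
      (∀ i, HHomogeneous ↥(f i)) ∧
      A = ⋃ i, f i) : ∃ K N C, Bad A K N C := by
  have h1 : ¬ Sig (fun E => HHomogeneous ↥(A ∩ E)) Set.univ := by
    intro h
    obtain ⟨E, hE, hEu⟩ := h.seq (by
      have : Subsingleton ↥(A ∩ ∅) := by simp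
      exact hhom_subsing)
    refine hno ⟨fun i => A ∩ E i, fun i => Set.inter_subset_left, fun i => ?_, fun i => (hE i).2, ?_⟩
    · have : (Subtype.val ⁻¹' (A ∩ E i) : Set A) = Subtype.val ⁻¹' E i := by
        ext x; simp
      rw [this]; exact (hE i).1.preimage continuous_subtype_val
    · ext x; constructor
      · intro hx; obtain ⟨i, hi⟩ := Set.mem_iUnion.1 (hEu (Set.mem_univ x))
        exact Set.mem_iUnion.2 ⟨i, hx, hi⟩
      · intro hx; obtain ⟨i, hi⟩ := Set.mem_iUnion.1 hx; exact hi.1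
  obtain ⟨Z, hZ, hZne, -, hZn⟩ := exhaustion _ isClosed_univ h1
  have hZh : ∀ U, Part U Z → ¬ HHomogeneous ↥(A ∩ U) := by
    rintro U hU hh
    have hcl := hU.closed hZ
    obtain ⟨hne, W, hW, rfl⟩ := hU
    exact hZn W hW hne (Sig.of hcl hh)
  have hZp : Perf Z := by
    intro x O hO ⟨y, hyZ, hyO⟩
    by_contra hcon
    obtain ⟨W, hW, hyW, hWO⟩ := clopen_nhd hO hyO
    have hall : ∀ z ∈ Z ∩ W, z = x := by
      intro z hz
      by_contra hzx
      exact hcon ⟨z, ⟨hz.1, hWO hz.2⟩, hzx⟩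
    refine hZh (Z ∩ W) (Part.mk' hW ⟨y, hyZ, hyW⟩) ?_
    have : Subsingleton ↥(A ∩ (Z ∩ W)) :=
      ⟨fun a b => Subtype.ext ((hall _ a.2.2).trans (hall _ b.2.2).symm)⟩
    exact hhom_subsing
  obtain ⟨K, N, hK, hN, C, hC1, hC2, hC3⟩ := baire_prop hA hZ hZne
  exact ⟨K, N, C, hK.closed hZ, hK.1, hZp.part hK, hN, fun U hU => hZh U (hU.trans hK), hC1, hC2, hC3⟩

theorem Bad.dense {A K N : Set Cs} {C : ℕ → Set Cs} (h : Bad A K N C) {U : Set Cs} (hU : Part U K)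
    {O : Set Cs} (hO : IsOpen O) (hne : (U ∩ O).Nonempty) : (A ∩ U ∩ O).Nonempty := by
  by_contra hcon
  obtain ⟨y, hyU, hyO⟩ := hne
  obtain ⟨W, hW, hyW, hWO⟩ := clopen_nhd hO hyO
  refine h.nh (U ∩ W) ((Part.mk' hW ⟨y, hyU, hyW⟩).trans hU) ?_
  have : Subsingleton ↥(A ∩ (U ∩ W)) :=
      ⟨fun a b => (hcon ⟨a, ⟨a.2.1, a.2.2.1⟩, hWO a.2.2.2⟩).elim⟩
  exact hhom_subsing

theorem Bad.dense' {A K N : Set Cs} {C : ℕ → Set Cs} (h : Bad A K N C) {U : Set Cs} (hU : Part U K) :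
    (Aᶜ ∩ U).Nonempty := by
  by_contra hcon
  refine h.nh U hU ?_
  refine hhom_of (N := Aᶜ) (hU.closed h.cl) (h.perf.part hU) (Or.inr rfl)
    (fun O hO hne => h.dense hU hO hne) (C := fun _ => ∅) (fun _ => isClosed_empty)
    (fun _ => NwdIn.empty _) (fun i O hO => ?_) (fun x hx => (hcon ⟨x, hx⟩).elim)
  refine ⟨∅, ⟨isCompact_empty, by simp, by simp, by simp⟩, by simp [dom], by simp [ran], ?_⟩
  simpa [ran] using NwdIn.empty _

end SH

end

section
namespace SH
open Topology

def Wit (A C U : Set Cs) : Prop :=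
  IsClosed C ∧ C.Nonempty ∧ C ⊆ U ∧ NwdIn C U ∧
    ∀ C', Part C' C → ∃ U', Part U' U ∧ ¬ Emb A A C' U'

theorem Emb.empty (A U : Set Cs) : Emb A A ∅ U := by
  refine ⟨∅, ⟨isCompact_empty, by simp, by simp, by simp⟩, by simp [dom], by simp [ran], ?_⟩
  simpa [ran] using NwdIn.empty _

theorem PE.single {A : Set Cs} {x y : Cs} (h : x ∈ A ↔ y ∈ A) : PE A A {(x, y)} := by
  refine ⟨isCompact_singleton, ?_, ?_, ?_⟩
  · rintro a b b' h1 h2; simp only [Set.mem_singleton_iff, Prod.mk.injEq] at h1 h2; rw [h1.2, h2.2]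
  · rintro a b b' h1 h2; simp only [Set.mem_singleton_iff, Prod.mk.injEq] at h1 h2; rw [h1.1, h2.1]
  · rintro a b h1; simp only [Set.mem_singleton_iff, Prod.mk.injEq] at h1; rw [h1.1, h1.2]; exact h

theorem Bad.single {A K N : Set Cs} {C : ℕ → Set Cs} (h : Bad A K N C) {U : Set Cs} (hU : Part U K)
    (x : Cs) : Emb A A {x} U := by
  obtain ⟨y, hyU, hy⟩ : ∃ y ∈ U, (x ∈ A ↔ y ∈ A) := by
    by_cases hx : x ∈ A
    · obtain ⟨y, ⟨h1, h2⟩, _⟩ := h.dense hU isOpen_univ (by simpa using hU.1)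
      exact ⟨y, h2, by tauto⟩
    · obtain ⟨y, h1, h2⟩ := h.dense' hU
      exact ⟨y, h2, by simp at h1; tauto⟩
  refine ⟨{(x, y)}, PE.single hy, by simp [dom], by simpa [ran] using hyU, ?_⟩
  simpa [ran] using (h.perf.part hU) y

theorem wit_exists {A K N : Set Cs} {C : ℕ → Set Cs} (h : Bad A K N C) {U : Set Cs} (hU : Part U K) :
    ∃ V, Wit A V U := by
  by_contra hcon
  push Not at hcon
  have hUc := hU.closed h.cl
  have hS : ∀ i, Sig (fun E => NwdIn E U ∧ ∀ O, Part O U → Emb A A E O) (C i ∩ U) := by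
    intro i
    by_contra hs
    obtain ⟨Z, hZ, hZne, hZs, hZn⟩ := exhaustion _ ((h.Ccl i).inter hUc) hs
    have hn : NwdIn Z U := ((h.Cn i).part hU).mono fun x hx => (hZs hx).1
    refine hcon Z ⟨hZ, hZne, fun x hx => (hZs hx).2, hn, ?_⟩
    rintro _ ⟨hne, W, hW, rfl⟩
    by_contra h2
    push Not at h2
    exact hZn W hW hne (Sig.of (hZ.inter hW.1) ⟨hn.mono Set.inter_subset_left, h2⟩)
  obtain ⟨E, hE, hEc⟩ := (Sig.iUnion hS).seq ⟨NwdIn.empty _, fun O _ => Emb.empty A O⟩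
  refine h.nh U hU (hhom_of (N := N) hUc (h.perf.part hU) h.hN (fun O hO hne => h.dense hU hO hne)
    (C := E) (fun i => (hE i).1) (fun i => (hE i).2.1) (fun i => (hE i).2.2) ?_)
  rintro x ⟨hxN, hxU⟩
  obtain ⟨i, hi⟩ := Set.mem_iUnion.1 (h.cov ⟨hxN, hU.subset hxU⟩)
  exact hEc (Set.mem_iUnion.2 ⟨i, hi, hxU⟩)

theorem Wit.part {A C C' U : Set Cs} (h : Wit A C U) (hC : Part C' C) : Wit A C' U :=
  ⟨hC.closed h.1, hC.1, hC.subset.trans h.2.2.1, h.2.2.2.1.mono hC.subset,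
    fun C'' h2 => h.2.2.2.2 C'' (h2.trans hC)⟩

theorem Wit.up {A C U V : Set Cs} (h : Wit A C U) (hU : Part U V) : Wit A C V :=
  ⟨h.1, h.2.1, h.2.2.1.trans hU.subset, h.2.2.2.1.ofPart hU h.2.2.1, fun C' h2 => by
    obtain ⟨U', h3, h4⟩ := h.2.2.2.2 C' h2
    exact ⟨U', h3.trans hU, h4⟩⟩

theorem nonperf {P : Set Cs} (h : ¬ Perf P) : ∃ O x, IsClopen O ∧ P ∩ O = {x} := by
  unfold Perf NwdIn at h
  push Not at h
  obtain ⟨x, O, hO, ⟨y, hyP, hyO⟩, h2⟩ := h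
  obtain ⟨W, hW, hyW, hWO⟩ := clopen_nhd hO hyO
  have hall : ∀ z ∈ P ∩ W, z = x := by
    intro z hz
    by_contra hzx
    have : z ∈ (P ∩ O) \ {x} := ⟨⟨hz.1, hWO hz.2⟩, hzx⟩
    rw [h2] at this; exact this
  refine ⟨W, x, hW, Set.eq_singleton_iff_nonempty_unique_mem.2 ⟨⟨y, hyP, hyW⟩, hall⟩⟩

theorem Wit.perf {A K N C U : Set Cs} {D : ℕ → Set Cs} (hB : Bad A K N D) (hU : Part U K)
    (h : Wit A C U) : Perf C := by
  by_contra hp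
  obtain ⟨O, x, hO, hx⟩ := nonperf hp
  obtain ⟨U', h1, h2⟩ := h.2.2.2.2 (C ∩ O) (Part.mk' hO (by rw [hx]; simp))
  rw [hx] at h2
  exact h2 (hB.single (h1.trans hU) x)

/-! ### Low sets -/

def Low (A : Set Cs) : ℕ → Set Cs → Prop
  | 0, K => K.Subsingleton
  | m+1, K => ∃ S, Sig (Low A m) S ∧ (K \ S ⊆ A ∨ K \ S ⊆ Aᶜ)

theorem Low.mono {A K K' : Set Cs} {m : ℕ} (h : Low A m K) (hK : K' ⊆ K) : Low A m K' := by
  cases m with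
  | zero => exact Set.Subsingleton.anti h hK
  | succ m =>
    obtain ⟨S, h1, h2⟩ := h
    exact ⟨S, h1, h2.imp (fun h x hx => h ⟨hK hx.1, hx.2⟩) (fun h x hx => h ⟨hK hx.1, hx.2⟩)⟩

theorem Low.succ {A K : Set Cs} {m : ℕ} (h : Low A m K) (hK : IsClosed K) : Low A (m+1) K :=
  ⟨K, Sig.of hK h, by simp⟩

theorem Low.zero {A K : Set Cs} {m : ℕ} (h : K.Subsingleton) : Low A m K := by
  have hc : IsClosed K := h.isClosed
  induction m with
  | zero => exact h
  | succ m ih => exact ih.succ hc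

theorem SigLow.countable {A T : Set Cs} {m : ℕ} (hT : T.Countable) : Sig (Low A m) T :=
  ⟨(fun x => {x}) '' T, hT.image _, by
    rintro _ ⟨x, hx, rfl⟩
    exact ⟨isClosed_singleton, Low.zero Set.subsingleton_singleton⟩,
    fun x hx => ⟨{x}, ⟨x, hx, rfl⟩, rfl⟩⟩

theorem pull_closure {Q T E : Set Cs} {g : Cs → Cs} (hQ : IsClosed Q) (hg : ContinuousOn g (Q \ T))
    (hE : IsClosed E) {x : Cs} (hx : x ∈ closure {x ∈ Q \ T | g x ∈ E}) (hxT : x ∉ T) :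
    x ∈ Q \ T ∧ g x ∈ E := by
  have hxQ : x ∈ Q := closure_minimal (fun y hy => hy.1.1) hQ hx
  refine ⟨⟨hxQ, hxT⟩, ?_⟩
  have hc : ContinuousWithinAt g {x ∈ Q \ T | g x ∈ E} x :=
    (hg x ⟨hxQ, hxT⟩).mono fun y hy => hy.1
  have := hc.mem_closure hx (t := E) (fun y hy => hy.2)
  rwa [hE.closure_eq] at this

theorem pull {A : Set Cs} {k : ℕ} : ∀ {E Q T : Set Cs} {g : Cs → Cs}, Low A k E → IsClosed Q →
    T.Countable → ContinuousOn g (Q \ T) → (∀ x ∈ Q \ T, g x ∈ E) → ∀ s : Prop,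
    (∀ x ∈ Q \ T, (x ∈ A ↔ (g x ∈ A ↔ s))) → Low A (k+1) Q := by
  induction k with
  | zero =>
    intro E Q T g hE hQ hT hg hgE s hs
    refine ⟨T, SigLow.countable hT, ?_⟩
    by_cases hc : ∃ x ∈ Q \ T, x ∈ A
    · obtain ⟨x, hx, hxA⟩ := hc
      left
      intro y hy
      have h1 := hs x hx
      have h2 := hs y hy
      rw [hE (hgE y hy) (hgE x hx)] at h2
      tauto
    · right
      intro y hy hyA
      exact hc ⟨y, hy, hyA⟩
  | succ k ih =>
    intro E Q T g hE hQ hT hg hgE s hs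
    obtain ⟨S, ⟨SS, h1, h2, h3⟩, h4⟩ := hE
    let Qj : Set Cs → Set Cs := fun F => closure {x ∈ Q \ T | g x ∈ F}
    have hQj : ∀ F ∈ SS, Low A (k+1) (Qj F) := by
      intro F hF
      have key : ∀ x ∈ Qj F \ T, x ∈ Q \ T ∧ g x ∈ F := fun x hx =>
        pull_closure hQ hg (h2 F hF).1 hx.1 hx.2
      exact ih (h2 F hF).2 isClosed_closure hT (hg.mono fun x hx => (key x hx).1)
        (fun x hx => (key x hx).2) s (fun x hx => hs x (key x hx).1)
    refine ⟨T ∪ ⋃₀ (Qj '' SS), (SigLow.countable hT).union ⟨Qj '' SS, h1.image _, ?_, le_rfl⟩, ?_⟩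
    · rintro _ ⟨F, hF, rfl⟩
      exact ⟨isClosed_closure, hQj F hF⟩
    · have key : ∀ x ∈ Q \ (T ∪ ⋃₀ (Qj '' SS)), x ∈ Q \ T ∧ g x ∈ E \ S := by
        rintro x ⟨hxQ, hx⟩
        have hxT : x ∈ Q \ T := ⟨hxQ, fun h => hx (Or.inl h)⟩
        refine ⟨hxT, hgE x hxT, fun hS => hx (Or.inr ?_)⟩
        obtain ⟨F, hF, hxF⟩ := h3 hS
        exact ⟨_, ⟨F, hF, rfl⟩, subset_closure ⟨hxT, hxF⟩⟩
      by_cases hc : ∃ x ∈ Q \ (T ∪ ⋃₀ (Qj '' SS)), x ∈ A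
      · obtain ⟨x, hx, hxA⟩ := hc
        left
        intro y hy
        have h5 := hs x (key x hx).1
        have h6 := hs y (key y hy).1
        have h7 : g x ∈ A ↔ g y ∈ A := by
          rcases h4 with h4 | h4
          · exact ⟨fun _ => h4 (key y hy).2, fun _ => h4 (key x hx).2⟩
          · exact ⟨fun h => (h4 (key x hx).2 h).elim, fun h => (h4 (key y hy).2 h).elim⟩
        tauto
      · right
        intro y hy hyA
        exact hc ⟨y, hy, hyA⟩

theorem pull_sig {A : Set Cs} {k : ℕ} {S Q T : Set Cs} {g : Cs → Cs} (hS : Sig (Low A k) S)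
    (hQ : IsClosed Q) (hT : T.Countable) (hg : ContinuousOn g (Q \ T)) (s : Prop)
    (hs : ∀ x ∈ Q \ T, (x ∈ A ↔ (g x ∈ A ↔ s))) : Sig (Low A (k+1)) {x ∈ Q \ T | g x ∈ S} := by
  obtain ⟨SS, h1, h2, h3⟩ := hS
  refine ⟨(fun F => closure {x ∈ Q \ T | g x ∈ F}) '' SS, h1.image _, ?_, ?_⟩
  · rintro _ ⟨F, hF, rfl⟩
    refine ⟨isClosed_closure, ?_⟩
    have key : ∀ x ∈ closure {x ∈ Q \ T | g x ∈ F} \ T, x ∈ Q \ T ∧ g x ∈ F := fun x hx =>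
        pull_closure hQ hg (h2 F hF).1 hx.1 hx.2
    exact pull (h2 F hF).2 isClosed_closure hT (hg.mono fun x hx => (key x hx).1)
        (fun x hx => (key x hx).2) s (fun x hx => hs x (key x hx).1)
  · rintro x ⟨hx, hxS⟩
    obtain ⟨F, hF, hxF⟩ := h3 hxS
    exact ⟨_, ⟨F, hF, rfl⟩, subset_closure ⟨hx, hxF⟩⟩

/-! ### types -/

theorem types (A : Set Cs) (m : ℕ) : ∃ (T : Type) (_ : Finite T) (Typ : T → Set Cs → Prop),
    (∀ P, IsClosed P → P.Nonempty → Low A m P → ∃ O, IsClopen O ∧ (P ∩ O).Nonempty ∧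
      ∃ τ, Typ τ (P ∩ O)) ∧
    (∀ τ W W', Typ τ W → Typ τ W' → PEmb A A W W') ∧
    (∀ τ W, Typ τ W → IsClosed W) := by
  induction m with
  | zero =>
    refine ⟨Bool, inferInstance, fun b W => ∃ x, W = {x} ∧ (x ∈ A ↔ b = true), ?_, ?_, ?_⟩
    · rintro P hP ⟨x, hx⟩ hL
      refine ⟨Set.univ, isClopen_univ, ⟨x, hx, trivial⟩, ?_⟩
      have : P ∩ Set.univ = {x} := by
        rw [Set.inter_univ]; exact Set.eq_singleton_iff_unique_mem.2 ⟨hx, fun y hy => hL hy hx⟩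
      by_cases hxA : x ∈ A
      · exact ⟨true, x, this, by simp [hxA]⟩
      · exact ⟨false, x, this, by simp [hxA]⟩
    · rintro τ _ _ ⟨x, rfl, hx⟩ ⟨y, rfl, hy⟩
      exact ⟨{(x, y)}, PE.single (hx.trans hy.symm), by simp [dom], by simp [ran]⟩
    · rintro τ _ ⟨x, rfl, hx⟩; exact isClosed_singleton
  | succ m ih =>
    obtain ⟨T, hT, Typ, ha, hb, hc⟩ := ih
    let Aε : Bool → Set Cs := fun b => if b then A else Aᶜ
    have hAε : ∀ b, Aε b = A ∨ Aε b = Aᶜ := by rintro (_ | _) <;> simp [Aε]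
    let Typ' : T ⊕ (Bool × Set T) → Set Cs → Prop := fun τ W => match τ with
      | Sum.inl τ => Typ τ W
      | Sum.inr (b, I) => IsClosed W ∧ W.Nonempty ∧ Perf W ∧
          Sig (fun D => NwdIn D W ∧ (D = ∅ ∨ ∃ τ ∈ I, Typ τ D)) (Aε b ∩ W) ∧
          ∀ τ ∈ I, ∀ E, Typ τ E → ∀ P, Part P W → Emb A A E P
    refine ⟨T ⊕ (Bool × Set T), inferInstance, Typ', ?_, ?_, ?_⟩
    · intro P hP hPne hL
      have hsub : ∀ O, IsClopen O → (P ∩ O).Nonempty → Low A m (P ∩ O) →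
          ∃ O, IsClopen O ∧ (P ∩ O).Nonempty ∧ ∃ τ, Typ' τ (P ∩ O) := by
        intro O hO hne hLo
        obtain ⟨O', hO', hne', τ, hτ⟩ := ha (P ∩ O) (hP.inter hO.1) hne hLo
        rw [Set.inter_assoc] at hne' hτ
        exact ⟨O ∩ O', hO.inter hO', hne', Sum.inl τ, hτ⟩
      obtain ⟨S, ⟨SS, h1, h2, h3⟩, h4⟩ := hL
      by_cases hperf : Perf P
      swap
      · obtain ⟨O, x, hO, hx⟩ := nonperf hperf
        exact hsub O hO (by rw [hx]; simp) (by rw [hx]; exact Low.zero Set.subsingleton_singleton)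
      by_cases hnwd : ∀ E ∈ SS, NwdIn E P
      swap
      · push Not at hnwd
        obtain ⟨E, hE, hEn⟩ := hnwd
        unfold NwdIn at hEn
        push Not at hEn
        obtain ⟨O, hO, ⟨y, hyP, hyO⟩, h5⟩ := hEn
        obtain ⟨W, hW, hyW, hWO⟩ := clopen_nhd hO hyO
        refine hsub W hW ⟨y, hyP, hyW⟩ ((h2 E hE).2.mono ?_)
        intro z hz
        by_contra hzE
        have : z ∈ (P ∩ O) \ E := ⟨⟨hz.1, hWO hz.2⟩, hzE⟩
        rw [h5] at this; exact this
      obtain ⟨b, hbε⟩ : ∃ b, Aε b ∩ P ⊆ S := by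
        rcases h4 with h4 | h4
        · exact ⟨false, fun x hx => by by_contra h; exact hx.1 (h4 ⟨hx.2, h⟩)⟩
        · exact ⟨true, fun x hx => by by_contra h; exact (h4 ⟨hx.2, h⟩) hx.1⟩
      let I : Set Cs → Set T := fun O => {τ | ∀ E, Typ τ E → Emb A A E (P ∩ O)}
      have hImono : ∀ O O', IsClopen O' → O' ⊆ O → I O' ⊆ I O := by
        intro O O' hO' hs τ hτ E hE
        exact (hτ E hE).mono_right (hP.inter hO'.1) (Set.inter_subset_inter_right _ hs)
      let ok : ℕ → Prop := fun n => ∃ O, IsClopen O ∧ (P ∩ O).Nonempty ∧ (I O).ncard = n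
      have hok : ∃ n, ok n := ⟨_, Set.univ, isClopen_univ, by simpa using hPne, rfl⟩
      classical
      obtain ⟨O, hO, hOne, hOn⟩ := Nat.find_spec hok
      have hmin : ∀ O', IsClopen O' → O' ⊆ O → (P ∩ O').Nonempty → I O' = I O := by
        intro O' hO' hs hne
        refine Set.eq_of_subset_of_ncard_le (hImono O O' hO' hs) ?_ (Set.toFinite _)
        rw [hOn]; exact Nat.find_min' hok ⟨O', hO', hne, rfl⟩
      have hPO : Part (P ∩ O) P := Part.mk' hO hOne
      refine ⟨O, hO, hOne, Sum.inr (b, I O), hP.inter hO.1, hOne, hperf.part hPO, ?_, ?_⟩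
      · have hEsig : ∀ E : SS, Sig (fun D => NwdIn D (P ∩ O) ∧ (D = ∅ ∨ ∃ τ ∈ I O, Typ τ D))
            (E.1 ∩ (P ∩ O)) := by
          rintro ⟨E, hE⟩
          by_contra hs
          obtain ⟨Z, hZ, hZne, hZs, hZn⟩ := exhaustion _ ((h2 E hE).1.inter (hP.inter hO.1)) hs
          obtain ⟨O', hO', hne', τ, hτ⟩ := ha Z hZ hZne ((h2 E hE).2.mono fun x hx => (hZs hx).1)
          have hn : NwdIn (Z ∩ O') (P ∩ O) :=
            ((hnwd E hE).part hPO).mono fun x hx => (hZs hx.1).1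
          refine hZn O' hO' hne' (Sig.of (hZ.inter hO'.1) ⟨hn, Or.inr ⟨τ, ?_, hτ⟩⟩)
          intro E' hE'
          exact (hb τ _ _ hE' hτ).emb_of_nwd (fun x hx => (hZs hx.1).2) hn
        have := h1.to_subtype
        refine (Sig.iUnion hEsig).mono ?_
        rintro x ⟨hxA, hx⟩
        obtain ⟨E, hE, hxE⟩ := h3 (hbε ⟨hxA, hx.1⟩)
        exact Set.mem_iUnion.2 ⟨⟨E, hE⟩, hxE, hx⟩
      · rintro τ hτ E hE _ ⟨hne, W, hW, rfl⟩
        rw [Set.inter_assoc] at hne ⊢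
        have := hmin (O ∩ W) (hO.inter hW) Set.inter_subset_left hne
        rw [← this] at hτ
        exact hτ E hE
    · rintro (τ | ⟨b, I⟩) W W' h h'
      · exact hb τ _ _ h h'
      · obtain ⟨h1, h2, h3, h4, h5⟩ := h
        obtain ⟨h1', h2', h3', h4', h5'⟩ := h'
        obtain ⟨C, hC, hCc⟩ := h4.seq ⟨NwdIn.empty _, Or.inl rfl⟩
        obtain ⟨C', hC', hCc'⟩ := h4'.seq ⟨NwdIn.empty _, Or.inl rfl⟩
        obtain ⟨R, hR, hRd, hRr⟩ := lemmaH (A := A) (N := Aε b) h1 h1' h2 h2' h3 h3' (hAε b)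
          (fun i => (hC i).1) (fun i => (hC' i).1) (fun i => (hC i).2.1) (fun i => (hC' i).2.1)
          (fun i O hO => by
            rcases (hC i).2.2 with h | ⟨τ, hτ, h⟩
            · rw [h]; exact Emb.empty _ _
            · exact h5' τ hτ _ h O hO)
          (fun i O hO => by
            rcases (hC' i).2.2 with h | ⟨τ, hτ, h⟩
            · rw [h]; exact Emb.empty _ _
            · exact h5 τ hτ _ h O hO) hCc hCc'
        exact ⟨R, hR, hRd, hRr.le⟩
    · rintro (τ | ⟨b, I⟩) W h
      · exact hc τ _ h
      · exact h.1

theorem claimL {A K N : Set Cs} {D : ℕ → Set Cs} (hB : Bad A K N D) (m : ℕ) {U : Set Cs}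
    (hU : Part U K) : ∃ U', Part U' U ∧ ∀ U'', Part U'' U' → ∀ V, Wit A V U'' →
      ¬ Sig (Low A m) V := by
  by_contra hcon
  push Not at hcon
  obtain ⟨T, hT, Typ, ha, hb, hc⟩ := types A m
  have step : ∀ P : {P // Part P U}, ∃ (Q : {P // Part P U}) (V X : Set Cs) (τ : T),
      Part Q.1 X ∧ Part X P.1 ∧ V ⊆ X ∧ NwdIn V X ∧ Typ τ V ∧ ¬ Emb A A V Q.1 := by
    rintro ⟨P, hP⟩
    obtain ⟨X, hX, V, hV, hVs⟩ := hcon P hP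
    obtain ⟨E, hE, hEL, W, hW, hne, hWE⟩ := baire hV.1 hV.2.1 hVs
    obtain ⟨O, hO, hOne, τ, hτ⟩ := ha _ (hV.1.inter hW.1) hne (hEL.mono hWE)
    have hp : Part (V ∩ W ∩ O) V := (Part.mk' hO hOne).trans (Part.mk' hW hne)
    have hw := hV.part hp
    obtain ⟨Q, hQ, hQn⟩ := hw.2.2.2.2 _ (Part.refl hw.2.1)
    exact ⟨⟨Q, hQ.trans (hX.trans hP)⟩, _, X, τ, hQ, hX, hw.2.2.1, hw.2.2.2.1, hτ, hQn⟩
  choose Q V X τ h1 h2 h3 h4 h5 h6 using step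
  let sq : ℕ → {P // Part P U} := fun n => Nat.rec ⟨U, Part.refl hU.1⟩ (fun _ P => Q P) n
  have hsq : ∀ n, sq (n+1) = Q (sq n) := fun n => rfl
  have hpart : ∀ n k, Part (sq (n+k)).1 (sq n).1 := by
    intro n k
    induction k with
    | zero => exact Part.refl (sq n).2.1
    | succ k ih => exact ((h1 (sq (n+k))).trans (h2 _)).trans ih
  have hlt : ∀ i j, i < j → τ (sq i) = τ (sq j) → False := by
    intro i j hij he
    obtain ⟨k, rfl⟩ := Nat.exists_eq_add_of_lt hij
    have e1 : PEmb A A (V (sq i)) (V (sq (i+k+1))) := hb _ _ _ (h5 _) (he ▸ h5 _)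
    have e2 := e1.emb_of_nwd (h3 _) (h4 _)
    have hX : Part (X (sq (i+k+1))) (sq (i+1)).1 := (h2 _).trans (by
      have := hpart (i+1) k
      rwa [show i + 1 + k = i + k + 1 by ring] at this)
    have hcl : IsClosed (X (sq (i+k+1))) :=
      (hX.trans ((sq (i+1)).2.trans hU)).closed hB.cl
    exact h6 (sq i) (e2.mono_right hcl hX.subset)
  obtain ⟨i, j, hij, he⟩ := Finite.exists_ne_map_eq_of_infinite (fun n => τ (sq n))
  rcases lt_or_gt_of_ne hij with h | h
  · exact hlt i j h he
  · exact hlt j i h he.symm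

end SH

end

section
namespace SH

section games
variable {M : Type}

/-- Positions are stored with the latest move first. -/
def hist (x : ℕ → M) : ℕ → List M
  | 0 => []
  | n + 1 => x n :: hist x n

@[simp] lemma hist_zero (x : ℕ → M) : hist x 0 = [] := rfl
lemma hist_succ (x : ℕ → M) (n : ℕ) : hist x (n + 1) = x n :: hist x n := rfl

@[simp] lemma hist_length (x : ℕ → M) (n : ℕ) : (hist x n).length = n := by
  induction n with
  | zero => rfl
  | succ n ih => simp [hist_succ, ih]

lemma hist_suffix_le (x : ℕ → M) {m n : ℕ} (h : m ≤ n) : hist x m <:+ hist x n := by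
  induction n, h using Nat.le_induction with
  | base => exact List.suffix_refl _
  | succ n _ ih => exact ih.trans (List.suffix_cons _ _)

lemma hist_suffix {x : ℕ → M} {n : ℕ} {u : List M} (h : u <:+ hist x n) :
    u.length ≤ n ∧ u = hist x u.length := by
  have h1 : u.length ≤ n := by simpa using h.length_le
  refine ⟨h1, ?_⟩
  have h2 := hist_suffix_le x h1
  exact (List.suffix_of_suffix_length_le h h2 (by simp)).eq_of_length (by simp)

lemma hist_agree {x y : ℕ → M} {n : ℕ} (h : hist x n = hist y n) {m : ℕ} (hm : m ≤ n) :
    hist x m = hist y m := by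
  have h1 := hist_suffix_le x hm
  rw [h] at h1
  have := (hist_suffix h1).2
  simpa using this

lemma hist_eval {x y : ℕ → M} {n : ℕ} (h : hist x n = hist y n) {m : ℕ} (hm : m < n) :
    x m = y m := by
  have := hist_agree h (m := m + 1) hm
  simp only [hist_succ, List.cons.injEq] at this
  exact this.1

lemma hist_map {M' : Type} (f : M → M') (x : ℕ → M) (n : ℕ) :
    (hist x n).map f = hist (fun i => f (x i)) n := by
  induction n with
  | zero => rfl
  | succ n ih => simp [hist_succ, ih]

lemma hist_ext {x y : ℕ → M} {n : ℕ} (h : ∀ m < n, x m = y m) : hist x n = hist y n := by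
  induction n with
  | zero => rfl
  | succ n ih => rw [hist_succ, hist_succ, h n (by omega), ih (fun m hm => h m (by omega))]

structure IsTree (T : Set (List M)) : Prop where
  nil : [] ∈ T
  cls : ∀ m t, m :: t ∈ T → t ∈ T
  prune : ∀ t ∈ T, ∃ m, m :: t ∈ T

lemma IsTree.suff {T : Set (List M)} (hT : IsTree T) {s t : List M} (h : s <:+ t) (ht : t ∈ T) :
    s ∈ T := by
  induction t with
  | nil => rw [List.suffix_nil.1 h]; exact ht
  | cons m t ih =>
    rcases List.suffix_cons_iff.1 h with h | h
    · rw [h]; exact ht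
    · exact ih h (hT.cls _ _ ht)

def Run (T : Set (List M)) (x : ℕ → M) : Prop := ∀ n, hist x n ∈ T
def Legal (T : Set (List M)) (i : ℕ) (σ : List M → M) : Prop :=
  ∀ t ∈ T, t.length % 2 = i → σ t :: t ∈ T
def ConsF (n0 i : ℕ) (σ : List M → M) (x : ℕ → M) : Prop :=
  ∀ n, n0 ≤ n → n % 2 = i → x n = σ (hist x n)

open Classical in
/-- Legalised version of a strategy. -/
noncomputable def fxv (T : Set (List M)) (t : List M) (v : M) : M :=
  if h : ∃ m, m :: t ∈ T ∧ ¬ (v :: t ∈ T) then h.choose else v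

noncomputable def fx (T : Set (List M)) (σ : List M → M) : List M → M := fun t =>
  fxv T t (σ t)

lemma fx_legal {T : Set (List M)} (hT : IsTree T) (i : ℕ) (σ : List M → M) :
    Legal T i (fx T σ) := by
  intro t ht _
  unfold fx fxv
  split_ifs with h
  · exact h.choose_spec.1
  · by_contra hc
    obtain ⟨m, hm⟩ := hT.prune t ht
    exact h ⟨m, hm, hc⟩

lemma fx_eq {T : Set (List M)} {σ : List M → M} {t : List M} (h : σ t :: t ∈ T) :
    fx T σ t = σ t := by
  unfold fx fxv
  rw [dif_neg]
  rintro ⟨m, _, hc⟩; exact hc h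

lemma fx_congr (T : Set (List M)) {σ σ' : List M → M} {t : List M} (h : σ t = σ' t) :
    fx T σ t = fx T σ' t := by
  unfold fx
  rw [h]

open Classical in
noncomputable def firs (S : Set (List M)) : List M → List M
  | [] => []
  | m :: t => if ∃ u ∈ S, u <:+ t then firs S t else m :: t

lemma firs_mem (S : Set (List M)) {t : List M} (h : ∃ u ∈ S, u <:+ t) : firs S t ∈ S := by
  induction t with
  | nil =>
    obtain ⟨u, hu, hs⟩ := h
    rw [List.suffix_nil.1 hs] at hu
    exact hu
  | cons m t ih =>
    unfold firs
    split_ifs with h'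
    · exact ih h'
    · obtain ⟨u, hu, hs⟩ := h
      rcases List.suffix_cons_iff.1 hs with h | h
      · rw [← h]; exact hu
      · exact absurd ⟨u, hu, h⟩ h'

open Classical in
noncomputable def sw (S : Set (List M)) (σu : List M → List M → M) (σ0 : List M → M) : List M → M :=
  fun t => if ∃ u ∈ S, u <:+ t then σu (firs S t) t else σ0 t

lemma sw_legal {T S : Set (List M)} {i : ℕ} {σu : List M → List M → M} {σ0 : List M → M}
    (h : ∀ u ∈ S, Legal T i (σu u)) (h0 : Legal T i σ0) : Legal T i (sw S σu σ0) := by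
  intro t ht hp
  unfold sw
  split_ifs with hs
  · exact h _ (firs_mem S hs) t ht hp
  · exact h0 t ht hp

lemma sw_cons {S : Set (List M)} {i n0 : ℕ} {σu : List M → List M → M} {σ0 : List M → M}
    {x : ℕ → M} (h : ConsF n0 i (sw S σu σ0) x) :
    (∃ n, hist x n ∈ S ∧ ∀ m, n0 ≤ m → n ≤ m → m % 2 = i → x m = σu (hist x n) (hist x m)) ∨
    ((∀ n, hist x n ∉ S) ∧ ConsF n0 i σ0 x) := by
  classical
  by_cases hh : ∃ n, hist x n ∈ S
  · left
    have hn := Nat.find_spec hh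
    set n := Nat.find hh with hndef
    refine ⟨n, hn, ?_⟩
    have key : ∀ m, n ≤ m → firs S (hist x m) = hist x n := by
      intro m hm
      induction m, hm using Nat.le_induction with
      | base =>
        have hno : ∀ j < n, hist x j ∉ S := fun j hj => Nat.find_min hh hj
        rcases hn0 : n with _ | j
        · rfl
        · rw [hist_succ]; unfold firs
          rw [if_neg]
          rintro ⟨u, hu, hs⟩
          have := hist_suffix hs
          rw [this.2] at hu
          exact hno _ (by omega) hu
      | succ m hm ih =>
        rw [hist_succ]; unfold firs
        rw [if_pos ⟨_, hn, hist_suffix_le x hm⟩, ih]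
    intro m h0 hm hp
    have := h m h0 hp
    unfold sw at this
    rw [if_pos ⟨_, hn, hist_suffix_le x hm⟩, key m hm] at this
    exact this
  · right
    push Not at hh
    refine ⟨hh, fun m h0 hp => ?_⟩
    have := h m h0 hp
    unfold sw at this
    rw [if_neg] at this
    · exact this
    · rintro ⟨u, hu, hs⟩
      rw [(hist_suffix hs).2] at hu
      exact hh _ hu

def ForceBy (T : Set (List M)) (i : ℕ) (S : Set (List M)) (t : List M) (τ : List M → M) : Prop :=
  Legal T i τ ∧ ∀ x, Run T x → hist x t.length = t → ConsF t.length i τ x → ∃ n, hist x n ∈ S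

def Force (T : Set (List M)) (i : ℕ) (S : Set (List M)) (t : List M) : Prop :=
  ∃ τ, ForceBy T i S t τ

lemma IsTree.nonempty {T : Set (List M)} (hT : IsTree T) : Nonempty M :=
  ⟨(hT.prune _ hT.nil).choose⟩

lemma IsTree.legal {T : Set (List M)} (hT : IsTree T) : ∃ σ, ∀ i, Legal T i σ :=
  have := hT.nonempty
  ⟨fx T (fun _ => Classical.arbitrary M), fun i => fx_legal hT i _⟩

lemma force_mem {T S : Set (List M)} (hT : IsTree T) (i : ℕ) {t : List M} (h : t ∈ S) :
    Force T i S t := by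
  obtain ⟨σ, hσ⟩ := hT.legal
  exact ⟨σ, hσ i, fun x _ hx _ => ⟨t.length, by rw [hx]; exact h⟩⟩

lemma force_own {T S : Set (List M)} (hT : IsTree T) {i : ℕ} {t : List M} {m : M}
    (hp : t.length % 2 = i) (hm : m :: t ∈ T) (h : Force T i S (m :: t)) : Force T i S t := by
  obtain ⟨τ, hτ, hw⟩ := h
  refine ⟨sw {m :: t} (fun _ => τ) (fx T (fun _ => m)), sw_legal (fun _ _ => hτ) (fx_legal hT i _), ?_⟩
  intro x hx ht hc
  rcases sw_cons hc with ⟨n, hn, hcn⟩ | ⟨hno, hc0⟩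
  · have hn' : hist x n = m :: t := hn
    have hl : n = t.length + 1 := by
      have := congrArg List.length hn'
      simpa using this
    subst hl
    refine hw x hx (by simpa using hn') ?_
    intro j hj hpj
    simp only [List.length_cons] at hj
    exact hcn j (by omega) hj hpj
  · exfalso
    have := hc0 t.length le_rfl hp
    rw [ht, fx_eq (σ := fun _ => m) hm] at this
    exact hno (t.length + 1) (by simp [hist_succ, ht, this])

lemma force_opp {T S : Set (List M)} (hT : IsTree T) {i : ℕ} {t : List M}
    (h : ∀ m, m :: t ∈ T → Force T i S (m :: t)) : Force T i S t := by
  obtain ⟨σ, hσ⟩ := hT.legal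
  have h' : ∀ u, ∃ τ, (∃ m, u = m :: t ∧ u ∈ T) → ForceBy T i S u τ := by
    intro u
    by_cases hu : ∃ m, u = m :: t ∧ u ∈ T
    · obtain ⟨m, rfl, hm⟩ := hu
      obtain ⟨τ, hτ⟩ := h m hm
      exact ⟨τ, fun _ => hτ⟩
    · exact ⟨σ, fun hh => absurd hh hu⟩
  choose τ hτ using h'
  refine ⟨sw {u | ∃ m, u = m :: t ∧ u ∈ T} τ σ, sw_legal (fun u hu => (hτ u hu).1) (hσ i), ?_⟩
  intro x hx ht hc
  have hmem : hist x (t.length + 1) ∈ {u | ∃ m, u = m :: t ∧ u ∈ T} :=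
    ⟨x t.length, by rw [hist_succ, ht], hx _⟩
  rcases sw_cons hc with ⟨n, hn, hcn⟩ | ⟨hno, _⟩
  · have hn' := hn
    obtain ⟨m, hm, _⟩ := hn'
    have hl : n = t.length + 1 := by
      have := congrArg List.length hm
      simpa using this
    refine (hτ _ hn).2 x hx (by simp) ?_
    intro j hj hpj
    simp only [hist_length] at hj
    exact hcn j (by omega) hj hpj
  · exact absurd hmem (hno _)

noncomputable def fo [Nonempty M] (T : Set (List M)) (i : ℕ) (S : Set (List M)) (r : List M) :
    List M → M :=
  Classical.epsilon (fun τ => ForceBy T i S r τ)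

lemma fo_spec [Nonempty M] {T : Set (List M)} {i : ℕ} {S : Set (List M)} {r : List M}
    (h : Force T i S r) : ForceBy T i S r (fo T i S r) :=
  Classical.epsilon_spec h

noncomputable def comb [Nonempty M] (T : Set (List M)) (n0 i : ℕ) (S : Set (List M))
    (σu : List M → List M → M) (σ0 : List M → M) : List M → M :=
  sw S (fun u => fx T (σu u)) (sw {r | n0 ≤ r.length ∧ Force T i S r} (fo T i S) (fx T σ0))

lemma comb_legal [Nonempty M] {T : Set (List M)} (hT : IsTree T) (n0 i : ℕ) (S : Set (List M))
    (σu : List M → List M → M) (σ0 : List M → M) : Legal T i (comb T n0 i S σu σ0) :=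
  sw_legal (fun u _ => fx_legal hT i _)
    (sw_legal (fun u hu => (fo_spec hu.2).1) (fx_legal hT i _))

lemma comb_cons [Nonempty M] {T : Set (List M)} {n0 i : ℕ} {S : Set (List M)}
    {σu : List M → List M → M} {σ0 : List M → M} {x : ℕ → M} (hx : Run T x)
    (h : ConsF n0 i (comb T n0 i S σu σ0) x) :
    (∃ n, hist x n ∈ S ∧ ∀ m, n0 ≤ m → n ≤ m → m % 2 = i →
      x m = fx T (σu (hist x n)) (hist x m)) ∨
    ((∀ n, n0 ≤ n → ¬ Force T i S (hist x n)) ∧ ConsF n0 i (fx T σ0) x) := by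
  rcases sw_cons h with h | ⟨hno, h⟩
  · exact Or.inl h
  · right
    rcases sw_cons h with ⟨n, hn, hc⟩ | ⟨hno', h⟩
    · exfalso
      have hn0 : n0 ≤ n := by have := hn.1; simpa using this
      obtain ⟨k, hk⟩ := (fo_spec hn.2).2 x hx (by simp) (by
        intro m hm hp
        simp only [hist_length] at hm
        exact hc m (by omega) hm hp)
      exact hno k hk
    · exact ⟨fun n hn hF => hno' n ⟨by simpa using hn, hF⟩, h⟩

/-- Coverings of trees. -/
structure Cov (k : ℕ) {M' : Type} (T : Set (List M)) (T' : Set (List M')) (f : M' → M)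
    (φ : ℕ → (List M' → M') → (List M → M)) : Prop where
  tree : IsTree T'
  map : ∀ s ∈ T', s.map f ∈ T
  leg : ∀ i σ, Legal T' i σ → Legal T i (φ i σ)
  loc : ∀ i σ σ' n, Legal T' i σ → Legal T' i σ' →
    (∀ t ∈ T', t.length < n → t.length % 2 = i → σ t = σ' t) →
    ∀ t ∈ T, t.length < n → t.length % 2 = i → φ i σ t = φ i σ' t
  lift : ∀ i σ x, i < 2 → Legal T' i σ → Run T x → ConsF 0 i (φ i σ) x →
    ∃ x' : ℕ → M', Run T' x' ∧ (∀ n, f (x' n) = x n) ∧ ConsF 0 i σ x'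
  surj : ∀ s ∈ T, s.length ≤ k → ∃ s' ∈ T', s'.map f = s
  uniq : ∀ s ∈ T', ∀ s' ∈ T', s.length ≤ k → s.map f = s'.map f → s = s'
  idn : ∀ i σ s, Legal T' i σ → s ∈ T' → s.length < k → s.length % 2 = i →
    φ i σ (s.map f) = f (σ s)

lemma Cov.mono {k k' : ℕ} {M' : Type} {T : Set (List M)} {T' : Set (List M')} {f : M' → M}
    {φ : ℕ → (List M' → M') → (List M → M)} (h : Cov k' T T' f φ) (hk : k ≤ k') :
    Cov k T T' f φ :=
  ⟨h.tree, h.map, h.leg, h.loc, h.lift, fun s hs hl => h.surj s hs (hl.trans hk),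
    fun s hs s' hs' hl => h.uniq s hs s' hs' (hl.trans hk),
    fun i σ s hσ hs hl => h.idn i σ s hσ hs (hl.trans_le hk)⟩

lemma Cov.comp {k : ℕ} {M' M'' : Type} {T : Set (List M)} {T' : Set (List M')}
    {T'' : Set (List M'')} {f : M' → M} {g : M'' → M'}
    {φ : ℕ → (List M' → M') → (List M → M)} {ψ : ℕ → (List M'' → M'') → (List M' → M')}
    (h : Cov k T T' f φ) (h' : Cov k T' T'' g ψ) :
    Cov k T T'' (fun m => f (g m)) (fun i σ => φ i (ψ i σ)) where
  tree := h'.tree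
  map s hs := by
    have := h.map _ (h'.map s hs)
    rw [List.map_map] at this
    exact this
  leg i σ hσ := h.leg i _ (h'.leg i _ hσ)
  loc i σ σ' n hσ hσ' ha := h.loc i _ _ n (h'.leg i _ hσ) (h'.leg i _ hσ') (h'.loc i _ _ n hσ hσ' ha)
  lift i σ x hi hσ hx hc := by
    obtain ⟨x', hx', hf, hc'⟩ := h.lift i _ x hi (h'.leg i _ hσ) hx hc
    obtain ⟨x'', hx'', hg, hc''⟩ := h'.lift i _ x' hi hσ hx' hc'
    exact ⟨x'', hx'', fun n => by rw [hg, hf], hc''⟩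
  surj s hs hl := by
    obtain ⟨s', hs', he⟩ := h.surj s hs hl
    obtain ⟨s'', hs'', he'⟩ := h'.surj s' hs' (by rw [← he] at hl; simpa using hl)
    refine ⟨s'', hs'', ?_⟩
    rw [← he, ← he', List.map_map]; rfl
  uniq s hs s' hs' hl he := by
    apply h'.uniq s hs s' hs' hl
    apply h.uniq _ (h'.map s hs) _ (h'.map s' hs') (by simpa using hl)
    rw [List.map_map, List.map_map]; exact he
  idn i σ s hσ hs hl hp := by
    have h1 := h'.idn i σ s hσ hs hl hp
    have h2 := h.idn i _ (s.map g) (h'.leg i _ hσ) (h'.map s hs) (by simpa using hl) (by simpa using hp)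
    rw [List.map_map] at h2
    rw [← h1, ← h2]; rfl

end games
end SH

end

section
namespace SH

section closed
variable {M : Type}

inductive Stt (M : Type) : Type
  | pre : Stt M
  | one (A : Set (List M)) : Stt M
  | fol (u : List M) : Stt M
  | stay (A : Set (List M)) : Stt M

def cur : List (M × Stt M) → Stt M
  | [] => Stt.pre
  | m :: _ => m.2

def GoodI (T : Set (List M)) (p : List M) (A : Set (List M)) : Prop :=
  p ∈ A ∧ ∀ t ∈ A, t ∈ T ∧ (t.length % 2 = 1 → ∀ m, m :: t ∈ T → m :: t ∈ A) ∧
    (t.length % 2 = 0 → ∃ m, m :: t ∈ A)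

def GoodII (T Y : Set (List M)) (p : List M) (A B : Set (List M)) : Prop :=
  p ∈ B ∧ ∀ t ∈ B, t ∈ T ∧ t ∈ Y ∧ (∃ m, m :: t ∈ B) ∧
    (t.length % 2 = 0 → ∀ m, m :: t ∈ A → m :: t ∈ B)

def OKs : Stt M → List M → Prop
  | Stt.fol u, p => p <:+ u ∨ u <:+ p
  | Stt.stay B, p => p ∈ B
  | _, _ => False

def Leg (T : Set (List M)) (N : ℕ) (Y : Set (List M)) (m : M) (a : Stt M) (t : List M) (c : Stt M) :
    Prop :=
  m :: t ∈ T ∧ (t.length < N → a = Stt.pre) ∧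
  (t.length = N → ∃ A, a = Stt.one A ∧ GoodI T (m :: t) A) ∧
  (t.length = N + 1 → ∃ A, c = Stt.one A ∧
    ((∃ u, a = Stt.fol u ∧ u ∈ A ∧ u ∈ T ∧ u ∉ Y ∧ (m :: t) <:+ u) ∨
      ∃ B, a = Stt.stay B ∧ GoodII T Y (m :: t) A B)) ∧
  (N + 1 < t.length → a = c ∧ OKs a (m :: t))

def T2p (T : Set (List M)) (N : ℕ) (Y : Set (List M)) : List (M × Stt M) → Prop
  | [] => True
  | m :: s => T2p T N Y s ∧ Leg T N Y m.1 m.2 (s.map Prod.fst) (cur s)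

def T2 (T : Set (List M)) (N : ℕ) (Y : Set (List M)) : Set (List (M × Stt M)) :=
  {s | T2p T N Y s}

lemma T2_cons {T : Set (List M)} {N : ℕ} {Y : Set (List M)} {m : M × Stt M} {s : List (M × Stt M)} :
    m :: s ∈ T2 T N Y ↔ s ∈ T2 T N Y ∧ Leg T N Y m.1 m.2 (s.map Prod.fst) (cur s) := Iff.rfl

lemma T2_map {T : Set (List M)} (hT : IsTree T) {N : ℕ} {Y : Set (List M)} {s : List (M × Stt M)}
    (hs : s ∈ T2 T N Y) : s.map Prod.fst ∈ T := by
  cases s with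
  | nil => exact hT.nil
  | cons m s => exact hs.2.1

lemma T2_inv {T : Set (List M)} {N : ℕ} {Y : Set (List M)} {s : List (M × Stt M)}
    (hs : s ∈ T2 T N Y) :
    (s.length ≤ N → cur s = Stt.pre) ∧
    (s.length = N + 1 → ∃ A, cur s = Stt.one A ∧ GoodI T (s.map Prod.fst) A) ∧
    (N + 2 ≤ s.length →
      (∃ u, cur s = Stt.fol u ∧ u ∈ T ∧ u ∉ Y ∧ (s.map Prod.fst <:+ u ∨ u <:+ s.map Prod.fst)) ∨
      (∃ B, cur s = Stt.stay B ∧ s.map Prod.fst ∈ B ∧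
        ∀ t ∈ B, t ∈ T ∧ t ∈ Y ∧ ∃ m, m :: t ∈ B)) := by
  induction s with
  | nil => exact ⟨fun _ => rfl, fun h => by simp at h, fun h => by simp at h⟩
  | cons m s ih =>
    obtain ⟨hs, h1, h2, h3, h4, h5⟩ := hs
    obtain ⟨-, i2, i3⟩ := ih hs
    simp only [List.length_map] at h2 h3 h4 h5
    refine ⟨fun h => h2 (by simp at h; omega), fun h => ?_, fun h => ?_⟩
    · exact h3 (by simp at h; omega)
    · simp only [List.length_cons] at h
      rcases Nat.lt_or_ge (N + 1) s.length with hl | hl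
      · obtain ⟨ha, hok⟩ := h5 hl
        rcases i3 hl with ⟨u, hu, huT, huY, hc⟩ | ⟨B, hB, htB, hall⟩
        · left
          refine ⟨u, ha.trans hu, huT, huY, ?_⟩
          rw [ha.trans hu] at hok
          exact hok
        · right
          refine ⟨B, ha.trans hB, ?_, hall⟩
          rw [ha.trans hB] at hok
          exact hok
      · obtain ⟨A, hA, h⟩ := h4 (by omega)
        rcases h with ⟨u, ha, huA, huT, huY, hsu⟩ | ⟨B, ha, hB⟩
        · exact Or.inl ⟨u, ha, huT, huY, Or.inl hsu⟩
        · exact Or.inr ⟨B, ha, hB.1, fun t ht => ⟨(hB.2 t ht).1, (hB.2 t ht).2.1, (hB.2 t ht).2.2.1⟩⟩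

lemma suffix_ext {t u : List M} (h : t <:+ u) (hl : t.length < u.length) : ∃ m, m :: t <:+ u := by
  obtain ⟨r, rfl⟩ := h
  rcases List.eq_nil_or_concat r with rfl | ⟨r', m, rfl⟩
  · simp at hl
  · exact ⟨m, r', by simp⟩

lemma GoodI.univ {T : Set (List M)} (hT : IsTree T) {p : List M} (hp : p ∈ T) : GoodI T p T :=
  ⟨hp, fun t ht => ⟨ht, fun _ _ h => h, fun _ => hT.prune t ht⟩⟩

lemma T2_tree {T : Set (List M)} (hT : IsTree T) {N : ℕ} (hN : N % 2 = 0) (Y : Set (List M)) :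
    IsTree (T2 T N Y) where
  nil := trivial
  cls m t h := h.1
  prune s hs := by
    obtain ⟨i1, i2, i3⟩ := T2_inv hs
    have hTs := T2_map hT hs
    rcases lt_trichotomy s.length N with hl | hl | hl
    · obtain ⟨m, hm⟩ := hT.prune _ hTs
      exact ⟨(m, Stt.pre), hs, hm, fun _ => rfl, fun h => by simp at h; omega,
        fun h => by simp at h; omega, fun h => by simp at h; omega⟩
    · obtain ⟨m, hm⟩ := hT.prune _ hTs
      exact ⟨(m, Stt.one T), hs, hm, fun h => by simp at h; omega,
        fun h => ⟨T, rfl, GoodI.univ hT hm⟩,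
        fun h => by simp at h; omega, fun h => by simp at h; omega⟩
    · rcases Nat.lt_or_ge (N + 1) s.length with hl' | hl'
      · rcases i3 hl' with ⟨u, hu, huT, huY, hc⟩ | ⟨B, hB, htB, hall⟩
        · have : ∃ m, m :: s.map Prod.fst ∈ T ∧
              (m :: s.map Prod.fst <:+ u ∨ u <:+ m :: s.map Prod.fst) := by
            by_cases hus : u <:+ s.map Prod.fst
            · obtain ⟨m, hm⟩ := hT.prune _ hTs
              exact ⟨m, hm, Or.inr (hus.trans (List.suffix_cons _ _))⟩
            · have hsu := hc.resolve_right hus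
              have hlt : (s.map Prod.fst).length < u.length := by
                by_contra hge
                rw [hsu.eq_of_length (le_antisymm hsu.length_le (by omega))] at hus
                exact hus (List.suffix_refl _)
              obtain ⟨m, hm⟩ := suffix_ext hsu hlt
              exact ⟨m, hT.suff hm huT, Or.inl hm⟩
          obtain ⟨m, hm, hc⟩ := this
          exact ⟨(m, Stt.fol u), hs, hm, fun h => by simp at h; omega, fun h => by simp at h; omega,
            fun h => by simp at h; omega, fun _ => ⟨hu.symm, hc⟩⟩
        · obtain ⟨m, hm⟩ := (hall _ htB).2.2
          exact ⟨(m, Stt.stay B), hs, (hall _ hm).1, fun h => by simp at h; omega,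
            fun h => by simp at h; omega, fun h => by simp at h; omega, fun _ => ⟨hB.symm, hm⟩⟩
      · have hl2 : s.length = N + 1 := by omega
        obtain ⟨A, hA, hG⟩ := i2 hl2
        obtain ⟨m, hm⟩ := hT.prune _ hTs
        have hmA : m :: s.map Prod.fst ∈ A := (hG.2 _ hG.1).2.1 (by simp; omega) m hm
        by_cases he : ∃ u ∈ A, u ∉ Y ∧ m :: s.map Prod.fst <:+ u
        · obtain ⟨u, huA, huY, hsu⟩ := he
          exact ⟨(m, Stt.fol u), hs, hm, fun h => by simp at h; omega, fun h => by simp at h; omega,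
            fun _ => ⟨A, hA, Or.inl ⟨u, rfl, huA, (hG.2 u huA).1, huY, hsu⟩⟩,
            fun h => by simp at h; omega⟩
        · push Not at he
          refine ⟨(m, Stt.stay {t | t ∈ A ∧ m :: s.map Prod.fst <:+ t}), hs, hm,
            fun h => by simp at h; omega, fun h => by simp at h; omega,
            fun _ => ⟨A, hA, Or.inr ⟨_, rfl, ⟨hmA, List.suffix_refl _⟩, ?_⟩⟩,
            fun h => by simp at h; omega⟩
          rintro t ⟨htA, hst⟩
          refine ⟨(hG.2 t htA).1, ?_, ?_, ?_⟩
          · by_contra hY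
            exact he t htA hY hst
          · rcases Nat.mod_two_eq_zero_or_one t.length with h | h
            · obtain ⟨m', hm'⟩ := (hG.2 t htA).2.2 h
              exact ⟨m', hm', hst.trans (List.suffix_cons _ _)⟩
            · obtain ⟨m', hm'⟩ := hT.prune _ (hG.2 t htA).1
              exact ⟨m', (hG.2 t htA).2.1 h m' hm', hst.trans (List.suffix_cons _ _)⟩
          · intro _ m' hm'
            exact ⟨hm', hst.trans (List.suffix_cons _ _)⟩

def lb (N : ℕ) (A : Set (List M)) (c : Stt M) (n : ℕ) : Stt M :=
  if n < N then Stt.pre else if n = N then Stt.one A else c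

def lab (N : ℕ) (A : Set (List M)) (c : Stt M) : List M → List (M × Stt M)
  | [] => []
  | m :: t => (m, lb N A c t.length) :: lab N A c t

@[simp] lemma lab_map (N : ℕ) (A : Set (List M)) (c : Stt M) (t : List M) :
    (lab N A c t).map Prod.fst = t := by
  induction t with
  | nil => rfl
  | cons m t ih => simp [lab, ih]

@[simp] lemma lab_length (N : ℕ) (A : Set (List M)) (c : Stt M) (t : List M) :
    (lab N A c t).length = t.length := by
  induction t with
  | nil => rfl
  | cons m t ih => simp [lab, ih]

lemma lab_low {N : ℕ} (A A' : Set (List M)) (c c' : Stt M) {t : List M} (h : t.length ≤ N) :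
    lab N A c t = lab N A' c' t := by
  induction t with
  | nil => rfl
  | cons m t ih =>
    simp only [List.length_cons] at h
    simp only [lab, ih (by omega), lb, if_pos (show t.length < N by omega)]

lemma lab_low1 {N : ℕ} (A : Set (List M)) (c c' : Stt M) {t : List M} (h : t.length ≤ N + 1) :
    lab N A c t = lab N A c' t := by
  cases t with
  | nil => rfl
  | cons m t =>
    simp only [List.length_cons] at h
    simp only [lab, lab_low A A c c' (show t.length ≤ N by omega), lb]
    congr 2
    split_ifs
    · rfl
    · rfl
    · omega

lemma cur_lab1 {N : ℕ} (A : Set (List M)) (c : Stt M) {t : List M} (h : t.length = N + 1) :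
    cur (lab N A c t) = Stt.one A := by
  cases t with
  | nil => simp at h
  | cons m t =>
    simp only [List.length_cons] at h
    simp only [lab, cur, lb]
    rw [if_neg (by omega), if_pos (by omega)]

lemma cur_lab2 {N : ℕ} (A : Set (List M)) (c : Stt M) {t : List M} (h : N + 2 ≤ t.length) :
    cur (lab N A c t) = c := by
  cases t with
  | nil => simp at h
  | cons m t =>
    simp only [List.length_cons] at h
    simp only [lab, cur, lb]
    rw [if_neg (by omega), if_neg (by omega)]

lemma lab_hist (N : ℕ) (A : Set (List M)) (c : Stt M) (x : ℕ → M) (n : ℕ) :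
    lab N A c (hist x n) = hist (fun j => (x j, lb N A c j)) n := by
  induction n with
  | zero => rfl
  | succ n ih => simp [hist_succ, lab, ih]

lemma lab_of_T2 {T : Set (List M)} {N : ℕ} {Y : Set (List M)} {s : List (M × Stt M)}
    (hs : s ∈ T2 T N Y) (hl : s.length ≤ N) (A : Set (List M)) (c : Stt M) :
    lab N A c (s.map Prod.fst) = s := by
  induction s with
  | nil => rfl
  | cons m s ih =>
    simp only [List.length_cons] at hl
    obtain ⟨hs, h1, h2, -⟩ := hs
    simp only [List.map_cons, lab, ih hs (by omega), lb, List.length_map]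
    rw [if_pos (by omega)]
    rw [← h2 (by simp; omega)]

lemma lab_mem_low {T : Set (List M)} (hT : IsTree T) {N : ℕ} {Y : Set (List M)} (A : Set (List M))
    (c : Stt M) {t : List M} (ht : t ∈ T) (hl : t.length ≤ N) : lab N A c t ∈ T2 T N Y := by
  induction t with
  | nil => trivial
  | cons m t ih =>
    simp only [List.length_cons] at hl
    refine ⟨ih (hT.cls _ _ ht) (by omega), ?_⟩
    simp only [lab_map, lb]
    refine ⟨ht, fun h => if_pos h, fun h => by omega, fun h => by omega, fun h => by omega⟩

lemma lab_mem1 {T : Set (List M)} (hT : IsTree T) {N : ℕ} {Y : Set (List M)} {A : Set (List M)}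
    (c : Stt M) {t : List M} (ht : t ∈ T) (hl : t.length = N + 1) (hG : GoodI T t A) :
    lab N A c t ∈ T2 T N Y := by
  cases t with
  | nil => simp at hl
  | cons m t =>
    simp only [List.length_cons] at hl
    refine ⟨lab_mem_low hT A c (hT.cls _ _ ht) (by omega), ?_⟩
    simp only [lab_map, lb]
    refine ⟨ht, fun h => by omega, fun h => ⟨A, ?_, hG⟩, fun h => by omega, fun h => by omega⟩
    rw [if_neg (by omega), if_pos h]

lemma lab_mem2 {T : Set (List M)} {N : ℕ} {Y : Set (List M)} {A : Set (List M)}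
    {c : Stt M} {m : M} {t : List M} (ht : m :: t ∈ T) (hl : t.length = N + 1)
    (h : lab N A c t ∈ T2 T N Y)
    (hc : (∃ u, c = Stt.fol u ∧ u ∈ A ∧ u ∈ T ∧ u ∉ Y ∧ (m :: t) <:+ u) ∨
      ∃ B, c = Stt.stay B ∧ GoodII T Y (m :: t) A B) :
    lab N A c (m :: t) ∈ T2 T N Y := by
  refine ⟨h, ?_⟩
  simp only [lab_map, lb]
  refine ⟨ht, fun h => by omega, fun h => by omega, fun h => ?_, fun h => by omega⟩
  rw [if_neg (by omega), if_neg (by omega), cur_lab1 A c hl]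
  exact ⟨A, rfl, hc⟩

lemma lab_mem3 {T : Set (List M)} {N : ℕ} {Y : Set (List M)} {A : Set (List M)}
    {c : Stt M} {m : M} {t : List M} (ht : m :: t ∈ T) (hl : N + 2 ≤ t.length)
    (h : lab N A c t ∈ T2 T N Y) (hc : OKs c (m :: t)) :
    lab N A c (m :: t) ∈ T2 T N Y := by
  refine ⟨h, ?_⟩
  simp only [lab_map, lb]
  refine ⟨ht, fun h => by omega, fun h => by omega, fun h => by omega, fun h => ?_⟩
  rw [if_neg (by omega), if_neg (by omega), cur_lab2 A c hl]
  exact ⟨rfl, hc⟩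

/-- A legal move at a labelled position. -/
lemma legal_lab {T : Set (List M)} (hT : IsTree T) {N : ℕ} {Y : Set (List M)} {i : ℕ}
    {σ : List (M × Stt M) → M × Stt M} (hσ : Legal (T2 T N Y) i σ) {A : Set (List M)} {c : Stt M}
    {t : List M} (h : lab N A c t ∈ T2 T N Y) (hp : t.length % 2 = i) :
    Leg T N Y (σ (lab N A c t)).1 (σ (lab N A c t)).2 t (cur (lab N A c t)) := by
  have := (hσ _ h (by simpa using hp)).2
  simpa using this

lemma fx_lab {T : Set (List M)} (hT : IsTree T) {N : ℕ} {Y : Set (List M)} {i : ℕ}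
    {σ : List (M × Stt M) → M × Stt M} (hσ : Legal (T2 T N Y) i σ) {A : Set (List M)} {c : Stt M}
    {t : List M} (h : lab N A c t ∈ T2 T N Y) (hp : t.length % 2 = i) :
    fx T (fun t => (σ (lab N A c t)).1) t = (σ (lab N A c t)).1 :=
  fx_eq (σ := fun t => (σ (lab N A c t)).1) (legal_lab hT hσ h hp).1

end closed
end SH

end

section
namespace SH

section closed2
variable {M : Type}

def rt (n0 : ℕ) (t : List M) : List M := t.drop (t.length - n0)

lemma rt_hist {n0 m : ℕ} (x : ℕ → M) (h : n0 ≤ m) : rt n0 (hist x m) = hist x n0 := by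
  have h1 : rt n0 (hist x m) <:+ hist x m := List.drop_suffix _ _
  have h2 := (hist_suffix h1).2
  have h3 : (rt n0 (hist x m)).length = n0 := by
    unfold rt; rw [List.length_drop, hist_length]; omega
  rw [h3] at h2
  exact h2

lemma rt_length_le (n0 : ℕ) (t : List M) : (rt n0 t).length ≤ t.length := by
  unfold rt; rw [List.length_drop]; omega

lemma comb_congr [Nonempty M] (T : Set (List M)) (n0 i : ℕ) (S : Set (List M))
    {σu σu' : List M → List M → M} {σ0 σ0' : List M → M} {t : List M}
    (h : ∀ u, σu u t = σu' u t) (h0 : σ0 t = σ0' t) :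
    comb T n0 i S σu σ0 t = comb T n0 i S σu' σ0' t := by
  unfold comb sw
  simp only [fx_congr T h0, fun u => fx_congr T (h u)]

def S0 (T Y : Set (List M)) (p : List M) (A : Set (List M)) : Set (List M) :=
  {u | u ∈ A ∧ u ∈ T ∧ u ∉ Y ∧ p <:+ u}

def B0 (T Y : Set (List M)) (p : List M) (A : Set (List M)) : Set (List M) :=
  {t | t ∈ A ∧ p <:+ t ∧ ¬ Force T 0 (S0 T Y p A) t}

def getA : Stt M → Set (List M)
  | Stt.one A => A
  | _ => ∅

noncomputable def ph0 [Nonempty M] (T : Set (List M)) (N : ℕ) (Y : Set (List M))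
    (σ : List (M × Stt M) → M × Stt M) (t : List M) : M :=
  if t.length ≤ N then fx T (fun t => (σ (lab N ∅ Stt.pre t)).1) t else
    comb T (N + 2) 0 (S0 T Y (rt (N + 2) t) (getA (σ (lab N ∅ Stt.pre (rt N t))).2))
      (fun u t' => (σ (lab N (getA (σ (lab N ∅ Stt.pre (rt N t))).2) (Stt.fol u) t')).1)
      (fun t' => (σ (lab N (getA (σ (lab N ∅ Stt.pre (rt N t))).2)
        (Stt.stay (B0 T Y (rt (N + 2) t) (getA (σ (lab N ∅ Stt.pre (rt N t))).2))) t')).1) t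

def S1 (T : Set (List M)) (p : List M) (F : Set (List M) → M × Stt M) : Set (List M) :=
  {u | ∃ A, GoodI T p A ∧ ∃ m, F A = (m, Stt.fol u) ∧ m :: p <:+ u}

noncomputable def AA (T : Set (List M)) (p : List M) (F : Set (List M) → M × Stt M) (u : List M) :
    Set (List M) :=
  Classical.epsilon (fun A => GoodI T p A ∧ ∃ m, F A = (m, Stt.fol u) ∧ m :: p <:+ u)

def A1 (T : Set (List M)) (p : List M) (F : Set (List M) → M × Stt M) : Set (List M) :=
  {t | t ∈ T ∧ p <:+ t ∧ ¬ Force T 1 (S1 T p F) t}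

noncomputable def ph1 [Nonempty M] (T : Set (List M)) (N : ℕ)
    (σ : List (M × Stt M) → M × Stt M) (t : List M) : M :=
  if t.length ≤ N then fx T (fun t => (σ (lab N ∅ Stt.pre t)).1) t else
    (fun F : Set (List M) → M × Stt M =>
    comb T (N + 1) 1 (S1 T (rt (N + 1) t) F)
      (fun u t' => (σ (lab N (AA T (rt (N + 1) t) F u) (Stt.fol u) t')).1)
      (fun t' => (σ (lab N (A1 T (rt (N + 1) t) F) (F (A1 T (rt (N + 1) t) F)).2 t')).1) t)
    (fun A => σ (lab N A Stt.pre (rt (N + 1) t)))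

lemma ph0_loc [Nonempty M] (T : Set (List M)) (N : ℕ) (Y : Set (List M))
    {σ σ' : List (M × Stt M) → M × Stt M} {n : ℕ} (h : ∀ t, t.length < n → σ t = σ' t)
    {t : List M} (ht : t.length < n) : ph0 T N Y σ t = ph0 T N Y σ' t := by
  unfold ph0
  split_ifs with hl
  · exact fx_congr T (by rw [h _ (by simpa using ht)])
  · have := rt_length_le N t
    rw [h (lab N ∅ Stt.pre (rt N t)) (by simp; omega)]
    apply comb_congr
    · intro u; rw [h _ (by simpa using ht)]
    · rw [h _ (by simpa using ht)]

lemma ph1_loc [Nonempty M] (T : Set (List M)) (N : ℕ)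
    {σ σ' : List (M × Stt M) → M × Stt M} {n : ℕ} (h : ∀ t, t.length < n → σ t = σ' t)
    {t : List M} (ht : t.length < n) : ph1 T N σ t = ph1 T N σ' t := by
  unfold ph1
  split_ifs with hl
  · exact fx_congr T (by rw [h _ (by simpa using ht)])
  · have := rt_length_le (N + 1) t
    have hF : (fun A => σ (lab N A Stt.pre (rt (N + 1) t))) =
        (fun A => σ' (lab N A Stt.pre (rt (N + 1) t))) := by
      funext A
      exact h _ (by simp; omega)
    rw [hF]
    apply comb_congr
    · intro u; rw [h _ (by simpa using ht)]
    · rw [h _ (by simpa using ht)]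

lemma ph0_legal [Nonempty M] {T : Set (List M)} (hT : IsTree T) (N : ℕ) (Y : Set (List M))
    (σ : List (M × Stt M) → M × Stt M) : Legal T 0 (ph0 T N Y σ) := by
  intro t ht hp
  unfold ph0
  split_ifs with hl
  · exact fx_legal hT 0 _ t ht hp
  · exact comb_legal hT _ _ _ _ _ t ht hp

lemma ph1_legal [Nonempty M] {T : Set (List M)} (hT : IsTree T) (N : ℕ)
    (σ : List (M × Stt M) → M × Stt M) : Legal T 1 (ph1 T N σ) := by
  intro t ht hp
  unfold ph1
  split_ifs with hl
  · exact fx_legal hT 1 _ t ht hp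
  · exact comb_legal hT _ _ _ _ _ t ht hp

/-- A labelled run following `u`. -/
lemma fol_run {T : Set (List M)} (hT : IsTree T) {N : ℕ} {Y : Set (List M)} {A : Set (List M)}
    {x : ℕ → M} (hx : Run T x) {n : ℕ} (hn : N + 2 ≤ n) (hG : GoodI T (hist x (N + 1)) A)
    (hA : hist x n ∈ A) (hY : hist x n ∉ Y) (m : ℕ) :
    lab N A (Stt.fol (hist x n)) (hist x m) ∈ T2 T N Y := by
  induction m with
  | zero => trivial
  | succ m ih =>
    rcases Nat.lt_or_ge m N with h | h
    · exact lab_mem_low hT _ _ (hx _) (by simp; omega)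
    · rcases Nat.eq_or_lt_of_le h with h | h
      · subst h
        exact lab_mem1 hT _ (hx _) (by simp) hG
      · rcases Nat.eq_or_lt_of_le (Nat.succ_le_of_lt h) with h | h
        · refine lab_mem2 (hx (m + 1)) (by simp; omega) ih (Or.inl ⟨_, rfl, hA, hx _, hY, ?_⟩)
          exact hist_suffix_le x (m := m + 1) (by omega)
        · refine lab_mem3 (hx (m + 1)) (by simp; omega) ih ?_
          rcases Nat.le_total (m + 1) n with h | h
          · exact Or.inl (hist_suffix_le x h)
          · exact Or.inr (hist_suffix_le x h)

/-- While following `u` there is no choice. -/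
lemma fol_forced {T : Set (List M)} (hT : IsTree T) {N : ℕ} {Y : Set (List M)} {A : Set (List M)}
    {i : ℕ} {σ : List (M × Stt M) → M × Stt M} (hσ : Legal (T2 T N Y) i σ)
    {x : ℕ → M} {n m : ℕ} (hm : N + 2 ≤ m) (hp : m % 2 = i)
    (h : lab N A (Stt.fol (hist x n)) (hist x m) ∈ T2 T N Y)
    (hlate : n ≤ m → x m = (σ (lab N A (Stt.fol (hist x n)) (hist x m))).1) :
    (x m, Stt.fol (hist x n)) = σ (lab N A (Stt.fol (hist x n)) (hist x m)) := by
  obtain ⟨-, -, -, -, h5⟩ := legal_lab hT hσ h (by simpa using hp)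
  obtain ⟨ha, hok⟩ := h5 (by simp; omega)
  rw [cur_lab2 A _ (by simp; omega)] at ha
  refine Prod.ext ?_ ha.symm
  rcases Nat.lt_or_ge m n with hmn | hmn
  · rw [ha] at hok
    have hsuf : (σ (lab N A (Stt.fol (hist x n)) (hist x m))).1 :: hist x m <:+ hist x n := by
      rcases hok with hok | hok
      · exact hok
      · exact ⟨[], (hok.eq_of_length (le_antisymm hok.length_le (by simp; omega))).symm⟩
    have := (hist_suffix hsuf).2
    simp only [List.length_cons, hist_length, hist_succ, List.cons.injEq] at this
    exact this.1.symm
  · exact hlate hmn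

lemma low_cons {T : Set (List M)} (hT : IsTree T) {N : ℕ} {Y : Set (List M)}
    {i : ℕ} {σ : List (M × Stt M) → M × Stt M} (hσ : Legal (T2 T N Y) i σ)
    {x : ℕ → M} (hx : Run T x) {m : ℕ} (hm : m ≤ N) (hp : m % 2 = i)
    (h : x m = fx T (fun t => (σ (lab N ∅ Stt.pre t)).1) (hist x m)) (A : Set (List M)) (c : Stt M) :
    x m = (σ (lab N A c (hist x m))).1 := by
  rw [fx_lab hT hσ (lab_mem_low hT _ _ (hx m) (by simpa using hm)) (by simpa using hp)] at h
  rw [h, lab_low ∅ A Stt.pre c (by simpa using hm)]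

lemma low_cons' {T : Set (List M)} (hT : IsTree T) {N : ℕ} {Y : Set (List M)}
    {i : ℕ} {σ : List (M × Stt M) → M × Stt M} (hσ : Legal (T2 T N Y) i σ)
    {x : ℕ → M} (hx : Run T x) {m : ℕ} (hm : m < N) (hp : m % 2 = i)
    (h : x m = fx T (fun t => (σ (lab N ∅ Stt.pre t)).1) (hist x m)) (A : Set (List M)) (c : Stt M) :
    (x m, lb N A c m) = σ (lab N A c (hist x m)) := by
  refine Prod.ext (low_cons hT hσ hx hm.le hp h A c) ?_
  have := (legal_lab hT hσ (lab_mem_low hT A c (hx m) (by simpa using hm.le)) (by simpa using hp)).2.1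
    (by simpa using hm)
  rw [this]
  simp [lb, hm]

lemma lift0 [Nonempty M] {T : Set (List M)} (hT : IsTree T) {N : ℕ} (hN : N % 2 = 0)
    {Y : Set (List M)} {σ : List (M × Stt M) → M × Stt M} (hσ : Legal (T2 T N Y) 0 σ)
    {x : ℕ → M} (hx : Run T x) (hc : ConsF 0 0 (ph0 T N Y σ) x) :
    ∃ x' : ℕ → M × Stt M, Run (T2 T N Y) x' ∧ (∀ n, (x' n).1 = x n) ∧ ConsF 0 0 σ x' := by
  have hlow : ∀ m, m ≤ N → m % 2 = 0 →
      x m = fx T (fun t => (σ (lab N ∅ Stt.pre t)).1) (hist x m) := by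
    intro m hm hp
    have := hc m (Nat.zero_le _) hp
    unfold ph0 at this
    rwa [if_pos (by simpa using hm)] at this
  -- the move at level `N`
  have hleg := legal_lab hT hσ (lab_mem_low hT (Y := Y) ∅ Stt.pre (hx N) (by simp)) (by simpa using hN)
  obtain ⟨A, hA, hG⟩ := hleg.2.2.1 (by simp)
  rw [← low_cons hT hσ hx le_rfl hN (hlow N le_rfl hN) ∅ Stt.pre] at hG
  have hG : GoodI T (hist x (N + 1)) A := hG
  have hAt : ∀ m, N + 2 ≤ m → getA (σ (lab N ∅ Stt.pre (rt N (hist x m)))).2 = A := by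
    intro m hm
    rw [rt_hist x (by omega), hA]; rfl
  have hNcons : ∀ c, (x N, lb N A c N) = σ (lab N A c (hist x N)) := by
    intro c
    rw [lab_low A ∅ c Stt.pre (by simp)]
    refine Prod.ext (low_cons hT hσ hx le_rfl hN (hlow N le_rfl hN) ∅ Stt.pre) ?_
    rw [hA]; simp [lb]
  have hcomb : ConsF (N + 2) 0 (comb T (N + 2) 0 (S0 T Y (hist x (N + 2)) A)
      (fun u t' => (σ (lab N A (Stt.fol u) t')).1)
      (fun t' => (σ (lab N A (Stt.stay (B0 T Y (hist x (N + 2)) A)) t')).1)) x := by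
    intro m hm hp
    have := hc m (Nat.zero_le _) hp
    unfold ph0 at this
    rwa [if_neg (by simp; omega), hAt m hm, rt_hist x hm] at this
  have fin : ∀ c, (∀ m, lab N A c (hist x m) ∈ T2 T N Y) →
      (∀ m, N + 2 ≤ m → m % 2 = 0 → (x m, c) = σ (lab N A c (hist x m))) →
      ∃ x' : ℕ → M × Stt M, Run (T2 T N Y) x' ∧ (∀ n, (x' n).1 = x n) ∧ ConsF 0 0 σ x' := by
    intro c h1 h2
    refine ⟨fun j => (x j, lb N A c j), fun n => by rw [← lab_hist]; exact h1 n, fun n => rfl, ?_⟩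
    intro m _ hp
    rw [← lab_hist]
    rcases lt_trichotomy m N with h | h | h
    · exact low_cons' hT hσ hx h hp (hlow m h.le hp) A c
    · subst h; exact hNcons c
    · have h3 : N + 2 ≤ m := by omega
      rw [← h2 m h3 hp]
      simp only [lb]
      rw [if_neg (by omega), if_neg (by omega)]
  rcases comb_cons hx hcomb with ⟨n, ⟨huA, huT, huY, hsu⟩, hcn⟩ | ⟨hnf, hc0⟩
  · have hn : N + 2 ≤ n := by have := hsu.length_le; simpa using this
    have hrun := fol_run hT hx hn hG huA huY
    refine fin _ hrun fun m hm hp => fol_forced hT hσ hm hp (hrun m) fun hnm => ?_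
    have := hcn m hm hnm hp
    rwa [fx_lab hT hσ (hrun m) (by simpa using hp)] at this
  · set B := B0 T Y (hist x (N + 2)) A with hB
    have hGII : GoodII T Y (hist x (N + 2)) A B := by
      refine ⟨⟨(hG.2 _ hG.1).2.1 (by simp; omega) _ (hx (N + 2)), List.suffix_refl _, hnf _ le_rfl⟩, ?_⟩
      rintro t ⟨htA, hst, htF⟩
      have htT := (hG.2 t htA).1
      have hI : t.length % 2 = 0 → ∀ m, m :: t ∈ A → m :: t ∈ B := fun hp m hm =>
        ⟨hm, hst.trans (List.suffix_cons _ _), fun hF => htF (force_own hT hp (hG.2 _ hm).1 hF)⟩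
      refine ⟨htT, ?_, ?_, hI⟩
      · by_contra hY
        exact htF (force_mem hT 0 ⟨htA, htT, hY, hst⟩)
      · rcases Nat.mod_two_eq_zero_or_one t.length with h | h
        · obtain ⟨m, hm⟩ := (hG.2 t htA).2.2 h
          exact ⟨m, hI h m hm⟩
        · by_contra hno
          push Not at hno
          apply htF
          apply force_opp hT
          intro m hm
          by_contra hF
          exact hno m ⟨(hG.2 t htA).2.1 h m hm, hst.trans (List.suffix_cons _ _), hF⟩
    have hmain : ∀ m, lab N A (Stt.stay B) (hist x m) ∈ T2 T N Y ∧ (N + 2 ≤ m → hist x m ∈ B) := by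
      intro m
      induction m with
      | zero => exact ⟨trivial, fun h => by omega⟩
      | succ m ih =>
        rcases Nat.lt_or_ge m N with h | h
        · exact ⟨lab_mem_low hT _ _ (hx _) (by simp; omega), fun h => by omega⟩
        · rcases Nat.eq_or_lt_of_le h with h | h
          · subst h
            exact ⟨lab_mem1 hT _ (hx _) (by simp) hG, fun h => by omega⟩
          · rcases Nat.eq_or_lt_of_le (Nat.succ_le_of_lt h) with h | h
            · have : m = N + 1 := by omega
              subst this
              exact ⟨lab_mem2 (hx (N + 1 + 1)) (by simp) ih.1 (Or.inr ⟨_, rfl, hGII⟩), fun _ => hGII.1⟩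
            · have hm : N + 2 ≤ m := h
              have hmB := ih.2 hm
              have key : hist x (m + 1) ∈ B := by
                rcases Nat.mod_two_eq_zero_or_one m with hp | hp
                · have h1 := hc0 m hm hp
                  rw [fx_lab hT hσ ih.1 (by simpa using hp)] at h1
                  obtain ⟨-, -, -, -, h5⟩ := legal_lab hT hσ ih.1 (by simpa using hp)
                  obtain ⟨ha, hok⟩ := h5 (by simp; omega)
                  rw [cur_lab2 A _ (by simp; omega)] at ha
                  rw [ha, ← h1] at hok
                  exact hok
                · exact ⟨(hG.2 _ hmB.1).2.1 (by simpa using hp) _ (hx (m + 1)),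
                    hist_suffix_le x (by omega), hnf _ (by omega)⟩
              exact ⟨lab_mem3 (hx (m + 1)) (by simp; omega) ih.1 key, fun _ => key⟩
    refine fin (Stt.stay B) (fun m => (hmain m).1) fun m hm hp => ?_
    have h1 := hc0 m hm hp
    rw [fx_lab hT hσ (hmain m).1 (by simpa using hp)] at h1
    obtain ⟨-, -, -, -, h5⟩ := legal_lab hT hσ (hmain m).1 (by simpa using hp)
    obtain ⟨ha, hok⟩ := h5 (by simp; omega)
    rw [cur_lab2 A _ (by simp; omega)] at ha
    exact Prod.ext h1 ha.symm

end closed2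
end SH

end

section
namespace SH

section closed3
variable {M : Type}

lemma lift1 [Nonempty M] {T : Set (List M)} (hT : IsTree T) {N : ℕ} (hN : N % 2 = 0)
    {Y : Set (List M)} {σ : List (M × Stt M) → M × Stt M} (hσ : Legal (T2 T N Y) 1 σ)
    {x : ℕ → M} (hx : Run T x) (hc : ConsF 0 1 (ph1 T N σ) x) :
    ∃ x' : ℕ → M × Stt M, Run (T2 T N Y) x' ∧ (∀ n, (x' n).1 = x n) ∧ ConsF 0 1 σ x' := by
  have hlow : ∀ m, m ≤ N → m % 2 = 1 →
      x m = fx T (fun t => (σ (lab N ∅ Stt.pre t)).1) (hist x m) := by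
    intro m hm hp
    have := hc m (Nat.zero_le _) hp
    unfold ph1 at this
    rwa [if_pos (by simpa using hm)] at this
  set p := hist x (N + 1) with hpdef
  obtain ⟨F, hF⟩ : ∃ F : Set (List M) → M × Stt M, F = fun A => σ (lab N A Stt.pre p) := ⟨_, rfl⟩
  have hcomb : ConsF (N + 1) 1 (comb T (N + 1) 1 (S1 T p F)
      (fun u t' => (σ (lab N (AA T p F u) (Stt.fol u) t')).1)
      (fun t' => (σ (lab N (A1 T p F) (F (A1 T p F)).2 t')).1)) x := by
    intro m hm hp
    have := hc m (Nat.zero_le _) hp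
    unfold ph1 at this
    rw [if_neg (by simp; omega), rt_hist x hm, ← hpdef, ← hF] at this
    exact this
  have fin : ∀ A c, (∀ m, lab N A c (hist x m) ∈ T2 T N Y) →
      (∀ m, N + 1 ≤ m → m % 2 = 1 → (x m, c) = σ (lab N A c (hist x m))) →
      ∃ x' : ℕ → M × Stt M, Run (T2 T N Y) x' ∧ (∀ n, (x' n).1 = x n) ∧ ConsF 0 1 σ x' := by
    intro A c h1 h2
    refine ⟨fun j => (x j, lb N A c j), fun n => by rw [← lab_hist]; exact h1 n, fun n => rfl, ?_⟩
    intro m _ hp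
    rw [← lab_hist]
    rcases lt_trichotomy m N with h | h | h
    · exact low_cons' hT hσ hx h hp (hlow m h.le hp) A c
    · omega
    · rw [← h2 m h hp]
      simp only [lb]
      rw [if_neg (by omega), if_neg (by omega)]
  have hpp : p.length % 2 = 1 := by simp [hpdef]; omega
  rcases comb_cons hx hcomb with ⟨n, hu, hcn⟩ | ⟨hnf, hc0⟩
  · obtain ⟨hG, m, hFA, hsu⟩ : GoodI T p (AA T p F (hist x n)) ∧
        ∃ m, F (AA T p F (hist x n)) = (m, Stt.fol (hist x n)) ∧ m :: p <:+ hist x n :=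
      Classical.epsilon_spec hu
    set A := AA T p F (hist x n) with hA
    have hn : N + 2 ≤ n := by have := hsu.length_le; simp [hpdef] at this; omega
    have hmx : m = x (N + 1) := by
      have := (hist_suffix hsu).2
      simp only [List.length_cons, hpdef, hist_length, hist_succ, List.cons.injEq] at this
      exact this.1
    have hleg := legal_lab hT hσ (lab_mem1 hT (Y := Y) Stt.pre (hx (N + 1)) (by simp) hG) hpp
    have hσp : σ (lab N A Stt.pre p) = (m, Stt.fol (hist x n)) := by rw [← hFA, hF]
    rw [← hpdef, hσp] at hleg
    obtain ⟨A', hA', hh⟩ := hleg.2.2.2.1 (by simp [hpdef])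
    rw [cur_lab1 A _ (by simp [hpdef])] at hA'
    injection hA' with hA'
    subst hA'
    have hh' : hist x n ∈ A ∧ hist x n ∉ Y := by
      rcases hh with ⟨u, hu1, hu2, hu3, hu4, hu5⟩ | ⟨B, hB, _⟩
      · injection hu1 with hu1
        rw [hu1]; exact ⟨hu2, hu4⟩
      · cases hB
    have hrun := fol_run hT hx hn hG hh'.1 hh'.2
    refine fin A _ hrun fun j hj hp => ?_
    rcases Nat.eq_or_lt_of_le hj with h | h
    · subst h
      rw [← hpdef, lab_low1 A _ Stt.pre (by simp [hpdef]), hσp, hmx]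
    · refine fol_forced hT hσ h hp (hrun j) fun hnm => ?_
      have := hcn j hj hnm hp
      rwa [fx_lab hT hσ (hrun j) (by simpa using hp)] at this
  · set A := A1 T p F with hA
    have hG : GoodI T p A := by
      refine ⟨⟨hx _, List.suffix_refl _, hnf _ le_rfl⟩, ?_⟩
      rintro t ⟨htT, hst, htF⟩
      refine ⟨htT, fun hp m hm => ⟨hm, hst.trans (List.suffix_cons _ _),
        fun hF => htF (force_own hT hp hm hF)⟩, fun hp => ?_⟩
      by_contra hno
      push Not at hno
      apply htF
      apply force_opp hT
      intro m hm
      by_contra hF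
      exact hno m ⟨hm, hst.trans (List.suffix_cons _ _), hF⟩
    have hin : ∀ m, N + 1 ≤ m → hist x m ∈ A := fun m hm =>
      ⟨hx m, hist_suffix_le x hm, hnf m hm⟩
    have hleg := legal_lab hT hσ (lab_mem1 hT (Y := Y) Stt.pre (hx (N + 1)) (by simp) hG) hpp
    rw [← hpdef] at hleg
    have hσp : σ (lab N A Stt.pre p) = F A := by rw [hF]
    rw [hσp] at hleg
    obtain ⟨A', hA', hh⟩ := hleg.2.2.2.1 (by simp [hpdef])
    rw [cur_lab1 A _ (by simp [hpdef])] at hA'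
    injection hA' with hA'
    rw [← hA'] at hh
    obtain ⟨B, hB, hGII⟩ : ∃ B, (F A).2 = Stt.stay B ∧ GoodII T Y ((F A).1 :: p) A B := by
      rcases hh with ⟨u, hu1, hu2, hu3, hu4, hu5⟩ | h
      · exfalso
        have : u ∈ S1 T p F := ⟨A, hG, (F A).1, Prod.ext rfl hu1, hu5⟩
        exact hu2.2.2 (force_mem hT 1 this)
      · exact h
    rw [hB] at hc0
    have hlabp : lab N A (Stt.stay B) p ∈ T2 T N Y := lab_mem1 hT _ (hx _) (by simp [hpdef]) hG
    have hx1 : x (N + 1) = (F A).1 := by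
      have := hc0 (N + 1) le_rfl (by omega)
      rwa [fx_lab hT hσ hlabp hpp, lab_low1 A _ Stt.pre (by simp [hpdef]), hσp] at this
    have hGII' : GoodII T Y (hist x (N + 2)) A B := by
      rw [← hx1] at hGII; exact hGII
    have hmain : ∀ m, lab N A (Stt.stay B) (hist x m) ∈ T2 T N Y ∧ (N + 2 ≤ m → hist x m ∈ B) := by
      intro m
      induction m with
      | zero => exact ⟨trivial, fun h => by omega⟩
      | succ m ih =>
        rcases Nat.lt_or_ge m N with h | h
        · exact ⟨lab_mem_low hT _ _ (hx _) (by simp; omega), fun h => by omega⟩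
        · rcases Nat.eq_or_lt_of_le h with h | h
          · subst h
            exact ⟨lab_mem1 hT _ (hx _) (by simp) hG, fun h => by omega⟩
          · rcases Nat.eq_or_lt_of_le (Nat.succ_le_of_lt h) with h | h
            · have : m = N + 1 := by omega
              subst this
              exact ⟨lab_mem2 (hx (N + 1 + 1)) (by simp) ih.1 (Or.inr ⟨_, rfl, hGII'⟩), fun _ => hGII'.1⟩
            · have hm : N + 2 ≤ m := h
              have hmB := ih.2 hm
              have key : hist x (m + 1) ∈ B := by
                rcases Nat.mod_two_eq_zero_or_one m with hp | hp
                · exact (hGII'.2 _ hmB).2.2.2 (by simpa using hp) _ (hin (m + 1) (by omega))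
                · have h1 := hc0 m (by omega) hp
                  rw [fx_lab hT hσ ih.1 (by simpa using hp)] at h1
                  obtain ⟨-, -, -, -, h5⟩ := legal_lab hT hσ ih.1 (by simpa using hp)
                  obtain ⟨ha, hok⟩ := h5 (by simp; omega)
                  rw [cur_lab2 A _ (by simp; omega)] at ha
                  rw [ha, ← h1] at hok
                  exact hok
              exact ⟨lab_mem3 (hx (m + 1)) (by simp; omega) ih.1 key, fun _ => key⟩
    refine fin A (Stt.stay B) (fun m => (hmain m).1) fun m hm hp => ?_
    rcases Nat.eq_or_lt_of_le hm with h | h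
    · subst h
      rw [← hpdef, lab_low1 A _ Stt.pre (by simp [hpdef]), hσp]
      exact Prod.ext hx1 hB.symm
    · have h1 := hc0 m hm hp
      rw [fx_lab hT hσ (hmain m).1 (by simpa using hp)] at h1
      obtain ⟨-, -, -, -, h5⟩ := legal_lab hT hσ (hmain m).1 (by simpa using hp)
      obtain ⟨ha, hok⟩ := h5 (by simp; omega)
      rw [cur_lab2 A _ (by simp; omega)] at ha
      exact Prod.ext h1 ha.symm

open Classical in
noncomputable def nm {M : Type} [Nonempty M] (T : Set (List M)) (i : ℕ) (σ : List M → M) : List M → M :=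
  fun t => if t ∈ T ∧ t.length % 2 = i then σ t else Classical.arbitrary M

lemma nm_eq [Nonempty M] {T : Set (List M)} {i : ℕ} {σ : List M → M} {t : List M} (h : t ∈ T)
    (hp : t.length % 2 = i) : nm T i σ t = σ t := if_pos ⟨h, hp⟩

lemma nm_legal [Nonempty M] {T : Set (List M)} {i : ℕ} {σ : List M → M} (h : Legal T i σ) :
    Legal T i (nm T i σ) := by
  intro t ht hp
  rw [nm_eq ht hp]; exact h t ht hp

lemma nm_loc [Nonempty M] {T : Set (List M)} {i : ℕ} {σ σ' : List M → M} {n : ℕ}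
    (h : ∀ t ∈ T, t.length < n → t.length % 2 = i → σ t = σ' t) :
    ∀ t, t.length < n → nm T i σ t = nm T i σ' t := by
  intro t ht
  unfold nm
  split_ifs with hh
  · exact h t hh.1 ht hh.2
  · rfl

def Clp (T : Set (List M)) (X : Set (ℕ → M)) : Prop :=
  ∀ x, Run T x → ∃ n, ∀ y, Run T y → hist y n = hist x n → (y ∈ X ↔ x ∈ X)

theorem closed_cov {T : Set (List M)} (hT : IsTree T) (k : ℕ) {Y : Set (List M)}
    (hY : ∀ m t, m :: t ∈ Y → t ∈ Y) :
    ∃ (M' : Type) (T' : Set (List M')) (f : M' → M) (φ : ℕ → (List M' → M') → (List M → M)),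
      Cov k T T' f φ ∧ Clp T' {x | ∀ n, hist (fun j => f (x j)) n ∈ Y} := by
  have : Nonempty M := hT.nonempty
  have hN : (2 * k) % 2 = 0 := by omega
  have htree := T2_tree hT hN Y
  have : Nonempty (M × Stt M) := htree.nonempty
  refine ⟨M × Stt M, T2 T (2 * k) Y, Prod.fst,
    fun i σ => if i = 0 then ph0 T (2 * k) Y (nm (T2 T (2 * k) Y) i σ)
      else if i = 1 then ph1 T (2 * k) (nm (T2 T (2 * k) Y) i σ) else fx T (fun _ => Classical.arbitrary M), ?_, ?_⟩
  · apply Cov.mono (k' := 2 * k) _ (by omega)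
    refine ⟨htree, fun s hs => T2_map hT hs, ?_, ?_, ?_, ?_, ?_, ?_⟩
    · intro i σ hσ
      rcases i with _ | _ | i
      · exact ph0_legal hT _ _ _
      · exact ph1_legal hT _ _
      · simpa using fx_legal hT _ _
    · intro i σ σ' n hσ hσ' ha t ht hl hp
      rcases i with _ | _ | i
      · exact ph0_loc T _ Y (nm_loc ha) hl
      · exact ph1_loc T _ (nm_loc ha) hl
      · simp
    · intro i σ x hi hσ hx hc
      have conv : ∀ x', Run (T2 T (2 * k) Y) x' → ConsF 0 i (nm (T2 T (2 * k) Y) i σ) x' →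
          ConsF 0 i σ x' := by
        intro x' hx' hc' m h0 hp
        rw [hc' m h0 hp, nm_eq (hx' m) (by simpa using hp)]
      rcases i with _ | _ | i
      · obtain ⟨x', h1, h2, h3⟩ := lift0 hT hN (nm_legal hσ) hx hc
        exact ⟨x', h1, h2, conv x' h1 h3⟩
      · obtain ⟨x', h1, h2, h3⟩ := lift1 hT hN (nm_legal hσ) hx hc
        exact ⟨x', h1, h2, conv x' h1 h3⟩
      · omega
    · intro s hs hl
      exact ⟨lab (2 * k) ∅ Stt.pre s, lab_mem_low hT _ _ hs hl, lab_map _ _ _ _⟩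
    · intro s hs s' hs' hl he
      have hl' : s'.length ≤ 2 * k := by
        have := congrArg List.length he
        simp at this; omega
      rw [← lab_of_T2 hs hl ∅ Stt.pre, ← lab_of_T2 hs' hl' ∅ Stt.pre, he]
    · intro i σ s hσ hs hl hp
      have e : fx T (fun t => (nm (T2 T (2 * k) Y) i σ (lab (2 * k) ∅ Stt.pre t)).1) (s.map Prod.fst)
          = (σ s).1 := by
        have hs' : lab (2 * k) ∅ Stt.pre (s.map Prod.fst) ∈ T2 T (2 * k) Y := by
          rw [lab_of_T2 hs hl.le]; exact hs
        rw [fx_lab hT (nm_legal hσ) hs' (by simpa using hp), lab_of_T2 hs hl.le, nm_eq hs hp]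
      rcases i with _ | _ | i
      · simp only [if_true]
        unfold ph0
        rw [if_pos (by simp; omega)]; exact e
      · simp only [if_true]
        rw [if_neg (by omega)]
        unfold ph1
        rw [if_pos (by simp; omega)]; exact e
      · omega
  · intro x hx
    refine ⟨2 * k + 2, ?_⟩
    have hst : ∀ y, Run (T2 T (2 * k) Y) y → ∀ n, 2 * k + 1 ≤ n → (y n).2 = (y (2 * k + 1)).2 := by
      intro y hy n hn
      induction n, hn using Nat.le_induction with
      | base => rfl
      | succ n hn ih =>
        obtain ⟨-, -, -, -, -, h5⟩ := hy (n + 2)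
        rw [← ih]
        exact (h5 (by simp; omega)).1
    have main : ∀ y, Run (T2 T (2 * k) Y) y →
        ((y ∈ {x : ℕ → M × Stt M | ∀ n, hist (fun j => (x j).1) n ∈ Y}) ↔ ∃ B, (y (2 * k + 1)).2 = Stt.stay B) := by
      intro y hy
      constructor
      · intro hin
        rcases (T2_inv (hy (2 * k + 2))).2.2 (by simp) with ⟨u, hu, huT, huY, hc⟩ | ⟨B, hB, htB, hall⟩
        · exfalso
          have hu : (y (2 * k + 1)).2 = Stt.fol u := hu
          rcases (T2_inv (hy (2 * k + 3 + u.length))).2.2 (by simp; omega) with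
            ⟨u', hu', huT', huY', hc'⟩ | ⟨B, hB, htB, hall⟩
          · have hu' : (y (2 * k + 2 + u.length)).2 = Stt.fol u' := by
              rw [show 2 * k + 3 + u.length = (2 * k + 2 + u.length) + 1 by omega] at hu'
              exact hu'
            rw [hst y hy _ (by omega), hu] at hu'
            injection hu' with hu'
            subst hu'
            have hs : u <:+ hist (fun j => (y j).1) (2 * k + 3 + u.length) := by
              rw [← hist_map]
              rcases hc' with h | h
              · have := h.length_le
                simp at this
              · exact h
            rw [(hist_suffix hs).2] at huY
            exact huY (hin _)
          · have hB : (y (2 * k + 2 + u.length)).2 = Stt.stay B := by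
              rw [show 2 * k + 3 + u.length = (2 * k + 2 + u.length) + 1 by omega] at hB
              exact hB
            rw [hst y hy _ (by omega), hu] at hB
            cases hB
        · exact ⟨B, hB⟩
      · rintro ⟨B, hB⟩ n
        have hY' : ∀ s t, s <:+ t → t ∈ Y → s ∈ Y := by
          intro s t h ht
          induction t with
          | nil => rw [List.suffix_nil.1 h]; exact ht
          | cons m t ih =>
            rcases List.suffix_cons_iff.1 h with h | h
            · rw [h]; exact ht
            · exact ih h (hY _ _ ht)
        refine hY' _ _ (hist_suffix_le _ (show n ≤ 2 * k + 2 + n by omega)) ?_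
        rcases (T2_inv (hy (2 * k + 2 + n))).2.2 (by simp) with
            ⟨u', hu', huT', huY', hc'⟩ | ⟨B', hB', htB, hall⟩
        · have hu' : (y (2 * k + 1 + n)).2 = Stt.fol u' := by
            rw [show 2 * k + 2 + n = (2 * k + 1 + n) + 1 by omega] at hu'
            exact hu'
          rw [hst y hy _ (by omega), hB] at hu'
          cases hu'
        · rw [← hist_map]
          exact (hall _ htB).2.1
    intro y hy hxy
    rw [main y hy, main x hx, hist_eval hxy (m := 2 * k + 1) (by omega)]

end closed3
end SH

end

section
namespace SH

section limit

/-- Inverse systems of trees. -/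
structure Sys where
  M : ℕ → Type
  T : ∀ i, Set (List (M i))
  f : ∀ i, M (i + 1) → M i
  κ : ℕ → ℕ

structure Sys.OK (S : Sys) : Prop where
  tree : ∀ i, IsTree (S.T i)
  map : ∀ i, ∀ s ∈ S.T (i + 1), s.map (S.f i) ∈ S.T i
  surj : ∀ i, ∀ s ∈ S.T i, s.length ≤ S.κ i → ∃ s' ∈ S.T (i + 1), s'.map (S.f i) = s
  uniq : ∀ i, ∀ s ∈ S.T (i + 1), ∀ s' ∈ S.T (i + 1), s.length ≤ S.κ i →
    s.map (S.f i) = s'.map (S.f i) → s = s'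
  mono : ∀ i, S.κ i ≤ S.κ (i + 1)
  unb : ∀ i, i ≤ S.κ i

def Sys.Ti (S : Sys) : Set (List (∀ i, S.M i)) :=
  {s | ∀ i, s.map (fun μ => μ i) ∈ S.T i ∧
    (s.map (fun μ => μ (i + 1))).map (S.f i) = s.map (fun μ => μ i)}

lemma Sys.Ti_cons {S : Sys} {μ : ∀ i, S.M i} {s : List (∀ i, S.M i)} (hs : s ∈ S.Ti)
    (h1 : ∀ i, μ i :: s.map (fun μ => μ i) ∈ S.T i) (h2 : ∀ i, S.f i (μ (i + 1)) = μ i) :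
    μ :: s ∈ S.Ti := by
  intro i
  refine ⟨h1 i, ?_⟩
  have := (hs i).2
  simp only [List.map_cons, h2, this]

lemma Sys.Ti_cls {S : Sys} (hS : S.OK) {μ : ∀ i, S.M i} {s : List (∀ i, S.M i)}
    (h : μ :: s ∈ S.Ti) : s ∈ S.Ti := by
  intro i
  have := h i
  simp only [List.map_cons] at this
  exact ⟨(hS.tree i).cls _ _ this.1, (List.cons.inj this.2).2⟩

lemma Sys.Ti_f {S : Sys} {μ : ∀ i, S.M i} {s : List (∀ i, S.M i)}
    (h : μ :: s ∈ S.Ti) (i : ℕ) : S.f i (μ (i + 1)) = μ i := by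
  have := (h i).2
  simp only [List.map_cons] at this
  exact (List.cons.inj this).1

lemma Sys.mono_le {S : Sys} (hS : S.OK) {i j : ℕ} (h : i ≤ j) : S.κ i ≤ S.κ j :=
  monotone_nat_of_le_succ hS.mono h

/-- Extending a thread. -/
lemma Sys.ext0 (j : ℕ) : ∀ (M : ℕ → Type) (T : ∀ i, Set (List (M i))) (f : ∀ i, M (i + 1) → M i)
    (κ : ℕ → ℕ), Sys.OK ⟨M, T, f, κ⟩ → ∀ (s : ∀ i, List (M i)),
    (∀ i, s i ∈ T i) → (∀ i, (s (i + 1)).map (f i) = s i) → ∀ m : M j, m :: s j ∈ T j →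
    (s 0).length + 1 ≤ κ j → ∃ μ : ∀ i, M i, μ j = m ∧ (∀ i, μ i :: s i ∈ T i) ∧
      ∀ i, f i (μ (i + 1)) = μ i := by
  induction j with
  | zero =>
    intro M T f κ hS s hs hm m hmT hl
    have hlen : ∀ i, (s i).length = (s 0).length := by
      intro i
      induction i with
      | zero => rfl
      | succ i ih => rw [← ih, ← hm i]; simp
    have hκ : ∀ i, (s 0).length + 1 ≤ κ i := fun i =>
      hl.trans (Sys.mono_le hS (Nat.zero_le i))
    have step : ∀ i (a : {a : M i // a :: s i ∈ T i}),
        ∃ b : {b : M (i + 1) // b :: s (i + 1) ∈ T (i + 1)}, f i b.1 = a.1 := by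
      rintro i ⟨a, ha⟩
      obtain ⟨s', hs', he⟩ := hS.surj i _ ha (by simp only [List.length_cons, hlen]; exact hκ i)
      cases s' with
      | nil => simp at he
      | cons b r =>
        simp only [List.map_cons, List.cons.injEq] at he
        have hr : r = s (i + 1) := by
          apply hS.uniq i r ((hS.tree (i + 1)).cls _ _ hs') _ (hs (i + 1))
          · have := congrArg List.length he.2
            simp only [List.length_map] at this
            rw [this, hlen]; have := hκ i; show _ ≤ κ i; omega
          · rw [he.2]; exact (hm i).symm
        subst hr
        exact ⟨⟨b, hs'⟩, he.1⟩
    choose g hg using step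
    let ν : ∀ i, {a : M i // a :: s i ∈ T i} := fun i => Nat.rec ⟨m, hmT⟩ (fun i a => g i a) i
    exact ⟨fun i => (ν i).1, rfl, fun i => (ν i).2, fun i => hg i (ν i)⟩
  | succ j ih =>
    intro M T f κ hS s hs hm m hmT hl
    have hS' : Sys.OK ⟨fun i => M (i + 1), fun i => T (i + 1), fun i => f (i + 1),
        fun i => κ (i + 1)⟩ :=
      ⟨fun i => hS.tree (i + 1), fun i => hS.map (i + 1), fun i => hS.surj (i + 1),
        fun i => hS.uniq (i + 1), fun i => hS.mono (i + 1), fun i => (Nat.le_succ i).trans (hS.unb (i + 1))⟩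
    obtain ⟨ν, h1, h2, h3⟩ := ih _ _ _ _ hS' (fun i => s (i + 1)) (fun i => hs (i + 1))
      (fun i => hm (i + 1)) m hmT (by
        have : (s 1).length = (s 0).length := by rw [← hm 0]; simp
        show (s 1).length + 1 ≤ _
        rw [this]; exact hl)
    refine ⟨fun i => Nat.casesOn i (f 0 (ν 0)) (fun i => ν i), h1, ?_, ?_⟩
    · rintro (_ | i)
      · have := hS.map 0 _ (h2 0)
        simp only [List.map_cons] at this
        have e := hm 0
        rw [show List.map (f 0) (s (0 + 1)) = s 0 from e] at this
        exact this
      · exact h2 i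
    · rintro (_ | i)
      · rfl
      · exact h3 i

lemma Sys.ext {S : Sys} (hS : S.OK) {s : List (∀ i, S.M i)} (hs : s ∈ S.Ti) (j : ℕ) {m : S.M j}
    (hm : m :: s.map (fun μ => μ j) ∈ S.T j) (hl : s.length + 1 ≤ S.κ j) :
    ∃ μ : ∀ i, S.M i, μ j = m ∧ μ :: s ∈ S.Ti := by
  obtain ⟨μ, h1, h2, h3⟩ := Sys.ext0 j S.M S.T S.f S.κ hS (fun i => s.map (fun μ => μ i))
    (fun i => (hs i).1) (fun i => (hs i).2) m hm (by simpa using hl)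
  exact ⟨μ, h1, Sys.Ti_cons hs h2 h3⟩

lemma Sys.lift {S : Sys} (hS : S.OK) (j : ℕ) (t : List (S.M j)) (ht : t ∈ S.T j)
    (hl : t.length ≤ S.κ j) : ∃ s ∈ S.Ti, s.map (fun μ => μ j) = t := by
  induction t with
  | nil => exact ⟨[], fun i => ⟨(hS.tree i).nil, rfl⟩, rfl⟩
  | cons m t ih =>
    simp only [List.length_cons] at hl
    obtain ⟨s, hs, he⟩ := ih ((hS.tree j).cls _ _ ht) (by omega)
    have hle : s.length = t.length := by rw [← he]; simp
    obtain ⟨μ, h1, h2⟩ := Sys.ext hS hs j (m := m) (by rw [he]; exact ht) (by omega)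
    exact ⟨μ :: s, h2, by simp [h1, he]⟩

lemma Sys.Ti_tree {S : Sys} (hS : S.OK) : IsTree S.Ti where
  nil := fun i => ⟨(hS.tree i).nil, rfl⟩
  cls m t h := Sys.Ti_cls hS h
  prune s hs := by
    obtain ⟨m, hm⟩ := (hS.tree (s.length + 1)).prune _ (hs (s.length + 1)).1
    obtain ⟨μ, _, h⟩ := Sys.ext hS hs (s.length + 1) hm (hS.unb _)
    exact ⟨μ, h⟩

lemma list_ext_comp {M : ℕ → Type} {s s' : List (∀ i, M i)}
    (h : ∀ i, s.map (fun μ => μ i) = s'.map (fun μ => μ i)) : s = s' := by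
  induction s generalizing s' with
  | nil =>
    have := h 0
    cases s' with
    | nil => rfl
    | cons a b => simp at this
  | cons a s ih =>
    cases s' with
    | nil => have := h 0; simp at this
    | cons b s' =>
      have h1 : a = b := by
        funext i
        have := h i
        simp only [List.map_cons, List.cons.injEq] at this
        exact this.1
      rw [h1, ih (s' := s') (fun i => by
        have := h i
        simp only [List.map_cons, List.cons.injEq] at this
        exact this.2)]

lemma Sys.uniq_i {S : Sys} (hS : S.OK) (j : ℕ) {s s' : List (∀ i, S.M i)} (hs : s ∈ S.Ti)
    (hs' : s' ∈ S.Ti) (hl : s.length ≤ S.κ j)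
    (he : s.map (fun μ => μ j) = s'.map (fun μ => μ j)) : s = s' := by
  apply list_ext_comp
  intro i
  rcases Nat.le_total i j with h | h
  · induction j, h using Nat.le_induction with
    | base => exact he
    | succ j hij ih =>
      have e : s.map (fun μ => μ j) = s'.map (fun μ => μ j) := by
        rw [← (hs j).2, ← (hs' j).2, he]
      clear hl
      have : ∀ j, i ≤ j → s.map (fun μ => μ j) = s'.map (fun μ => μ j) →
          s.map (fun μ => μ i) = s'.map (fun μ => μ i) := by
        intro j hj
        induction j, hj using Nat.le_induction with
        | base => exact fun h => h
        | succ j _ ih => exact fun h => ih (by rw [← (hs j).2, ← (hs' j).2, h])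
      exact this j hij e
  · induction i, h using Nat.le_induction with
    | base => exact he
    | succ i hij ih =>
      apply hS.uniq i _ (hs (i + 1)).1 _ (hs' (i + 1)).1
      · simpa using hl.trans (Sys.mono_le hS hij)
      · rw [(hs i).2, (hs' i).2, ih]

end limit
end SH

end

section
namespace SH

section limit2

open Classical in
noncomputable def tauS (S : Sys) (d : ∀ j, List (S.M j) → S.M j)
    (σ : List (∀ i, S.M i) → ∀ i, S.M i) (j : ℕ) (t : List (S.M j)) : S.M j :=
  if h : t.length < S.κ j ∧ ∃ s ∈ S.Ti, s.map (fun μ => μ j) = t then σ h.2.choose j else d j t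

lemma tauS_eq {S : Sys} (hS : S.OK) (d : ∀ j, List (S.M j) → S.M j)
    (σ : List (∀ i, S.M i) → ∀ i, S.M i) (j : ℕ) {s : List (∀ i, S.M i)} (hs : s ∈ S.Ti)
    (hl : s.length < S.κ j) : tauS S d σ j (s.map (fun μ => μ j)) = σ s j := by
  have h : (s.map (fun μ => μ j)).length < S.κ j ∧
      ∃ s' ∈ S.Ti, s'.map (fun μ => μ j) = s.map (fun μ => μ j) := ⟨by simpa using hl, s, hs, rfl⟩
  unfold tauS
  rw [dif_pos h]
  have h1 := h.2.choose_spec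
  rw [Sys.uniq_i hS j hs h1.1 hl.le h1.2.symm |>.symm]

lemma tauS_legal {S : Sys} (hS : S.OK) {d : ∀ j, List (S.M j) → S.M j} {q : ℕ}
    (hd : ∀ j, Legal (S.T j) q (d j)) {σ : List (∀ i, S.M i) → ∀ i, S.M i} (hσ : Legal S.Ti q σ)
    (j : ℕ) : Legal (S.T j) q (tauS S d σ j) := by
  intro t ht hp
  unfold tauS
  split_ifs with h
  · have h1 := h.2.choose_spec
    have hl : h.2.choose.length = t.length := by
      have := congrArg List.length h1.2
      simpa using this
    have := (hσ _ h1.1 (by rw [hl]; exact hp) j).1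
    simp only [List.map_cons, h1.2] at this
    exact this
  · exact hd j t ht hp

lemma tauS_loc {S : Sys} (hS : S.OK) (d : ∀ j, List (S.M j) → S.M j) {q n : ℕ}
    {σ σ' : List (∀ i, S.M i) → ∀ i, S.M i}
    (ha : ∀ t ∈ S.Ti, t.length < n → t.length % 2 = q → σ t = σ' t)
    (j : ℕ) (t : List (S.M j)) (hl : t.length < n) (hp : t.length % 2 = q) :
    tauS S d σ j t = tauS S d σ' j t := by
  unfold tauS
  split_ifs with h
  · have h1 := h.2.choose_spec
    have hl' : h.2.choose.length = t.length := by
      have := congrArg List.length h1.2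
      simpa using this
    rw [ha _ h1.1 (by omega) (by omega)]
  · rfl

abbrev Phi (S : Sys) := ∀ i, ℕ → (List (S.M (i + 1)) → S.M (i + 1)) → (List (S.M i) → S.M i)

def Ch {S : Sys} (φ : Phi S) (q : ℕ) (τ : ∀ j, List (S.M j) → S.M j) :
    ℕ → ∀ i, List (S.M i) → S.M i
  | 0, i => τ i
  | d + 1, i => φ i q (Ch φ q τ d (i + 1))

theorem limit_cov (S : Sys) (φ : Phi S) (h0 : IsTree (S.T 0))
    (hc : ∀ i, Cov (S.κ i) (S.T i) (S.T (i + 1)) (S.f i) (φ i))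
    (mono : ∀ i, S.κ i ≤ S.κ (i + 1)) (unb : ∀ i, i ≤ S.κ i) :
    ∃ ψ, Cov (S.κ 0) (S.T 0) S.Ti (fun μ => μ 0) ψ := by
  have hS : S.OK := ⟨fun i => by cases i with
    | zero => exact h0
    | succ i => exact (hc i).tree, fun i => (hc i).map, fun i => (hc i).surj, fun i => (hc i).uniq,
    mono, unb⟩
  have hd : ∀ j, ∃ d : List (S.M j) → S.M j, ∀ q, Legal (S.T j) q d := fun j => (hS.tree j).legal
  choose d hd using hd
  -- basic facts
  have Cleg : ∀ q σ, Legal S.Ti q σ → ∀ e i, Legal (S.T i) q (Ch φ q (tauS S d σ) e i) := by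
    intro q σ hσ e
    induction e with
    | zero => exact fun i => tauS_legal hS (fun j => hd j q) hσ i
    | succ e ih => exact fun i => (hc i).leg q _ (ih (i + 1))
  have Cstep : ∀ q σ, Legal S.Ti q σ → ∀ e i, ∀ t ∈ S.T i, t.length < S.κ (i + e) →
      t.length % 2 = q → Ch φ q (tauS S d σ) (e + 1) i t = Ch φ q (tauS S d σ) e i t := by
    intro q σ hσ e
    induction e with
    | zero =>
      intro i t ht hl hp
      obtain ⟨s, hs, rfl⟩ := Sys.lift hS i t ht hl.le
      simp only [List.length_map] at hl hp
      show φ i q (tauS S d σ (i + 1)) _ = tauS S d σ i _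
      rw [tauS_eq hS d σ i hs hl, ← (hs i).2,
        (hc i).idn q _ _ (tauS_legal hS (fun j => hd j q) hσ (i + 1)) (hs (i + 1)).1 (by simpa using hl)
          (by simpa using hp), tauS_eq hS d σ (i + 1) hs (hl.trans_le (mono i))]
      exact Sys.Ti_f (hσ s hs hp) i
    | succ e ih =>
      intro i t ht hl hp
      refine (hc i).loc q _ _ (S.κ (i + (e + 1))) (Cleg q σ hσ (e + 1) (i + 1)) (Cleg q σ hσ e (i + 1)) ?_ t ht hl hp
      intro t' ht' hl' hp'
      exact ih (i + 1) t' ht' (by rw [show i + 1 + e = i + (e + 1) by omega]; exact hl') hp'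
  have Cstab : ∀ q σ, Legal S.Ti q σ → ∀ e e' i, e ≤ e' → ∀ t ∈ S.T i, t.length < S.κ (i + e) →
      t.length % 2 = q → Ch φ q (tauS S d σ) e' i t = Ch φ q (tauS S d σ) e i t := by
    intro q σ hσ e e' i hee t ht hl hp
    induction e', hee using Nat.le_induction with
    | base => rfl
    | succ e' he ih =>
      rw [Cstep q σ hσ e' i t ht (hl.trans_le (Sys.mono_le hS (by omega))) hp, ih]
  obtain ⟨Z, hZ⟩ : ∃ Z : ℕ → (List (∀ i, S.M i) → ∀ i, S.M i) → ∀ i, List (S.M i) → S.M i,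
      ∀ q σ i t, Z q σ i t = Ch φ q (tauS S d σ) (t.length + 1) i t := ⟨_, fun _ _ _ _ => rfl⟩
  have Zeq : ∀ q σ, Legal S.Ti q σ → ∀ e i, ∀ t ∈ S.T i, t.length < S.κ (i + e) →
      t.length % 2 = q → Z q σ i t = Ch φ q (tauS S d σ) e i t := by
    intro q σ hσ e i t ht hl hp
    rw [hZ]
    rcases Nat.le_total e (t.length + 1) with h | h
    · exact Cstab q σ hσ _ _ i h t ht hl hp
    · refine (Cstab q σ hσ _ _ i h t ht ?_ hp).symm
      have := unb (i + (t.length + 1)); omega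
  have Zleg : ∀ q σ, Legal S.Ti q σ → ∀ i, Legal (S.T i) q (Z q σ i) := by
    intro q σ hσ i t ht hp
    rw [hZ]; exact Cleg q σ hσ _ i t ht hp
  have Zphi : ∀ q σ, Legal S.Ti q σ → ∀ i, ∀ t ∈ S.T i, t.length % 2 = q →
      Z q σ i t = φ i q (Z q σ (i + 1)) t := by
    intro q σ hσ i t ht hp
    have hb : t.length < S.κ (i + (t.length + 1 + 1)) := by
      have := unb (i + (t.length + 1 + 1)); omega
    rw [Zeq q σ hσ (t.length + 1 + 1) i t ht hb hp]
    refine (hc i).loc q _ _ (t.length + 1) (Cleg q σ hσ _ (i + 1)) (Zleg q σ hσ (i + 1)) ?_ t ht (by omega) hp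
    intro t' ht' hl' hp'
    refine (Zeq q σ hσ (t.length + 1) (i + 1) t' ht' ?_ hp').symm
    have := unb (i + 1 + (t.length + 1)); omega
  refine ⟨fun q σ => Z q σ 0, Sys.Ti_tree hS, fun s hs => (hs 0).1, fun q σ hσ => Zleg q σ hσ 0, ?_, ?_, ?_, ?_, ?_⟩
  · intro q σ σ' n hσ hσ' ha t ht hl hp
    have : ∀ e i, ∀ t ∈ S.T i, t.length < n → t.length % 2 = q →
        Ch φ q (tauS S d σ) e i t = Ch φ q (tauS S d σ') e i t := by
      intro e
      induction e with
      | zero => exact fun i t ht hl hp => tauS_loc hS d ha i t hl hp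
      | succ e ih =>
        exact fun i => (hc i).loc q _ _ n (Cleg q σ hσ e (i + 1)) (Cleg q σ' hσ' e (i + 1)) (ih (i + 1))
    simp only [hZ]
    exact this _ 0 t ht hl hp
  · intro q σ x hq hσ hx hcx
    have step : ∀ i (y : {y : ℕ → S.M i // Run (S.T i) y ∧ ConsF 0 q (Z q σ i) y}),
        ∃ y' : {y : ℕ → S.M (i + 1) // Run (S.T (i + 1)) y ∧ ConsF 0 q (Z q σ (i + 1)) y},
          ∀ n, S.f i (y'.1 n) = y.1 n := by
      rintro i ⟨y, hy, hcy⟩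
      obtain ⟨y', h1, h2, h3⟩ := (hc i).lift q (Z q σ (i + 1)) y hq (Zleg q σ hσ (i + 1)) hy (by
        intro n h0 hp
        rw [hcy n h0 hp]
        exact Zphi q σ hσ i _ (hy n) (by simpa using hp))
      exact ⟨⟨y', h1, h3⟩, h2⟩
    choose g hg using step
    let ν : ∀ i, {y : ℕ → S.M i // Run (S.T i) y ∧ ConsF 0 q (Z q σ i) y} :=
      fun i => Nat.rec ⟨x, hx, hcx⟩ (fun i a => g i a) i
    have hν : ∀ i n, S.f i ((ν (i + 1)).1 n) = (ν i).1 n := fun i n => hg i (ν i) n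
    have hh : ∀ i n, (hist (fun n => (fun i => (ν i).1 n : ∀ i, S.M i)) n).map (fun μ => μ i) =
        hist (ν i).1 n := fun i n => hist_map _ _ n
    have hrun : Run S.Ti (fun n => (fun i => (ν i).1 n : ∀ i, S.M i)) := by
      intro n i
      rw [hh, hh]
      refine ⟨(ν i).2.1 n, ?_⟩
      rw [hist_map]
      congr 1
      funext n
      exact hν i n
    refine ⟨fun n i => (ν i).1 n, hrun, fun n => rfl, ?_⟩
    intro n _ hp
    set s := hist (fun n => (fun i => (ν i).1 n : ∀ i, S.M i)) n with hs
    have hsl : s.length = n := by simp [hs]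
    have hsT : s ∈ S.Ti := hrun n
    have big : ∀ i, n < S.κ i → (ν i).1 n = σ s i := by
      intro i hi
      rw [(ν i).2.2 n (Nat.zero_le _) hp, ← hh i n, ← hs]
      rw [Zeq q σ hσ 0 i _ (hsT i).1 (by simpa [hsl] using hi) (by simpa [hsl] using hp)]
      exact tauS_eq hS d σ i hsT (by rw [hsl]; exact hi)
    have down : ∀ j i, (ν (i + j)).1 n = σ s (i + j) → (ν i).1 n = σ s i := by
      intro j
      induction j with
      | zero => exact fun i h => h
      | succ j ih =>
        intro i h
        apply ih
        rw [← hν, ← Sys.Ti_f (hσ s hsT (by rw [hsl]; exact hp))]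
        exact congrArg _ h
    funext i
    apply down (n + 1) i
    exact big (i + (n + 1)) (by have := unb (i + (n + 1)); omega)
  · exact fun s hs hl => Sys.lift hS 0 s hs hl
  · exact fun s hs s' hs' hl he => Sys.uniq_i hS 0 hs hs' hl he
  · intro q σ s hσ hs hl hp
    show Z q σ 0 _ = _
    rw [Zeq q σ hσ 0 0 _ (hs 0).1 (by simpa using hl) (by simpa using hp)]
    exact tauS_eq hS d σ 0 hs hl

end limit2

section borel

/-- Unravellability of a payoff set, hereditarily. -/
def Unr {M : Type} (X : Set (ℕ → M)) : Prop :=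
  ∀ (M1 : Type) (T : Set (List M1)) (g : M1 → M) (k : ℕ), IsTree T →
    ∃ (M' : Type) (T' : Set (List M')) (f : M' → M1) (φ : ℕ → (List M' → M') → (List M1 → M1)),
      Cov k T T' f φ ∧ Clp T' {x | (fun n => g (f (x n))) ∈ X}

def OpenH {M : Type} (X : Set (ℕ → M)) : Prop := ∀ x ∈ X, ∃ n, ∀ y, hist y n = hist x n → y ∈ X

lemma Clp.compl {M : Type} {T : Set (List M)} {X : Set (ℕ → M)} (h : Clp T X) : Clp T Xᶜ := by
  intro x hx
  obtain ⟨n, hn⟩ := h x hx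
  exact ⟨n, fun y hy e => not_congr (hn y hy e)⟩

lemma Unr.compl {M : Type} {X : Set (ℕ → M)} (h : Unr X) : Unr Xᶜ := by
  intro M1 T g k hT
  obtain ⟨M', T', f, φ, hc, hX⟩ := h M1 T g k hT
  exact ⟨M', T', f, φ, hc, hX.compl⟩

/-- Open-on-the-body version of the closed covering theorem. -/
lemma open_cov {M : Type} {T : Set (List M)} (hT : IsTree T) (k : ℕ) {X : Set (ℕ → M)}
    (hX : ∀ x, Run T x → x ∈ X → ∃ n, ∀ y, Run T y → hist y n = hist x n → y ∈ X) :
    ∃ (M' : Type) (T' : Set (List M')) (f : M' → M) (φ : ℕ → (List M' → M') → (List M → M)),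
      Cov k T T' f φ ∧ Clp T' {x | (fun n => f (x n)) ∈ X} := by
  obtain ⟨M', T', f, φ, hc, hcl⟩ := closed_cov hT k
    (Y := {t | ∃ x, Run T x ∧ x ∉ X ∧ hist x t.length = t}) (by
      rintro m t ⟨x, hx, hxX, he⟩
      refine ⟨x, hx, hxX, ?_⟩
      simp only [List.length_cons, hist_succ, List.cons.injEq] at he
      exact he.2)
  refine ⟨M', T', f, φ, hc, ?_⟩
  have key : ∀ x, Run T' x → (x ∈ {x : ℕ → M' | (fun n => f (x n)) ∈ X} ↔
      x ∉ {x : ℕ → M' | ∀ n, hist (fun j => f (x j)) n ∈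
        {t | ∃ x, Run T x ∧ x ∉ X ∧ hist x t.length = t}}) := by
    intro x hx
    have hr : Run T (fun n => f (x n)) := fun n => by rw [← hist_map]; exact hc.map _ (hx n)
    constructor
    · intro h hall
      obtain ⟨n, hn⟩ := hX _ hr h
      obtain ⟨y, hy, hyX, he⟩ := hall n
      simp only [hist_length] at he
      exact hyX (hn y hy he)
    · intro h
      by_contra hno
      exact h fun n => ⟨_, hr, hno, by simp⟩
  intro x hx
  obtain ⟨n, hn⟩ := hcl x hx
  refine ⟨n, fun y hy e => ?_⟩
  rw [key y hy, key x hx]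
  exact not_congr (hn y hy e)

lemma Unr.of_open {M : Type} {X : Set (ℕ → M)} (h : OpenH X) : Unr X := by
  intro M1 T g k hT
  refine open_cov hT k (X := {x | (fun n => g (x n)) ∈ X}) ?_
  intro x hx hxX
  obtain ⟨n, hn⟩ := h _ hxX
  refine ⟨n, fun y hy e => hn _ ?_⟩
  rw [← hist_map g y, ← hist_map g x, e]

structure Node (M : Type) where
  N : Type
  T : Set (List N)
  tree : IsTree T
  g : N → M

lemma Unr.iUnion {M : Type} {X : ℕ → Set (ℕ → M)} (h : ∀ n, Unr (X n)) : Unr (⋃ n, X n) := by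
  intro M1 T g k hT
  have step : ∀ (i : ℕ) (D : Node M), ∃ (D' : Node M) (f : D'.N → D.N)
      (φ : ℕ → (List D'.N → D'.N) → (List D.N → D.N)),
      Cov (k + i) D.T D'.T f φ ∧ Clp D'.T {x | (fun n => D'.g (x n)) ∈ X i} ∧
      ∀ a, D'.g a = D.g (f a) := by
    intro i D
    obtain ⟨M', T', f, φ, hc, hX⟩ := h i D.N D.T D.g (k + i) D.tree
    exact ⟨⟨M', T', hc.tree, fun a => D.g (f a)⟩, f, φ, hc, hX, fun a => rfl⟩
  choose nx f φ hc hX hg using step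
  let D : ℕ → Node M := fun i => Nat.rec ⟨M1, T, hT, g⟩ (fun i D => nx i D) i
  let S : Sys := ⟨fun i => (D i).N, fun i => (D i).T, fun i => f i (D i), fun i => k + i⟩
  obtain ⟨ψ, hψ⟩ := limit_cov S (fun i => φ i (D i)) hT (fun i => hc i (D i))
    (fun i => by show k + i ≤ k + (i + 1); omega) (fun i => by show i ≤ k + i; omega)
  have hψ' : Cov k T S.Ti (fun μ => μ 0) ψ := hψ
  have hgi : ∀ x, Run S.Ti x → ∀ i n, (D i).g (x n i) = g (x n 0) := by
    intro x hx i n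
    induction i with
    | zero => rfl
    | succ i ih =>
      rw [← ih, ← Sys.Ti_f (hx (n + 1)) i]
      exact hg i (D i) _
  obtain ⟨M', T', f', φ', hc', hcl⟩ := open_cov hψ.tree k
    (X := {x | (fun n => g (x n 0)) ∈ ⋃ n, X n}) (by
      intro x hx hxX
      obtain ⟨i, hi⟩ := Set.mem_iUnion.1 hxX
      have hr : ∀ y, Run S.Ti y → Run (D (i + 1)).T (fun n => y n (i + 1)) := fun y hy n => by
        rw [← hist_map (fun μ : ∀ i, S.M i => μ (i + 1))]; exact (hy n (i + 1)).1
      obtain ⟨n, hn⟩ := hX i (D i) _ (hr x hx)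
      refine ⟨n, fun y hy e => Set.mem_iUnion.2 ⟨i, ?_⟩⟩
      have e1 : ∀ y, Run S.Ti y → (fun n => g (y n 0)) = fun n => (nx i (D i)).g (y n (i + 1)) := by
        intro y hy
        funext n
        exact (hgi y hy (i + 1) n).symm
      have := hn _ (hr y hy) (by
        rw [← hist_map (fun μ : ∀ i, S.M i => μ (i + 1)), ← hist_map (fun μ : ∀ i, S.M i => μ (i + 1)), e])
      rw [e1 y hy]
      refine this.2 ?_
      rw [e1 x hx] at hi
      exact hi)
  exact ⟨M', T', _, _, hψ'.comp hc', hcl⟩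

def Det {M : Type} (T : Set (List M)) (X : Set (ℕ → M)) : Prop :=
  (∃ σ, Legal T 0 σ ∧ ∀ x, Run T x → ConsF 0 0 σ x → x ∈ X) ∨
  (∃ σ, Legal T 1 σ ∧ ∀ x, Run T x → ConsF 0 1 σ x → x ∉ X)

lemma Clp.det {M : Type} {T : Set (List M)} (hT : IsTree T) {X : Set (ℕ → M)} (h : Clp T X) :
    Det T X := by
  classical
  set S : Set (List M) := {t | ∀ x, Run T x → hist x t.length = t → x ∈ X} with hS
  by_cases hF : Force T 0 S []
  · left
    obtain ⟨σ, hσ, hw⟩ := hF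
    refine ⟨σ, hσ, fun x hx hc => ?_⟩
    obtain ⟨n, hn⟩ := hw x hx rfl hc
    exact hn x hx (by simp)
  · right
    obtain ⟨d, hd⟩ := hT.legal
    refine ⟨fun t => if h : ∃ m, m :: t ∈ T ∧ ¬ Force T 0 S (m :: t) then h.choose else d t, ?_, ?_⟩
    · intro t ht hp
      simp only
      split_ifs with h
      · exact h.choose_spec.1
      · exact hd 1 t ht hp
    · intro x hx hc hxX
      have hno : ∀ n, ¬ Force T 0 S (hist x n) := by
        intro n
        induction n with
        | zero => exact hF
        | succ n ih =>
          rcases Nat.mod_two_eq_zero_or_one n with hp | hp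
          · exact fun h => ih (force_own hT (by simpa using hp) (hx (n + 1)) h)
          · have he : ∃ m, m :: hist x n ∈ T ∧ ¬ Force T 0 S (m :: hist x n) := by
              by_contra hno
              push Not at hno
              exact ih (force_opp hT hno)
            have := hc n (Nat.zero_le _) hp
            beta_reduce at this
            rw [dif_pos he] at this
            rw [hist_succ, this]
            exact he.choose_spec.2
      obtain ⟨n, hn⟩ := h x hx
      refine hno n (force_mem hT 0 fun y hy e => ?_)
      simp only [hist_length] at e
      exact (hn y hy e).2 hxX

theorem Unr.det {M : Type} {X : Set (ℕ → M)} (h : Unr X) {T : Set (List M)} (hT : IsTree T) :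
    Det T X := by
  obtain ⟨M', T', f, φ, hc, hX⟩ := h M T id 0 hT
  rcases hX.det hc.tree with ⟨σ, hσ, hw⟩ | ⟨σ, hσ, hw⟩
  · refine Or.inl ⟨φ 0 σ, hc.leg 0 σ hσ, fun x hx hcx => ?_⟩
    obtain ⟨x', h1, h2, h3⟩ := hc.lift 0 σ x (by omega) hσ hx hcx
    have e : (fun n => id (f (x' n))) = x := funext fun n => h2 n
    rw [← e]
    exact hw x' h1 h3
  · refine Or.inr ⟨φ 1 σ, hc.leg 1 σ hσ, fun x hx hcx => ?_⟩
    obtain ⟨x', h1, h2, h3⟩ := hc.lift 1 σ x (by omega) hσ hx hcx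
    have e : (fun n => id (f (x' n))) = x := funext fun n => h2 n
    rw [← e]
    exact hw x' h1 h3

end borel
end SH

end

section
namespace SH
open Topology Filter

abbrev Pm := ℕ × Bool
abbrev Pw := ℕ → Pm

lemma cwa_of_hist {X : Type} [TopologicalSpace X] {f : X → Pw} {S : Set X} {x : X}
    (h : ∀ n, ∀ᶠ x' in 𝓝[S] x, hist (f x') n = hist (f x) n) : ContinuousWithinAt f S x := by
  refine continuousWithinAt_pi.2 fun n => ?_
  refine (tendsto_const_nhds (x := f x n)).congr' ?_
  filter_upwards [h (n + 1)] with x' hx'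
  exact (hist_eval hx' (Nat.lt_succ_self n)).symm

lemma hist_nhds (π : Pw) (n : ℕ) : ∀ᶠ π' in 𝓝 π, hist π' n = hist π n := by
  have : ∀ᶠ π' in 𝓝 π, ∀ m ∈ Finset.range n, π' m = π m := by
    rw [Finset.eventually_all]
    intro m _
    have hc : Continuous (fun π' : Pw => π' m) := continuous_apply m
    exact hc.continuousAt (IsOpen.mem_nhds (isOpen_discrete {π m}) rfl)
  filter_upwards [this] with π' h
  exact hist_ext fun m hm => h m (Finset.mem_range.2 hm)

lemma openH_of_isOpen {X : Set Pw} (h : IsOpen X) : OpenH X := by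
  intro x hx
  obtain ⟨I, u, hu, hs⟩ := isOpen_pi_iff.1 h x hx
  refine ⟨I.sup id + 1, fun y hy => hs fun i hi => ?_⟩
  have : i ≤ I.sup id := Finset.le_sup (f := id) hi
  rw [hist_eval hy (m := i) (by omega)]
  exact (hu i hi).2

lemma unr_borel {X : Set Pw} (h : @MeasurableSet Pw (borel Pw) X) : Unr X := by
  induction X, h using MeasurableSpace.generateFrom_induction with
  | hC t ht _ => exact Unr.of_open (openH_of_isOpen ht)
  | empty => exact Unr.of_open fun x hx => absurd hx (by simp)
  | compl t _ ih => exact ih.compl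
  | iUnion s _ ih => exact Unr.iUnion ih

/-- The play produced by a total strategy for both players. -/
def ph {M : Type} (g : List M → M) : ℕ → List M
  | 0 => []
  | n + 1 => g (ph g n) :: ph g n
def play {M : Type} (g : List M → M) (n : ℕ) : M := g (ph g n)
lemma hist_play {M : Type} (g : List M → M) (n : ℕ) : hist (play g) n = ph g n := by
  induction n with
  | zero => rfl
  | succ n ih => rw [hist_succ, ih]; rfl
lemma play_eq {M : Type} (g : List M → M) (n : ℕ) : play g n = g (hist (play g) n) := by
  rw [hist_play]; rfl

def Wl (e : ℕ → Bool → Set Cs) : List Pm → Set Cs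
  | c :: m :: _ => e m.1 c.2
  | _ => Set.univ

structure Lg (e : ℕ → Bool → Set Cs) (L : Set Cs) (t : List Pm) (m : ℕ) : Prop where
  sub : ∀ c, e m c ⊆ Wl e t
  dj : Disjoint (e m true) (e m false)
  ne : ∀ c, (L ∩ e m c).Nonempty
  third : ((L ∩ Wl e t) \ (e m true ∪ e m false)).Nonempty
  ag : ∀ c, Agree (t.length + 1) (e m c)

def LgP (e : ℕ → Bool → Set Cs) (L : Set Cs) (π : Pw) : Prop :=
  ∀ n, Lg e L (hist π (2 * n)) (π (2 * n)).1

def aa (π : Pw) : Cs := fun n => (π (2 * n + 1)).2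
open Classical in
noncomputable def bb (e : ℕ → Bool → Set Cs) (π : Pw) : Cs := fun n =>
  decide (∃ z ∈ e (π (2 * n)).1 (π (2 * n + 1)).2, z n = true)

lemma aa_cont : Continuous aa := by
  unfold aa; fun_prop

lemma bb_cont (e : ℕ → Bool → Set Cs) : Continuous (bb e) := by
  classical
  refine continuous_pi fun n => ?_
  have : (fun π => bb e π n) =
      (fun p : Pm × Pm => decide (∃ z ∈ e p.1.1 p.2.2, z n = true)) ∘
        fun π : Pw => (π (2 * n), π (2 * n + 1)) := by
    funext π
    simp only [bb, Function.comp]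
  rw [this]
  exact continuous_of_discreteTopology.comp (by fun_prop)

lemma Wl_succ (e : ℕ → Bool → Set Cs) (π : Pw) (n : ℕ) :
    Wl e (hist π (2 * (n + 1))) = e (π (2 * n)).1 (π (2 * n + 1)).2 := rfl

lemma Wl_clopen {e : ℕ → Bool → Set Cs} (he : ∀ m c, IsClopen (e m c)) (t : List Pm) :
    IsClopen (Wl e t) := by
  unfold Wl
  split
  · exact he _ _
  · exact isClopen_univ

lemma Wl_anti {e : ℕ → Bool → Set Cs} {L : Set Cs} {π : Pw} {N : ℕ}
    (h : ∀ n < N, Lg e L (hist π (2 * n)) (π (2 * n)).1)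
    {m n : ℕ} (hmn : m ≤ n) (hn : n ≤ N) : Wl e (hist π (2 * n)) ⊆ Wl e (hist π (2 * m)) := by
  induction n, hmn using Nat.le_induction with
  | base => exact le_rfl
  | succ n _ ih =>
    rw [Wl_succ]
    exact ((h n (by omega)).sub _).trans (ih (by omega))

lemma bb_eq {e : ℕ → Bool → Set Cs} {L : Set Cs} {π : Pw} (h : LgP e L π) {z : Cs}
    (hz : ∀ n, z ∈ Wl e (hist π (2 * n))) : bb e π = z := by
  classical
  funext k
  have hk := hz (k + 1)
  rw [Wl_succ] at hk
  have := (h k).ag (π (2 * k + 1)).2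
  simp only [hist_length] at this
  unfold bb
  cases hb : z k with
  | true => exact decide_eq_true ⟨z, hk, hb⟩
  | false =>
    refine decide_eq_false ?_
    rintro ⟨w, hw, hwk⟩
    have := this z hk w hw k (by omega)
    rw [hb, hwk] at this
    exact absurd this (by simp)

lemma bb_mem {e : ℕ → Bool → Set Cs} (he : ∀ m c, IsClopen (e m c)) {L : Set Cs}
    (hL : IsClosed L) {π : Pw} (h : LgP e L π) :
    bb e π ∈ L ∧ ∀ n, bb e π ∈ Wl e (hist π (2 * n)) := by
  have hne : (⋂ n, L ∩ Wl e (hist π (2 * n))).Nonempty := by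
    apply IsCompact.nonempty_iInter_of_sequence_nonempty_isCompact_isClosed
    · intro n
      exact Set.inter_subset_inter_right _ (Wl_anti (N := n + 1) (fun m _ => h m) (Nat.le_succ n) le_rfl)
    · intro n
      cases n with
      | zero =>
        obtain ⟨z, hz, _⟩ := (h 0).third
        exact ⟨z, hz⟩
      | succ n => rw [Wl_succ]; exact (h n).ne _
    · exact (hL.inter (Wl_clopen he _).1).isCompact
    · exact fun n => hL.inter (Wl_clopen he _).1
  obtain ⟨z, hz⟩ := hne
  rw [Set.mem_iInter] at hz
  rw [bb_eq h fun n => (hz n).2]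
  exact ⟨(hz 0).1, fun n => (hz n).2⟩

lemma lgp_closed (e : ℕ → Bool → Set Cs) (L : Set Cs) : IsClosed {π | LgP e L π} := by
  have : {π | LgP e L π} = ⋂ n, {π : Pw | Lg e L (hist π (2 * n)) (π (2 * n)).1} := by
    ext π; simp [LgP]
  rw [this]
  refine isClosed_iInter fun n => ⟨isOpen_iff_mem_nhds.2 fun π hπ => ?_⟩
  filter_upwards [hist_nhds π (2 * n + 1)] with π' h hc
  apply hπ
  have h1 : hist π' (2 * n) = hist π (2 * n) := hist_agree h (by omega)
  have h2 : π' (2 * n) = π (2 * n) := hist_eval h (by omega)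
  have hc' : Lg e L (hist π' (2 * n)) (π' (2 * n)).1 := hc
  rwa [h1, h2] at hc'

lemma consF_closed (i : ℕ) (τ : List Pm → Pm) : IsClosed {π | ConsF 0 i τ π} := by
  refine ⟨isOpen_iff_mem_nhds.2 fun π hπ => ?_⟩
  have hπ' : ¬ ConsF 0 i τ π := hπ
  unfold ConsF at hπ'
  push Not at hπ'
  obtain ⟨n, h0, h1, h2⟩ := hπ'
  filter_upwards [hist_nhds π (n + 1)] with π' h hc
  apply h2
  have := hc n h0 h1
  rwa [hist_eval h (Nat.lt_succ_self n), hist_agree h (Nat.le_succ n)] at this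

end SH

end

section
namespace SH
open Topology Filter

lemma cyl_open (y : Cs) (n : ℕ) : IsOpen {z : Cs | ∀ j < n, z j = y j} := by
  have : {z : Cs | ∀ j < n, z j = y j} = ⋂ j ∈ Finset.range n, {z : Cs | z j = y j} := by
    ext z; simp
  rw [this]
  exact isOpen_biInter_finset fun j _ => (isClopen_coord j (y j)).2

lemma cyl_sub {O : Set Cs} (hO : IsOpen O) {y : Cs} (hy : y ∈ O) :
    ∃ N, ∀ z : Cs, (∀ j < N, z j = y j) → z ∈ O := by
  obtain ⟨I, u, hu, hs⟩ := isOpen_pi_iff.1 hO y hy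
  refine ⟨I.sup id + 1, fun z hz => hs fun i hi => ?_⟩
  have : i ≤ I.sup id := Finset.le_sup (f := id) hi
  rw [hz i (by omega)]
  exact (hu i hi).2

def ge (σ : List Pm → Pm) (x : Cs) (t : List Pm) : Pm :=
  if t.length % 2 = 0 then σ t else (0, x (t.length / 2))

lemma ge_cons (σ : List Pm → Pm) (x : Cs) : ConsF 0 0 σ (play (ge σ x)) := by
  intro n _ hn
  rw [play_eq]
  unfold ge
  rw [if_pos (by rwa [hist_length])]

lemma ge_bit (σ : List Pm → Pm) (x : Cs) (n : ℕ) : (play (ge σ x) (2 * n + 1)).2 = x n := by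
  rw [play_eq]
  show (if _ then _ else _ : Pm).2 = _
  rw [if_neg (by rw [hist_length]; omega), hist_length]
  exact congrArg x (by omega)

lemma ge_aa (σ : List Pm → Pm) (x : Cs) : aa (play (ge σ x)) = x := by
  funext n; exact ge_bit σ x n

lemma ge_agree (σ : List Pm → Pm) {x x' : Cs} {n : ℕ} (h : ∀ j < n, x j = x' j) :
    hist (play (ge σ x)) (2 * n + 1) = hist (play (ge σ x')) (2 * n + 1) := by
  have : ∀ k ≤ 2 * n + 1, hist (play (ge σ x)) k = hist (play (ge σ x')) k := by
    intro k
    induction k with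
    | zero => intro _; rfl
    | succ k ih =>
      intro hk
      have ih := ih (by omega)
      rw [hist_succ, hist_succ, play_eq, play_eq (ge σ x'), ih]
      congr 1
      unfold ge
      split_ifs with hp
      · rfl
      · rw [hist_length] at hp ⊢
        rw [h (k / 2) (by omega)]
  exact this _ le_rfl

lemma ge_cont (σ : List Pm → Pm) : Continuous (fun x => play (ge σ x)) := by
  rw [← continuousOn_univ]
  intro x _
  refine cwa_of_hist fun n => ?_
  rw [nhdsWithin_univ]
  filter_upwards [(cyl_open x n).mem_nhds (fun j _ => rfl)] with x' hx'
  exact hist_agree (ge_agree σ hx') (by omega)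

lemma first_diff {x x' : Cs} (h : x ≠ x') : ∃ k, (∀ j < k, x j = x' j) ∧ x k ≠ x' k := by
  classical
  have : ∃ k, x k ≠ x' k := by
    by_contra hc
    push Not at hc
    exact h (funext hc)
  exact ⟨Nat.find this, fun j hj => not_not.1 (Nat.find_min this hj), Nat.find_spec this⟩

lemma lg_dj {e : ℕ → Bool → Set Cs} {L : Set Cs} {t : List Pm} {m : ℕ} (h : Lg e L t m)
    {c c' : Bool} (hc : c ≠ c') {z : Cs} (h1 : z ∈ e m c) (h2 : z ∈ e m c') : False := by
  have := Set.disjoint_left.1 h.dj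
  cases c <;> cases c'
  · exact hc rfl
  · exact this h2 h1
  · exact this h1 h2
  · exact hc rfl

lemma emb_of_win {e : ℕ → Bool → Set Cs} (he : ∀ m c, IsClopen (e m c)) {A B V L : Set Cs}
    (hV : IsClosed V) (hL : IsClosed L) (σ : List Pm → Pm)
    (hw : ∀ π, ConsF 0 0 σ π → LgP e L π ∧ (aa π ∈ V → (aa π ∈ A ↔ bb e π ∈ B))) :
    Emb A B V L := by
  set pl : Cs → Pw := fun x => play (ge σ x) with hpl
  have hlg : ∀ x, LgP e L (pl x) := fun x => (hw _ (ge_cons σ x)).1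
  have hbm := fun x => bb_mem he hL (hlg x)
  have sep : ∀ x x' z, z ∈ Set.univ → ∀ k, (∀ j < k, x j = x' j) → x k ≠ x' k →
      z ∈ Wl e (hist (pl x) (2 * (k + 1))) → z ∈ Wl e (hist (pl x') (2 * (k + 1))) → False := by
    intro x x' z _ k hk hne h1 h2
    have := ge_agree σ hk
    rw [Wl_succ] at h1 h2
    rw [show (pl x' (2 * k + 1)).2 = x' k from ge_bit σ x' k,
      show pl x' (2 * k) = pl x (2 * k) from (hist_eval this (by omega)).symm] at h2
    rw [show (pl x (2 * k + 1)).2 = x k from ge_bit σ x k] at h1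
    exact lg_dj (hlg x k) hne h1 h2
  have inj : ∀ x x', bb e (pl x) = bb e (pl x') → x = x' := by
    intro x x' h
    by_contra hne
    obtain ⟨k, hk, hkn⟩ := first_diff hne
    exact sep x x' (bb e (pl x)) trivial k hk hkn ((hbm x).2 _) (h ▸ (hbm x').2 _)
  refine ⟨(fun x => (x, bb e (pl x))) '' V, ⟨?_, ?_, ?_, ?_⟩, ?_, ?_, ?_⟩
  · exact hV.isCompact.image (continuous_id.prodMk ((bb_cont e).comp (ge_cont σ)))
  · rintro a b b' ⟨x, _, h⟩ ⟨x', _, h'⟩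
    simp only [Prod.mk.injEq] at h h'
    rw [← h.2, ← h'.2, h.1, h'.1]
  · rintro a a' b ⟨x, _, h⟩ ⟨x', _, h'⟩
    simp only [Prod.mk.injEq] at h h'
    rw [← h.1, ← h'.1]
    exact inj _ _ (h.2.trans h'.2.symm)
  · rintro a b ⟨x, hx, h⟩
    simp only [Prod.mk.injEq] at h
    have := (hw _ (ge_cons σ x)).2
    rw [ge_aa] at this
    rw [← h.1, ← h.2]
    exact this hx
  · ext x
    rw [mem_dom]
    constructor
    · rintro ⟨y, x', hx', h⟩
      simp only [Prod.mk.injEq] at h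
      exact h.1 ▸ hx'
    · exact fun hx => ⟨_, x, hx, rfl⟩
  · rintro y hy
    obtain ⟨x, x', hx', h⟩ := mem_ran.1 hy
    simp only [Prod.mk.injEq] at h
    rw [← h.2]; exact (hbm x').1
  · rintro O hO ⟨y, hyL, hyO⟩
    by_cases hy : y ∈ ran ((fun x => (x, bb e (pl x))) '' V)
    swap
    · exact ⟨y, ⟨hyL, hyO⟩, hy⟩
    obtain ⟨_, x, hx, h⟩ := mem_ran.1 hy
    simp only [Prod.mk.injEq] at h
    obtain ⟨N, hN⟩ := cyl_sub hO hyO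
    obtain ⟨z, ⟨hzL, hzW⟩, hz⟩ := (hlg x (N + 1)).third
    have hzO : z ∈ O := by
      refine hN z fun j hj => ?_
      have h1 := (hbm x).2 (N + 1)
      rw [h.2] at h1
      rw [Wl_succ] at hzW h1
      exact (hlg x N).ag _ z hzW y h1 j (by rw [hist_length]; omega)
    refine ⟨z, ⟨hzL, hzO⟩, fun hzr => ?_⟩
    obtain ⟨_, x', hx', h'⟩ := mem_ran.1 hzr
    simp only [Prod.mk.injEq] at h'
    by_cases hag : ∀ j < N + 1, x j = x' j
    · have h1 := ge_agree σ hag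
      have h2 := (hbm x').2 (N + 1 + 1)
      rw [Wl_succ, h'.2, show pl x' (2 * (N + 1)) = pl x (2 * (N + 1)) from
        (hist_eval h1 (by omega)).symm] at h2
      apply hz
      cases hc : (pl x' (2 * (N + 1) + 1)).2 with
      | true => rw [hc] at h2; exact Or.inl h2
      | false => rw [hc] at h2; exact Or.inr h2
    · push Not at hag
      obtain ⟨j, hj, hjn⟩ := hag
      obtain ⟨k, hk, hkn⟩ := first_diff (x := x) (x' := x') (fun h => hjn (congrFun h j))
      have hkj : k ≤ j := by
        by_contra hc
        exact hjn (hk j (by omega))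
      refine sep x x' z trivial k hk hkn ?_ ?_
      · exact Wl_anti (N := N + 1) (fun m _ => hlg x m) (by omega) le_rfl hzW
      · rw [← h'.2]; exact (hbm x').2 _

section chooser
variable (e : ℕ → Bool → Set Cs) (L : Set Cs) (τ : List Pm → Pm)

def Qc (y : Cs) (t : List Pm) (m : ℕ) : Prop := Lg e L t m ∧ y ∈ e m (τ ((m, false) :: t)).2

def Trap : Set Cs := {y | y ∈ L ∧ ∃ t, y ∈ Wl e t ∧ ¬ ∃ m, Qc e L τ y t m}

open Classical in
noncomputable def gc (y : Cs) (t : List Pm) : Pm :=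
  if t.length % 2 = 0 then (if h : ∃ m, Qc e L τ y t m then Nat.find h else 0, false) else τ t

lemma gc_cons (y : Cs) : ConsF 0 1 τ (play (gc e L τ y)) := by
  intro n _ hn
  rw [play_eq]
  unfold gc
  rw [if_neg (by rw [hist_length]; omega)]

open Classical in
lemma gc_eq {y : Cs} {t : List Pm} (ht : t.length % 2 = 0) (h : ∃ m, Qc e L τ y t m) :
    gc e L τ y t = (Nat.find h, false) := by
  unfold gc
  rw [if_pos ht, dif_pos h]

lemma gc_even (y : Cs) (n : ℕ) (h : ∃ m, Qc e L τ y (hist (play (gc e L τ y)) (2 * n)) m) :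
    Qc e L τ y (hist (play (gc e L τ y)) (2 * n)) (play (gc e L τ y) (2 * n)).1 ∧
    play (gc e L τ y) (2 * n) = ((play (gc e L τ y) (2 * n)).1, false) := by
  classical
  have : play (gc e L τ y) (2 * n) = (Nat.find h, false) := by
    rw [play_eq]
    exact gc_eq e L τ (by rw [hist_length]; omega) h
  rw [this]
  exact ⟨Nat.find_spec h, rfl⟩

lemma gc_mem {y : Cs} (hy : y ∈ L \ Trap e L τ) (n : ℕ) :
    y ∈ Wl e (hist (play (gc e L τ y)) (2 * n)) := by
  induction n with
  | zero => exact trivial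
  | succ n ih =>
    have hex : ∃ m, Qc e L τ y (hist (play (gc e L τ y)) (2 * n)) m := by
      by_contra hc
      exact hy.2 ⟨hy.1, _, ih, hc⟩
    obtain ⟨h1, h2⟩ := gc_even e L τ y n hex
    rw [Wl_succ]
    have h3 := gc_cons e L τ y (2 * n + 1) (Nat.zero_le _) (by omega)
    rw [hist_succ, h2] at h3
    rw [h3]
    exact h1.2

lemma gc_ex {y : Cs} (hy : y ∈ L \ Trap e L τ) (n : ℕ) :
    ∃ m, Qc e L τ y (hist (play (gc e L τ y)) (2 * n)) m := by
  by_contra hc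
  exact hy.2 ⟨hy.1, _, gc_mem e L τ hy n, hc⟩

lemma gc_lgp {y : Cs} (hy : y ∈ L \ Trap e L τ) : LgP e L (play (gc e L τ y)) :=
  fun n => (gc_even e L τ y n (gc_ex e L τ hy n)).1.1

lemma gc_contOn (he : ∀ m c, IsClopen (e m c)) :
    ContinuousOn (fun y => play (gc e L τ y)) (L \ Trap e L τ) := by
  classical
  intro y hy
  refine cwa_of_hist fun n => ?_
  induction n with
  | zero => exact Eventually.of_forall fun _ => rfl
  | succ n ih =>
    rcases Nat.even_or_odd' n with ⟨k, rfl | rfl⟩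
    · have hex := gc_ex e L τ hy k
      have hcl : ∀ m, ∀ᶠ y' in 𝓝 y, (Qc e L τ y' (hist (play (gc e L τ y)) (2 * k)) m ↔
          Qc e L τ y (hist (play (gc e L τ y)) (2 * k)) m) := by
        intro m
        by_cases hm : y ∈ e m (τ ((m, false) :: hist (play (gc e L τ y)) (2 * k))).2
        · filter_upwards [(he m _).2.mem_nhds hm] with y' hy'
          exact and_congr_right fun _ => iff_of_true hy' hm
        · filter_upwards [(he m _).1.isOpen_compl.mem_nhds hm] with y' hy'
          exact and_congr_right fun _ => iff_of_false hy' hm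
      have hall : ∀ᶠ y' in 𝓝 y, ∀ m ∈ Finset.range (Nat.find hex + 1),
          (Qc e L τ y' (hist (play (gc e L τ y)) (2 * k)) m ↔
          Qc e L τ y (hist (play (gc e L τ y)) (2 * k)) m) :=
        (Finset.eventually_all _).2 fun m _ => hcl m
      filter_upwards [ih, mem_nhdsWithin_of_mem_nhds hall] with y' h1 h2
      rw [hist_succ, hist_succ, h1]
      congr 1
      rw [play_eq, play_eq (gc e L τ y), h1]
      have hex' : ∃ m, Qc e L τ y' (hist (play (gc e L τ y)) (2 * k)) m :=
        ⟨Nat.find hex, (h2 _ (by simp)).2 (Nat.find_spec hex)⟩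
      have hf : Nat.find hex' = Nat.find hex := by
        rw [Nat.find_eq_iff]
        refine ⟨(h2 _ (by simp)).2 (Nat.find_spec hex), fun j hj hc => ?_⟩
        exact Nat.find_min hex hj ((h2 j (Finset.mem_range.2 (by omega))).1 hc)
      rw [gc_eq e L τ (by rw [hist_length]; omega) hex', gc_eq e L τ (by rw [hist_length]; omega) hex,
        hf]
    · filter_upwards [ih] with y' h1
      rw [hist_succ _ (2 * k + 1), hist_succ _ (2 * k + 1), h1]
      congr 1
      rw [gc_cons e L τ y' _ (Nat.zero_le _) (by omega), h1,
        ← gc_cons e L τ y _ (Nat.zero_le _) (by omega)]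

end chooser

lemma trap_countable {e : ℕ → Bool → Set Cs} (he : ∀ m c, IsClopen (e m c))
    (hs : ∀ f : Bool → Set Cs, (∀ c, IsClopen (f c)) → ∃ m, e m = f)
    {L : Set Cs} (hp : Perf L) (τ : List Pm → Pm) : (Trap e L τ).Countable := by
  have : Trap e L τ ⊆ ⋃ t : List Pm, {y | y ∈ L ∧ y ∈ Wl e t ∧ ¬ ∃ m, Qc e L τ y t m} := by
    rintro y ⟨h1, t, h2, h3⟩
    exact Set.mem_iUnion.2 ⟨t, h1, h2, h3⟩
  refine (Set.countable_iUnion fun t => Set.Subsingleton.countable ?_).mono this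
  rintro y ⟨hy1, hy2, hy3⟩ y' ⟨hy1', hy2', hy3'⟩
  by_contra hne
  have hn : NwdIn ({y} ∪ {y'}) L := NwdIn.union isClosed_singleton (hp y) (hp y')
  obtain ⟨z, ⟨hzL, hzW⟩, hz⟩ := hn (Wl e t) (Wl_clopen he t).2 ⟨y, hy1, hy2⟩
  have hzy : y ≠ z := fun h => hz (Or.inl h.symm)
  have hzy' : y' ≠ z := fun h => hz (Or.inr h.symm)
  obtain ⟨p, hpc, hyp, hps⟩ := clopen_nhd (O := Wl e t ∩ {w | ∀ j < t.length + 1, w j = y j} ∩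
      ({z}ᶜ ∩ {y'}ᶜ)) (((Wl_clopen he t).2.inter (cyl_open y _)).inter
      (isClosed_singleton.isOpen_compl.inter isClosed_singleton.isOpen_compl))
      ⟨⟨hy2, fun _ _ => rfl⟩, hzy, hne⟩
  obtain ⟨q, hqc, hyq, hqs⟩ := clopen_nhd (O := Wl e t ∩ {w | ∀ j < t.length + 1, w j = y' j} ∩
      ({z}ᶜ ∩ pᶜ)) (((Wl_clopen he t).2.inter (cyl_open y' _)).inter
      (isClosed_singleton.isOpen_compl.inter hpc.1.isOpen_compl))
      ⟨⟨hy2', fun _ _ => rfl⟩, hzy', fun h => (hps h).2.2 rfl⟩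
  obtain ⟨m, hm⟩ := hs (fun c => cond c p q) (fun c => by cases c; exacts [hqc, hpc])
  have hlg : Lg e L t m := by
    constructor
    · rw [hm]; intro c w hw
      cases c
      · exact (hqs hw).1.1
      · exact (hps hw).1.1
    · rw [hm]
      exact Set.disjoint_left.2 fun w hw hw' => (hqs hw').2.2 hw
    · rw [hm]; intro c
      cases c
      · exact ⟨y', hy1', hyq⟩
      · exact ⟨y, hy1, hyp⟩
    · rw [hm]
      refine ⟨z, ⟨hzL, hzW⟩, ?_⟩
      rintro (h | h)
      · exact (hps h).2.1 rfl
      · exact (hqs h).2.1 rfl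
    · rw [hm]; intro c
      cases c
      · exact fun w hw w' hw' j hj => ((hqs hw).1.2 j hj).trans ((hqs hw').1.2 j hj).symm
      · exact fun w hw w' hw' j hj => ((hps hw).1.2 j hj).trans ((hps hw').1.2 j hj).symm
  cases hc : (τ ((m, false) :: t)).2 with
  | true => exact hy3 ⟨m, hlg, by rw [hc, hm]; exact hyp⟩
  | false => exact hy3' ⟨m, hlg, by rw [hc, hm]; exact hyq⟩

theorem lemmaG {A B V L : Set Cs} (hA : @MeasurableSet Cs (borel Cs) A)
    (hB : @MeasurableSet Cs (borel Cs) B) (hV : IsClosed V) (hL : IsClosed L) (hp : Perf L)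
    (hno : ¬ Emb A B V L) :
    ∃ (T : Set Cs) (Pl : Set Pw) (b : Pw → Cs) (P : Cs → Pw), T.Countable ∧ IsClosed Pl ∧
      Continuous b ∧ ContinuousOn P (L \ T) ∧ (∀ y ∈ L \ T, P y ∈ Pl ∧ b (P y) = y) ∧
      ∀ π ∈ Pl, aa π ∈ V ∧ b π ∈ L ∧ (aa π ∈ A ↔ b π ∉ B) := by
  obtain ⟨e, he, hs⟩ : ∃ e : ℕ → Bool → Set Cs, (∀ m c, IsClopen (e m c)) ∧
      ∀ f : Bool → Set Cs, (∀ c, IsClopen (f c)) → ∃ m, e m = f := by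
    have hc := countable_clopens.to_subtype
    have hn : Nonempty (Bool → {W : Set Cs | IsClopen W}) := ⟨fun _ => ⟨∅, isClopen_empty⟩⟩
    obtain ⟨g, hg⟩ := exists_surjective_nat (Bool → {W : Set Cs | IsClopen W})
    refine ⟨fun m c => (g m c).1, fun m c => (g m c).2, fun f hf => ?_⟩
    obtain ⟨m, hm⟩ := hg fun c => ⟨f c, hf c⟩
    exact ⟨m, by funext c; show (g m c).1 = f c; rw [hm]⟩
  set X : Set Pw := {π | LgP e L π ∧ (aa π ∈ V → (aa π ∈ A ↔ bb e π ∈ B))} with hX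
  have hXm : @MeasurableSet Pw (borel Pw) X := by
    let _ : MeasurableSpace Pw := borel Pw
    have : BorelSpace Pw := ⟨rfl⟩
    let _ : MeasurableSpace Cs := borel Cs
    have : BorelSpace Cs := ⟨rfl⟩
    have h1 : MeasurableSet {π | LgP e L π} := (lgp_closed e L).measurableSet
    have h2 : MeasurableSet (aa ⁻¹' V) := aa_cont.measurable hV.measurableSet
    have h3 : MeasurableSet (aa ⁻¹' A) := aa_cont.measurable hA
    have h4 : MeasurableSet (bb e ⁻¹' B) := (bb_cont e).measurable hB
    have : X = {π | LgP e L π} ∩ ((aa ⁻¹' V)ᶜ ∪ ((aa ⁻¹' A ∩ bb e ⁻¹' B) ∪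
        ((aa ⁻¹' A)ᶜ ∩ (bb e ⁻¹' B)ᶜ))) := by
      ext π
      simp only [hX, Set.mem_ofPred_eq, Set.mem_inter_iff, Set.mem_union, Set.mem_compl_iff,
        Set.mem_preimage]
      tauto
    rw [this]
    exact h1.inter (h2.compl.union ((h3.inter h4).union (h3.compl.inter h4.compl)))
  have hT : IsTree (Set.univ : Set (List Pm)) :=
    ⟨trivial, fun _ _ _ => trivial, fun _ _ => ⟨(0, false), trivial⟩⟩
  rcases (unr_borel hXm).det hT with ⟨σ, _, hw⟩ | ⟨τ, _, hw⟩
  · exact absurd (emb_of_win he hV hL σ fun π hc => hw π (fun _ => trivial) hc) hno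
  · refine ⟨Trap e L τ, {π | ConsF 0 1 τ π} ∩ {π | LgP e L π}, bb e,
      fun y => play (gc e L τ y), trap_countable he hs hp τ,
      (consF_closed 1 τ).inter (lgp_closed e L), bb_cont e, gc_contOn e L τ he, ?_, ?_⟩
    · intro y hy
      exact ⟨⟨gc_cons e L τ y, gc_lgp e L τ hy⟩, bb_eq (gc_lgp e L τ hy) (gc_mem e L τ hy)⟩
    · rintro π ⟨h1, h2⟩
      have h3 : ¬ (LgP e L π ∧ (aa π ∈ V → (aa π ∈ A ↔ bb e π ∈ B))) :=
        hw π (fun _ => trivial) h1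
      have h2' : LgP e L π := h2
      have := (bb_mem he hL h2').1
      tauto

end SH

end

section
namespace SH
open Topology Filter

def flip1 (k : ℕ) (y : Cs) : Cs := Function.update y k (!(y k))

lemma flip1_cont (k : ℕ) : Continuous (flip1 k) := by
  unfold flip1
  exact continuous_id.update k ((continuous_of_discreteTopology (f := fun b : Bool => !b)).comp (continuous_apply k))

lemma flip1_flip1 (k : ℕ) (y : Cs) : flip1 k (flip1 k y) = y := by
  simp [flip1]

lemma flip1_ne {k i : ℕ} (h : i ≠ k) (y : Cs) : flip1 k y i = y i := by
  simp [flip1, h]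

lemma no_flip {S : Set Cs} (hS : @MeasurableSet Cs (borel Cs) S)
    (hf : ∀ k y, (y ∈ S ↔ flip1 k y ∉ S)) : False := by
  obtain ⟨K, N, ⟨hne, W, hW, hKW⟩, hN, C, hC, hCn, hcov⟩ := baire_prop hS isClosed_univ ⟨fun _ => false, trivial⟩
  rw [Set.univ_inter] at hKW
  subst hKW
  obtain ⟨y, hy⟩ := hne
  obtain ⟨k, hk⟩ := cyl_sub hW.2 hy
  set K' : Set Cs := {z | ∀ j < k, z j = y j} with hK'
  have hK'o : IsOpen K' := cyl_open y k
  have hinv : ∀ z ∈ K', flip1 k z ∈ K' := fun z hz j hj => by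
    rw [flip1_ne (by omega)]; exact hz j hj
  have hn1 : ∀ i, NwdIn (C i) K' := by
    intro i O hO ⟨z, hz, hzO⟩
    obtain ⟨w, ⟨_, h2, h3⟩, h4⟩ := hCn i (K' ∩ O) (hK'o.inter hO) ⟨z, hk z hz, hz, hzO⟩
    exact ⟨w, ⟨h2, h3⟩, h4⟩
  have hn2 : ∀ i, NwdIn (flip1 k ⁻¹' C i) K' := by
    intro i O hO ⟨z, hz, hzO⟩
    obtain ⟨w, ⟨h2, h3⟩, h4⟩ := hn1 i (flip1 k ⁻¹' O) (hO.preimage (flip1_cont k))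
      ⟨flip1 k z, hinv z hz, by show flip1 k (flip1 k z) ∈ O; rwa [flip1_flip1]⟩
    exact ⟨flip1 k w, ⟨hinv w h2, h3⟩, by
      show ¬ flip1 k (flip1 k w) ∈ C i; rwa [flip1_flip1]⟩
  have hcl : IsClosed K' := by
    have : K' = ⋂ j ∈ Finset.range k, {z : Cs | z j = y j} := by
      ext z; simp [hK']
    rw [this]
    exact isClosed_biInter fun j _ => (isClopen_coord j (y j)).1
  have hsig : Sig (fun E => NwdIn E K') K' := by
    refine ⟨Set.range C ∪ Set.range (fun i => flip1 k ⁻¹' C i),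
      (Set.countable_range _).union (Set.countable_range _), ?_, ?_⟩
    · rintro E (⟨i, rfl⟩ | ⟨i, rfl⟩)
      · exact ⟨hC i, hn1 i⟩
      · exact ⟨(hC i).preimage (flip1_cont k), hn2 i⟩
    · intro z hz
      have hor : z ∈ N ∨ flip1 k z ∈ N := by
        have := hf k z
        rcases hN with rfl | rfl
        · tauto
        · show z ∉ S ∨ flip1 k z ∉ S
          tauto
      rcases hor with h | h
      · obtain ⟨i, hi⟩ := Set.mem_iUnion.1 (hcov ⟨h, hk z hz⟩)
        exact ⟨C i, Or.inl ⟨i, rfl⟩, hi⟩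
      · obtain ⟨i, hi⟩ := Set.mem_iUnion.1 (hcov ⟨h, hk _ (hinv z hz)⟩)
        exact ⟨flip1 k ⁻¹' C i, Or.inr ⟨i, rfl⟩, hi⟩
  obtain ⟨E, hE, hEn, W', hW', hne', hsub⟩ := baire hcl ⟨y, fun _ _ => rfl⟩ hsig
  obtain ⟨z, hz, hzE⟩ := hEn W' hW'.2 hne'
  exact hzE (hsub hz)

lemma mm_sign {A K N : Set Cs} {D : ℕ → Set Cs} (hB : Bad A K N D) :
    ∃ U0, Part U0 K ∧ ∀ V U, Part U U0 → Wit A V U → ∀ m, ∃ U' C, Part U' U ∧ Wit A C U' ∧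
      ¬ Emb A A V C ∧ ¬ Emb A Aᶜ V C ∧ ¬ Sig (Low A m) C := by
  by_cases hcase : ∃ U, Part U K ∧ ∀ U1 C C'', Part U1 U → Wit A C U1 → IsClosed C'' → C'' ⊆ U1 →
      ¬ Emb A Aᶜ C C''
  · obtain ⟨U0, hU0, h⟩ := hcase
    refine ⟨U0, hU0, fun V U hU hV m => ?_⟩
    obtain ⟨U', hU', hno⟩ := hV.2.2.2.2 V (Part.refl hV.2.1)
    obtain ⟨U2, hU2, hL⟩ := claimL hB m ((hU'.trans hU).trans hU0)
    obtain ⟨C, hC⟩ := wit_exists hB (hU2.trans ((hU'.trans hU).trans hU0))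
    have hCU' : C ⊆ U' := hC.2.2.1.trans hU2.subset
    refine ⟨U2, C, hU2.trans hU', hC, fun he => hno (he.mono_right hC.1 hCU'), ?_,
      hL U2 (Part.refl hU2.1) C hC⟩
    exact h U V C hU hV hC.1 (hCU'.trans hU'.subset)
  · push Not at hcase
    refine ⟨K, Part.refl hB.ne, fun V U hU hV m => ?_⟩
    obtain ⟨U', hU', hno⟩ := hV.2.2.2.2 V (Part.refl hV.2.1)
    obtain ⟨U2, hU2, hL⟩ := claimL hB m (hU'.trans hU)
    obtain ⟨U3, C, C'', hU3, hC, hC''c, hC'', he⟩ := hcase U2 (hU2.trans (hU'.trans hU))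
    have hCU' : C ⊆ U' := hC.2.2.1.trans (hU3.trans hU2).subset
    refine ⟨U3, C, (hU3.trans hU2).trans hU', hC, fun he => hno (he.mono_right hC.1 hCU'), ?_,
      hL U3 hU3 C hC⟩
    intro he'
    have h1 : Emb Aᶜ A C C'' := by
      have := he.compl
      rwa [compl_compl] at this
    exact hno ((he'.pemb.trans_emb h1).mono_right hC''c (hC''.trans (hU3.trans hU2).subset))

structure MS (A U0 : Set Cs) (n : ℕ) where
  V : Set Cs
  U : Set Cs
  D : Set Cs
  Φ : Cs → ℕ → Cs → Pw
  hU : Part U U0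
  hW : Wit A V U
  hD : D ⊆ V
  hne : D.Nonempty
  hsig : Sig (Low A n) (V \ D)
  hc : ∀ y j, ContinuousOn (Φ y j) D
  hloc : ∀ y y' : Cs, (∀ i < n, y i = y' i) → Φ y = Φ y'
  hcon : ∀ y j, j < n → ∀ z ∈ D, ∀ z' ∈ D, hist (Φ y j z) n = hist (Φ y j z') n

structure MR {A U0 : Set Cs} {n : ℕ} (s : MS A U0 n) (s' : MS A U0 (n + 1))
    (Pl : Bool → Set Pw) (b : Bool → Pw → Cs) (P : Bool → Cs → Pw) : Prop where
  cl : ∀ c, IsClosed (Pl c)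
  bc : ∀ c, Continuous (b c)
  sg : ∀ c, ∀ π ∈ Pl c, (aa π ∈ A ↔ (b c π ∈ A ↔ c = true))
  mem : ∀ c, ∀ z ∈ s'.D, P c z ∈ Pl c ∧ b c (P c z) = z ∧ aa (P c z) ∈ s.D
  eq : ∀ y j z, s'.Φ y j z = if j < n then s.Φ y j (aa (P (y n) z)) else P (y n) z

lemma mm_step {A K N U0 : Set Cs} {D : ℕ → Set Cs} (hA : @MeasurableSet Cs (borel Cs) A)
    (hB : Bad A K N D) (hU0 : Part U0 K)
    (hstep : ∀ V U, Part U U0 → Wit A V U → ∀ m, ∃ U' C, Part U' U ∧ Wit A C U' ∧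
      ¬ Emb A A V C ∧ ¬ Emb A Aᶜ V C ∧ ¬ Sig (Low A m) C) (n : ℕ) (s : MS A U0 n) :
    ∃ (s' : MS A U0 (n + 1)) (Pl : Bool → Set Pw) (b : Bool → Pw → Cs) (P : Bool → Cs → Pw),
      MR s s' Pl b P := by
  obtain ⟨U', C, hU', hC, hn1, hn2, hns⟩ := hstep s.V s.U s.hU s.hW (n + 1)
  have hperf : Perf C := hC.perf hB ((hU'.trans s.hU).trans hU0)
  have hA' : @MeasurableSet Cs (borel Cs) Aᶜ := @MeasurableSet.compl _ _ (borel Cs) hA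
  have hG : ∀ c : Bool, ∃ (T : Set Cs) (Pl : Set Pw) (b : Pw → Cs) (P : Cs → Pw),
      T.Countable ∧ IsClosed Pl ∧ Continuous b ∧ ContinuousOn P (C \ T) ∧
      (∀ y ∈ C \ T, P y ∈ Pl ∧ b (P y) = y) ∧
      ∀ π ∈ Pl, aa π ∈ s.V ∧ b π ∈ C ∧ (aa π ∈ A ↔ (b π ∈ A ↔ c = true)) := by
    intro c
    cases c with
    | false =>
      obtain ⟨T, Pl, b, P, h1, h2, h3, h4, h5, h6⟩ := lemmaG hA hA s.hW.1 hC.1 hperf hn1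
      refine ⟨T, Pl, b, P, h1, h2, h3, h4, h5, fun π hπ => ?_⟩
      obtain ⟨q1, q2, q3⟩ := h6 π hπ
      exact ⟨q1, q2, by simpa using q3⟩
    | true =>
      obtain ⟨T, Pl, b, P, h1, h2, h3, h4, h5, h6⟩ := lemmaG hA hA' s.hW.1 hC.1 hperf hn2
      refine ⟨T, Pl, b, P, h1, h2, h3, h4, h5, fun π hπ => ?_⟩
      obtain ⟨q1, q2, q3⟩ := h6 π hπ
      exact ⟨q1, q2, by simpa using q3⟩
  choose T Pl b P hT hPl hb hP hPm hPs using hG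
  set D' : Set Cs := {z | z ∈ C ∧ ∀ c, z ∉ T c ∧ aa (P c z) ∈ s.D} with hD'
  have hD'T : ∀ c, D' ⊆ C \ T c := fun c z hz => ⟨hz.1, (hz.2 c).1⟩
  have hsig : Sig (Low A (n + 1)) (C \ D') := by
    have h1 : ∀ c : Bool, Sig (Low A (n + 1)) (T c ∪ {z ∈ C \ T c | (fun z => aa (P c z)) z ∈ s.V \ s.D}) := by
      intro c
      refine (SigLow.countable (hT c)).union ?_
      refine pull_sig s.hsig hC.1 (hT c) (aa_cont.comp_continuousOn (hP c)) (c = true) ?_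
      intro x hx
      obtain ⟨q1, q2⟩ := hPm c x hx
      have := (hPs c _ q1).2.2
      rw [q2] at this
      tauto
    refine (Sig.iUnion h1).mono ?_
    rintro z ⟨hz, hzD⟩
    have : ∃ c, z ∈ T c ∨ aa (P c z) ∉ s.D := by
      by_contra hcon
      push Not at hcon
      exact hzD ⟨hz, hcon⟩
    obtain ⟨c, hc⟩ := this
    refine Set.mem_iUnion.2 ⟨c, ?_⟩
    by_cases hzT : z ∈ T c
    · exact Or.inl hzT
    · exact Or.inr ⟨⟨hz, hzT⟩, (hPs c _ (hPm c z ⟨hz, hzT⟩).1).1, hc.resolve_left hzT⟩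
  obtain ⟨x, hx⟩ : D'.Nonempty := by
    by_contra hcon
    rw [Set.not_nonempty_iff_eq_empty] at hcon
    rw [hcon, Set.sdiff_empty] at hsig
    exact hns hsig
  set Φ' : Cs → ℕ → Cs → Pw := fun y j z =>
    if j < n then s.Φ y j (aa (P (y n) z)) else P (y n) z with hΦ'
  have hcΦ : ∀ y j, ContinuousOn (Φ' y j) D' := by
    intro y j
    have hPD : ContinuousOn (P (y n)) D' := (hP _).mono (hD'T _)
    by_cases hj : j < n
    · have : Φ' y j = fun z => s.Φ y j (aa (P (y n) z)) := by
        funext z; simp only [hΦ', if_pos hj]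
      rw [this]
      exact (s.hc y j).comp (aa_cont.comp_continuousOn hPD) fun z hz => (hz.2 _).2
    · have : Φ' y j = P (y n) := by
        funext z; simp only [hΦ', if_neg hj]
      rw [this]; exact hPD
  have hlocΦ : ∀ y y' : Cs, (∀ i < n + 1, y i = y' i) → Φ' y = Φ' y' := by
    intro y y' h
    funext j z
    simp only [hΦ', h n (by omega), s.hloc y y' fun i hi => h i (by omega)]
  have hev : ∀ᶠ z in 𝓝[D'] x, ∀ (u : Fin (n + 1) → Bool) (j : Fin (n + 1)),
      hist (Φ' (fun i => if h : i < n + 1 then u ⟨i, h⟩ else false) j z) (n + 1) =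
      hist (Φ' (fun i => if h : i < n + 1 then u ⟨i, h⟩ else false) j x) (n + 1) := by
    rw [eventually_all]; intro u
    rw [eventually_all]; intro j
    exact (hcΦ _ j x hx).eventually (hist_nhds _ (n + 1))
  obtain ⟨O, hO, hxO, hOs⟩ := mem_nhdsWithin.1 hev
  obtain ⟨W, hW, hxW, hWO⟩ := clopen_nhd hO hxO
  have hcon : ∀ y j, j < n + 1 → ∀ z ∈ D' ∩ W, hist (Φ' y j z) (n + 1) = hist (Φ' y j x) (n + 1) := by
    intro y j hj z hz
    have h1 := hOs ⟨hWO hz.2, hz.1⟩ (fun i => y i) ⟨j, hj⟩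
    rw [hlocΦ y (fun i => if h : i < n + 1 then y i else false) fun i hi => by simp [hi]]
    exact h1
  refine ⟨⟨C ∩ W, U', D' ∩ W, Φ', hU'.trans s.hU, hC.part (Part.mk' hW ⟨x, hx.1, hxW⟩),
    Set.inter_subset_inter_left _ fun z hz => hz.1, ⟨x, hx, hxW⟩, hsig.mono ?_,
    fun y j => (hcΦ y j).mono Set.inter_subset_left, hlocΦ, fun y j hj z hz z' hz' =>
      (hcon y j hj z hz).trans (hcon y j hj z' hz').symm⟩, Pl, b, P, hPl, hb,
      fun c π hπ => (hPs c π hπ).2.2, ?_, fun y j z => rfl⟩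
  · rintro z ⟨⟨h1, h2⟩, h3⟩
    exact ⟨h1, fun h => h3 ⟨h, h2⟩⟩
  · rintro c z ⟨hz, _⟩
    exact ⟨(hPm c z (hD'T c hz)).1, (hPm c z (hD'T c hz)).2, (hz.2 c).2⟩

lemma tendsto_of_hist {f : ℕ → Pw} {π : Pw} (h : ∀ m, ∀ᶠ n in atTop, hist (f n) m = hist π m) :
    Tendsto f atTop (𝓝 π) := by
  refine tendsto_pi_nhds.2 fun m => ?_
  refine (tendsto_const_nhds (x := π m)).congr' ?_
  filter_upwards [h (m + 1)] with n hn
  exact (hist_eval hn (Nat.lt_succ_self m)).symm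

theorem no_bad {A K N : Set Cs} {D0 : ℕ → Set Cs} (hA : @MeasurableSet Cs (borel Cs) A)
    (hB : Bad A K N D0) : False := by
  obtain ⟨U0, hU0, hstep⟩ := mm_sign hB
  obtain ⟨V0, hV0⟩ := wit_exists hB hU0
  choose nx Pl0 b0 P0 hR using mm_step hA hB hU0 hstep
  let s : ∀ n, MS A U0 n := fun n => Nat.rec
    ⟨V0, U0, V0, fun _ _ _ _ => (0, false), Part.refl hU0.1, hV0, le_rfl, hV0.2.1, by
      rw [Set.sdiff_self]; exact SigLow.countable Set.countable_empty,
      fun _ _ => continuousOn_const, fun _ _ _ => rfl, fun _ _ h => absurd h (Nat.not_lt_zero _)⟩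
    (fun n s => nx n s) n
  set Pl := fun n => Pl0 n (s n) with hPl
  set b := fun n => b0 n (s n) with hb
  set P := fun n => P0 n (s n) with hP
  have hM : ∀ n, MR (s n) (s (n + 1)) (Pl n) (b n) (P n) := fun n => hR n (s n)
  have F1 : ∀ n y j z, j < n → z ∈ (s n).D → (s n).Φ y j z ∈ Pl j (y j) := by
    intro n
    induction n with
    | zero => intro y j z hj; omega
    | succ n ih =>
      intro y j z hj hz
      rw [(hM n).eq]
      split_ifs with h
      · exact ih _ _ _ h ((hM n).mem _ z hz).2.2
      · obtain rfl : j = n := by omega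
        exact ((hM j).mem _ z hz).1
  have F2 : ∀ n y j z, j + 1 < n → z ∈ (s n).D →
      b j (y j) ((s n).Φ y j z) = aa ((s n).Φ y (j + 1) z) := by
    intro n
    induction n with
    | zero => intro y j z hj; omega
    | succ n ih =>
      intro y j z hj hz
      rw [(hM n).eq, (hM n).eq, if_pos (by omega)]
      have hm := ((hM n).mem (y n) z hz).2.2
      by_cases h : j + 1 < n
      · rw [if_pos h]; exact ih _ _ _ h hm
      · rw [if_neg h]
        obtain rfl : n = j + 1 := by omega
        rw [(hM j).eq, if_neg (by omega)]
        exact ((hM j).mem _ _ hm).2.1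
  have F3 : ∀ n (y y' : Cs) j z, j < n → (∀ i, j ≤ i → y i = y' i) →
      (s n).Φ y j z = (s n).Φ y' j z := by
    intro n
    induction n with
    | zero => intro y y' j z hj; omega
    | succ n ih =>
      intro y y' j z hj hy
      rw [(hM n).eq, (hM n).eq, hy n (by omega)]
      split_ifs with h
      · exact ih _ _ _ _ h hy
      · rfl
  have F4 : ∀ n y j m, j < n → n ≤ m → ∀ z ∈ (s n).D, ∀ z' ∈ (s m).D,
      hist ((s m).Φ y j z') n = hist ((s n).Φ y j z) n := by
    intro n y j m hj hm
    induction m, hm using Nat.le_induction with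
    | base => exact fun z hz z' hz' => (s n).hcon y j hj z' hz' z hz
    | succ m hm ih =>
      intro z hz z' hz'
      rw [(hM m).eq, if_pos (by omega)]
      exact ih z hz _ ((hM m).mem _ z' hz').2.2
  choose x hx using fun n => (s n).hne
  set lim : ℕ → Cs → Pw := fun j y i => (s (j + i + 1)).Φ y j (x (j + i + 1)) i with hlim
  have L1 : ∀ j y m n, j < n → m ≤ n → hist (lim j y) m = hist ((s n).Φ y j (x n)) m := by
    intro j y m n hj hm
    refine hist_ext fun i hi => ?_
    show (s (j + i + 1)).Φ y j (x (j + i + 1)) i = _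
    rcases le_total n (j + i + 1) with h | h
    · exact hist_eval (F4 n y j (j + i + 1) hj h _ (hx n) _ (hx _)) (by omega)
    · exact (hist_eval (F4 (j + i + 1) y j n (by omega) h _ (hx _) _ (hx n)) (by omega)).symm
  have L2 : ∀ j y, Tendsto (fun n => (s n).Φ y j (x n)) atTop (𝓝 (lim j y)) := by
    intro j y
    refine tendsto_of_hist fun m => ?_
    filter_upwards [eventually_ge_atTop (j + 1 + m)] with n hn
    exact (L1 j y m n (by omega) (by omega)).symm
  have L3 : ∀ j y, lim j y ∈ Pl j (y j) := by
    intro j y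
    refine ((hM j).cl (y j)).mem_of_tendsto (L2 j y) ?_
    filter_upwards [eventually_ge_atTop (j + 1)] with n hn
    exact F1 n y j _ (by omega) (hx n)
  have L4 : ∀ j y, b j (y j) (lim j y) = aa (lim (j + 1) y) := by
    intro j y
    have t1 := (((hM j).bc (y j)).tendsto _).comp (L2 j y)
    have t2 := (aa_cont.tendsto _).comp (L2 (j + 1) y)
    refine tendsto_nhds_unique (t1.congr' ?_) t2
    filter_upwards [eventually_ge_atTop (j + 2)] with n hn
    exact F2 n y j _ (by omega) (hx n)
  have L5 : ∀ j (y y' : Cs), (∀ i, j ≤ i → y i = y' i) → lim j y = lim j y' := by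
    intro j y y' h
    funext i
    show (s (j + i + 1)).Φ y j (x (j + i + 1)) i = (s (j + i + 1)).Φ y' j (x (j + i + 1)) i
    rw [F3 _ y y' j _ (by omega) h]
  have L6 : Continuous (lim 0) := by
    rw [← continuousOn_univ]
    intro y _
    refine cwa_of_hist fun n => ?_
    rw [nhdsWithin_univ]
    filter_upwards [(cyl_open y (n + 1)).mem_nhds (fun j _ => rfl)] with y' hy'
    rw [L1 0 y' n (n + 1) (by omega) (by omega), L1 0 y n (n + 1) (by omega) (by omega),
      (s (n + 1)).hloc y' y hy']
  have L7 : ∀ j y, (aa (lim j y) ∈ A ↔ (aa (lim (j + 1) y) ∈ A ↔ y j = true)) := by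
    intro j y
    rw [← L4]
    exact (hM j).sg _ _ (L3 j y)
  refine no_flip (S := {y | aa (lim 0 y) ∈ A}) ?_ ?_
  · let _ : MeasurableSpace Cs := borel Cs
    have : BorelSpace Cs := ⟨rfl⟩
    exact (aa_cont.comp L6).measurable hA
  · intro k y
    have key : ∀ d j, j + d = k → (aa (lim j y) ∈ A ↔ aa (lim j (flip1 k y)) ∉ A) := by
      intro d
      induction d with
      | zero =>
        intro j hj
        obtain rfl : j = k := hj
        rw [L7, L7 j]
        rw [L5 (j + 1) (flip1 j y) y fun i hi => flip1_ne (by omega) y]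
        have : flip1 j y j = !(y j) := by simp [flip1]
        rw [this]
        cases y j <;> simp
      | succ d ih =>
        intro j hj
        rw [L7, L7 j, flip1_ne (by omega)]
        have := ih (j + 1) (by omega)
        tauto
    exact key k 0 (by omega)

end SH

end

/-- Every Borel subset `X` of the Cantor space `ℕ → Bool` is σ-homogeneous:
it is a countable union of subspaces `f i`, each closed in `X` and
h-homogeneous in the subspace topology. -/
theorem borel_sigmaHomogeneous (X : Set (ℕ → Bool))
    (hX : @MeasurableSet (ℕ → Bool) (borel (ℕ → Bool)) X) :
    ∃ f : ℕ → Set (ℕ → Bool),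
      (∀ i, f i ⊆ X) ∧
      (∀ i, IsClosed (Subtype.val ⁻¹' f i : Set ↥X)) ∧
      (∀ i, HHomogeneous ↥(f i)) ∧
      X = ⋃ i, f i := by
  by_contra hno
  obtain ⟨K, N, C, hB⟩ := SH.start hX hno
  exact SH.no_bad hX hB
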